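/- Let k ≥ m ≥ 2 and let A = {a_1,…,a_k} and B = {b_1,…,b_m} be free bases of F(A) and F(B). There exist exponentially generic subsets V ⊆ C_{m,A} and U ⊆ C_{k,B} with the following property: for every (u_1,…,u_k) ∈ U and (v_1,…,v_m) ∈ V, in the group G = ⟨a_1,…,a_k, b_1,…,b_m | a_i = u_i(b̄) for 1 ≤ i ≤ k, b_j = v_j(ā) for 1 ≤ j ≤ m⟩, the k-tuple (a_1,…,a_k) is not Nielsen equivalent in G to any k-tuple whose first entry is b_1. -/

import Mathlib

/-!
Nielsen equivalence in small cancellation groups (Kapovich–Weidmann).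

STATEMENT 2: for k ≥ m ≥ 2 there are exponentially generic sets V ⊆ C_{m,A},
U ⊆ C_{k,B} such that for (u₁,…,u_k) ∈ U, (v₁,…,v_m) ∈ V, in
G = ⟨a,b | aᵢ = uᵢ(b̄), bⱼ = vⱼ(ā)⟩ the k-tuple (a₁,…,a_k) is not Nielsen
equivalent to any k-tuple whose first entry is b₁.
-/

def ElemEquiv {G : Type*} [Group G] {k : ℕ} (T T' : Fin k → G) : Prop :=
  (∃ σ : Equiv.Perm (Fin k), ∀ i, T' i = T (σ i)) ∨
  (∃ i, T' i = (T i)⁻¹ ∧ ∀ j, j ≠ i → T' j = T j) ∨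
  (∃ i j, i ≠ j ∧ T' i = T i * T j ∧ ∀ t, t ≠ i → T' t = T t)

/-- Nielsen equivalence of `k`-tuples: a finite chain of elementary moves. -/
def NielsenEquiv {G : Type*} [Group G] {k : ℕ} (T T' : Fin k → G) : Prop :=
  Relation.EqvGen ElemEquiv T T'

/-- The length of the freely reduced word representing `g`. -/
def wlen {α : Type} [DecidableEq α] (g : FreeGroup α) : ℕ := g.toWord.length

/-- `g` is cyclically reduced: in its reduced word the first letter is not
the inverse of the last letter. -/
def CyclicallyReduced {α : Type} [DecidableEq α] (g : FreeGroup α) : Prop :=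
  ∀ x y : α × Bool, g.toWord.head? = some x → g.toWord.getLast? = some y →
    x ≠ (y.1, !y.2)

/-- `C_{m,A}`: the set of `m`-tuples of cyclically reduced words in the free
group of rank `k`, all entries of equal length. -/
def Cset (k m : ℕ) : Set (Fin m → FreeGroup (Fin k)) :=
  {T | (∀ i, CyclicallyReduced (T i)) ∧ ∀ i j, wlen (T i) = wlen (T j)}

/-- `γ_A(n,U)`: the number of tuples in `U` all of whose entries have length `n`. -/
noncomputable def gammaA {k m : ℕ} (U : Set (Fin m → FreeGroup (Fin k))) (n : ℕ) : ℕ :=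
  Set.ncard {T | T ∈ U ∧ ∀ i, wlen (T i) = n}

/-- `U` is an exponentially generic subset of `C_{m,A}`:
`γ(n,U)/γ(n,C_{m,A}) → 1` exponentially fast. -/
def ExpGenericIn {k m : ℕ} (U : Set (Fin m → FreeGroup (Fin k))) : Prop :=
  U ⊆ Cset k m ∧ ∃ C : ℝ, 0 < C ∧ ∃ q : ℝ, 0 < q ∧ q < 1 ∧
    ∀ n : ℕ, |((gammaA U n : ℝ) / (gammaA (Cset k m) n : ℝ)) - 1| ≤ C * q ^ n

/-- The defining relations `aᵢ = uᵢ(b̄)`, `bⱼ = vⱼ(ā)` of the presentation (†). -/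
def mixedRels {k m : ℕ} (u : Fin k → FreeGroup (Fin m)) (v : Fin m → FreeGroup (Fin k)) :
    Set (FreeGroup (Fin k ⊕ Fin m)) :=
  (Set.range fun i : Fin k =>
    FreeGroup.of (Sum.inl i) * (FreeGroup.map Sum.inr (u i))⁻¹) ∪
  (Set.range fun j : Fin m =>
    FreeGroup.of (Sum.inr j) * (FreeGroup.map Sum.inl (v j))⁻¹)

set_option linter.all false
namespace KW
theorem take_pre {β : Type*} (n : ℕ) (L : List β) : L.take n <+: L := ⟨L.drop n, List.take_append_drop n L⟩

theorem pre_or_pre {β : Type*} {a b c : List β} (h1 : a <+: c) (h2 : b <+: c) : a <+: b ∨ b <+: a :=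
  (le_total a.length b.length).imp (List.prefix_of_prefix_length_le h1 h2) (List.prefix_of_prefix_length_le h2 h1)

theorem _root_.FreeGroup.IsReduced.subw {α : Type*} {L z : List (α × Bool)} (h : FreeGroup.IsReduced L)
    (hz : z <:+: L) : FreeGroup.IsReduced z := by
  obtain ⟨p, s, rfl⟩ := hz
  exact List.IsChain.right_of_append (List.IsChain.left_of_append h)

section P1
variable {α : Type} [DecidableEq α]

/-- tree distance on the free group -/
def td (x y : FreeGroup α) : ℕ := (x⁻¹ * y).norm

/-- betweenness -/
def Btw (x z y : FreeGroup α) : Prop := td x z + td z y = td x y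

theorem td_self (x : FreeGroup α) : td x x = 0 := by simp [td]
theorem td_comm (x y : FreeGroup α) : td x y = td y x := by
  unfold td; rw [← FreeGroup.norm_inv_eq]; simp
theorem td_eq_zero {x y : FreeGroup α} : td x y = 0 ↔ x = y := by
  unfold td; rw [FreeGroup.norm_eq_zero, inv_mul_eq_one]
theorem td_tri (x y z : FreeGroup α) : td x z ≤ td x y + td y z := by
  unfold td
  have := FreeGroup.norm_mul_le (x⁻¹ * y) (y⁻¹ * z)
  simpa [mul_assoc] using this
theorem td_mul (g x y : FreeGroup α) : td (g * x) (g * y) = td x y := by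
  unfold td; congr 1; group
theorem td_one (y : FreeGroup α) : td 1 y = y.norm := by simp [td]
theorem Btw.symm {x z y : FreeGroup α} (h : Btw x z y) : Btw y z x := by
  unfold Btw at *; rw [td_comm y z, td_comm z x, td_comm y x]; omega
theorem Btw.mul {x z y : FreeGroup α} (g : FreeGroup α) (h : Btw x z y) :
    Btw (g * x) (g * z) (g * y) := by
  unfold Btw at *; simpa [td_mul] using h
theorem Btw.mul_iff {x z y : FreeGroup α} (g : FreeGroup α) :
    Btw (g * x) (g * z) (g * y) ↔ Btw x z y := by
  unfold Btw at *; simp [td_mul]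

theorem Btw.left (x y : FreeGroup α) : Btw x x y := by simp [Btw, td_self]
theorem Btw.right (x y : FreeGroup α) : Btw x y y := by simp [Btw, td_self]

/-- heads disjoint -/
def HDis (x y : FreeGroup α) : Prop :=
  ∀ l, x.toWord.head? = some l → y.toWord.head? = some l → False

theorem toWord_mul_of_norm {a b : FreeGroup α} (h : (a * b).norm = a.norm + b.norm) :
    (a * b).toWord = a.toWord ++ b.toWord := by
  rw [FreeGroup.toWord_mul]
  have hs : (FreeGroup.reduce (a.toWord ++ b.toWord)).Sublist (a.toWord ++ b.toWord) :=
    FreeGroup.Red.sublist FreeGroup.reduce.red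
  apply hs.eq_of_length
  have : (FreeGroup.reduce (a.toWord ++ b.toWord)).length = (a*b).norm := by
    rw [← FreeGroup.toWord_mul]; rfl
  rw [this, h, List.length_append]; rfl

theorem norm_mul_of_toWord {a b : FreeGroup α} (h : (a * b).toWord = a.toWord ++ b.toWord) :
    (a * b).norm = a.norm + b.norm := by
  unfold FreeGroup.norm; rw [h, List.length_append]

theorem hdis_iff {x y : FreeGroup α} : (x⁻¹ * y).norm = x.norm + y.norm ↔ HDis x y := by
  constructor
  · intro h l hx hy
    obtain ⟨x', hx'⟩ : ∃ x', x.toWord = l :: x' := by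
      cases hc : x.toWord with
      | nil => simp [hc] at hx
      | cons a t => simp [hc] at hx; exact ⟨t, by rw [hx]⟩
    obtain ⟨y', hy'⟩ : ∃ y', y.toWord = l :: y' := by
      cases hc : y.toWord with
      | nil => simp [hc] at hy
      | cons a t => simp [hc] at hy; exact ⟨t, by rw [hy]⟩
    have ex : x = FreeGroup.mk [l] * FreeGroup.mk x' := by
      rw [FreeGroup.mul_mk, ← FreeGroup.mk_toWord (x := x), hx']; rfl
    have ey : y = FreeGroup.mk [l] * FreeGroup.mk y' := by
      rw [FreeGroup.mul_mk, ← FreeGroup.mk_toWord (x := y), hy']; rfl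
    have e : x⁻¹ * y = (FreeGroup.mk x')⁻¹ * FreeGroup.mk y' := by
      rw [ex, ey]; group
    have h1 : x.norm = x'.length + 1 := by unfold FreeGroup.norm; simp [hx']
    have h2 : y.norm = y'.length + 1 := by unfold FreeGroup.norm; simp [hy']
    have h3 := FreeGroup.norm_mul_le (FreeGroup.mk x')⁻¹ (FreeGroup.mk y')
    have h4 : (FreeGroup.mk x').norm ≤ x'.length := FreeGroup.norm_mk_le
    have h5 : (FreeGroup.mk y').norm ≤ y'.length := FreeGroup.norm_mk_le
    rw [FreeGroup.norm_inv_eq, ← e] at h3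
    omega
  · intro h
    have : FreeGroup.IsReduced (FreeGroup.invRev x.toWord ++ y.toWord) := by
      unfold FreeGroup.IsReduced
      rw [List.isChain_append]
      refine ⟨?_, FreeGroup.isReduced_toWord, ?_⟩
      · have := FreeGroup.isReduced_toWord (x := x⁻¹)
        rw [FreeGroup.toWord_inv] at this
        exact this
      · intro a ha b hb hab
        by_contra hne
        apply h b ?_ hb
        unfold FreeGroup.invRev at ha
        simp [List.getLast?_reverse] at ha
        obtain ⟨c, ⟨hc, rfl⟩ | ⟨hc, rfl⟩⟩ := ha
        · rw [hc]; obtain ⟨b1, b2⟩ := b; simp at hab hne ⊢; simp [hab, hne]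
        · rw [hc]; obtain ⟨b1, b2⟩ := b; simp at hab hne ⊢; simp [hab, hne]
    have e : (x⁻¹ * y).toWord = FreeGroup.invRev x.toWord ++ y.toWord := by
      rw [FreeGroup.toWord_mul, FreeGroup.toWord_inv, this.reduce_eq]
    unfold FreeGroup.norm
    rw [e]; simp

theorem btw_iff_hdis {x z y : FreeGroup α} : Btw x z y ↔ HDis (z⁻¹ * x) (z⁻¹ * y) := by
  rw [← hdis_iff, Btw, td_comm x z]
  unfold td
  have : (z⁻¹ * x)⁻¹ * (z⁻¹ * y) = x⁻¹ * y := by group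
  rw [this]; constructor <;> intro h <;> exact h.symm

theorem Btw.or {x z y : FreeGroup α} (h : Btw x z y) (c : FreeGroup α) : Btw x z c ∨ Btw c z y := by
  simp only [btw_iff_hdis] at *
  by_contra hc
  push Not at hc
  obtain ⟨h1, h2⟩ := hc
  unfold HDis at h1 h2
  push Not at h1 h2
  obtain ⟨l, a1, a2, -⟩ := h1
  obtain ⟨l', b1, b2, -⟩ := h2
  have : l = l' := by rw [a2] at b1; simpa using b1
  subst this
  exact h l a1 b2

theorem exists_common_pre (y z : FreeGroup α) : ∃ m y' z' : FreeGroup α,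
    y = m * y' ∧ z = m * z' ∧ y.norm = m.norm + y'.norm ∧ z.norm = m.norm + z'.norm ∧
    HDis y' z' := by
  have key : ∀ (n : ℕ) (y z : FreeGroup α), y.norm ≤ n → ∃ m y' z' : FreeGroup α,
    y = m * y' ∧ z = m * z' ∧ y.norm = m.norm + y'.norm ∧ z.norm = m.norm + z'.norm ∧
    HDis y' z' := by
    intro n
    induction n with
    | zero =>
      intro y z h
      refine ⟨1, y, z, by simp, by simp, by simp, by simp, ?_⟩
      have : y = 1 := by rw [← FreeGroup.norm_eq_zero]; omega
      subst this
      intro l h; simp at h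
    | succ n ih =>
      intro y z h
      by_cases hd : HDis y z
      · exact ⟨1, y, z, by simp, by simp, by simp, by simp, hd⟩
      · unfold HDis at hd; push Not at hd
        obtain ⟨l, hy, hz, -⟩ := hd
        obtain ⟨y1, hy'⟩ : ∃ y', y.toWord = l :: y' := by
          cases hc : y.toWord with
          | nil => simp [hc] at hy
          | cons a t => simp [hc] at hy; exact ⟨t, by rw [hy]⟩
        obtain ⟨z1, hz'⟩ : ∃ y', z.toWord = l :: y' := by
          cases hc : z.toWord with
          | nil => simp [hc] at hz
          | cons a t => simp [hc] at hz; exact ⟨t, by rw [hz]⟩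
        have ey : y = FreeGroup.mk [l] * FreeGroup.mk y1 := by
          rw [FreeGroup.mul_mk, ← FreeGroup.mk_toWord (x := y), hy']; rfl
        have ez : z = FreeGroup.mk [l] * FreeGroup.mk z1 := by
          rw [FreeGroup.mul_mk, ← FreeGroup.mk_toWord (x := z), hz']; rfl
        have ry : FreeGroup.IsReduced y1 := by
          have := FreeGroup.isReduced_toWord (x := y)
          rw [hy'] at this
          exact this.subw (List.IsSuffix.isInfix (List.suffix_cons _ _))
        have rz : FreeGroup.IsReduced z1 := by
          have := FreeGroup.isReduced_toWord (x := z)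
          rw [hz'] at this
          exact this.subw (List.IsSuffix.isInfix (List.suffix_cons _ _))
        have n1 : (FreeGroup.mk y1).norm = y1.length := by
          unfold FreeGroup.norm; rw [FreeGroup.toWord_mk, ry.reduce_eq]
        have n2 : (FreeGroup.mk z1).norm = z1.length := by
          unfold FreeGroup.norm; rw [FreeGroup.toWord_mk, rz.reduce_eq]
        have h1 : y.norm = y1.length + 1 := by unfold FreeGroup.norm; simp [hy']
        have h2 : z.norm = z1.length + 1 := by unfold FreeGroup.norm; simp [hz']
        obtain ⟨m, y', z', e1, e2, e3, e4, e5⟩ := ih (FreeGroup.mk y1) (FreeGroup.mk z1) (by omega)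
        have hm : (FreeGroup.mk [l] * m).norm ≤ 1 + m.norm := by
          refine (FreeGroup.norm_mul_le _ _).trans ?_
          have : (FreeGroup.mk [l]).norm ≤ [l].length := FreeGroup.norm_mk_le
          simp at this; omega
        have hm2 : y.norm ≤ (FreeGroup.mk [l] * m).norm + y'.norm := by
          rw [ey, e1, ← mul_assoc]; exact FreeGroup.norm_mul_le _ _
        refine ⟨FreeGroup.mk [l] * m, y', z', by rw [ey, e1, mul_assoc], by rw [ez, e2, mul_assoc],
          by omega, by omega, e5⟩
  exact key _ y z le_rfl

theorem exists_median (x y z : FreeGroup α) : ∃ m, Btw x m y ∧ Btw y m z ∧ Btw x m z := by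
  obtain ⟨m, y', z', e1, e2, e3, e4, e5⟩ := exists_common_pre (x⁻¹ * y) (x⁻¹ * z)
  have ey : y = x * (m * y') := by rw [← e1]; group
  have ez : z = x * (m * z') := by rw [← e2]; group
  refine ⟨x * m, ?_, ?_, ?_⟩
  · unfold Btw td; rw [e3]; rw [ey]; congr 2 <;> group
  · rw [btw_iff_hdis, ey, ez]
    have a : (x * m)⁻¹ * (x * (m * y')) = y' := by group
    have b : (x * m)⁻¹ * (x * (m * z')) = z' := by group
    rw [a, b]; exact e5
  · unfold Btw td; rw [e4]; rw [ez]; congr 2 <;> group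

/-- reduced words give elements with that word -/
theorem norm_mk_red {L : List (α × Bool)} (h : FreeGroup.IsReduced L) :
    (FreeGroup.mk L).norm = L.length := by
  unfold FreeGroup.norm; rw [FreeGroup.toWord_mk, h.reduce_eq]

theorem exists_btw {x y : FreeGroup α} {t : ℕ} (h : t ≤ td x y) : ∃ z, Btw x z y ∧ td x z = t := by
  set g := x⁻¹ * y with hg
  have hr := FreeGroup.isReduced_toWord (x := g)
  have r1 : FreeGroup.IsReduced (g.toWord.take t) := hr.subw (List.IsPrefix.isInfix (KW.take_pre _ _))
  have r2 : FreeGroup.IsReduced (g.toWord.drop t) := hr.subw (List.IsSuffix.isInfix (List.drop_suffix _ _))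
  have e : FreeGroup.mk (g.toWord.take t) * FreeGroup.mk (g.toWord.drop t) = g := by
    rw [FreeGroup.mul_mk, List.take_append_drop, FreeGroup.mk_toWord]
  have hl : g.toWord.length = td x y := rfl
  have n1 := norm_mk_red r1
  have n2 := norm_mk_red r2
  simp only [List.length_take, List.length_drop] at n1 n2
  have t1 : td x (x * FreeGroup.mk (g.toWord.take t)) = t := by
    unfold td; rw [inv_mul_cancel_left, n1]; omega
  refine ⟨x * FreeGroup.mk (g.toWord.take t), ?_, t1⟩
  unfold Btw
  rw [t1]
  have : (x * FreeGroup.mk (g.toWord.take t))⁻¹ * y = FreeGroup.mk (g.toWord.drop t) := by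
    have hy : y = x * (FreeGroup.mk (g.toWord.take t) * FreeGroup.mk (g.toWord.drop t)) := by
      rw [e, hg]; group
    conv_lhs => rw [hy]
    group
  have t2 : td (x * FreeGroup.mk (g.toWord.take t)) y = td x y - t := by
    conv_lhs => unfold td
    rw [this, n2, hl]
  omega

/-- convex sets -/
def Cvx (S : Set (FreeGroup α)) : Prop := ∀ x ∈ S, ∀ y ∈ S, ∀ z, Btw x z y → z ∈ S

/-- `p` is the gate of `x` on `S` -/
def IsGate (S : Set (FreeGroup α)) (x p : FreeGroup α) : Prop := p ∈ S ∧ ∀ s ∈ S, Btw x p s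

theorem exists_gate {S : Set (FreeGroup α)} (hS : Cvx S) (hne : S.Nonempty) (x : FreeGroup α) :
    ∃ p, IsGate S x p := by
  classical
  let A : Set ℕ := (fun s => td x s) '' S
  have hA : A.Nonempty := hne.image _
  obtain ⟨p, hp, hpA⟩ := Nat.sInf_mem hA
  refine ⟨p, hp, fun s hs => ?_⟩
  obtain ⟨m, h1, h2, h3⟩ := exists_median x p s
  have hm : m ∈ S := hS p hp s hs m h2
  have hle : sInf A ≤ td x m := Nat.sInf_le ⟨m, hm, rfl⟩
  simp only at hpA
  have : td m p = 0 := by unfold Btw at h1; omega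
  rw [td_eq_zero] at this
  subst this; exact h3

theorem IsGate.unique {S : Set (FreeGroup α)} {x p q : FreeGroup α} (h : IsGate S x p)
    (h' : IsGate S x q) : p = q := by
  have a := h.2 q h'.1
  have b := h'.2 p h.1
  unfold Btw at a b
  rw [td_comm q p] at b
  rw [← td_eq_zero]; omega

theorem btw_trans {x p q y : FreeGroup α} (h : Btw x q y) (h' : Btw x p q) :
    Btw x p y ∧ Btw p q y := by
  unfold Btw at *
  have := td_tri x p y
  have := td_tri p q y
  omega

theorem btw_of_sum {x p q y : FreeGroup α} (h : td x y = td x p + td p q + td q y) :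
    Btw x p y ∧ Btw x q y ∧ Btw p q y ∧ Btw x p q := by
  unfold Btw
  have := td_tri x p y
  have := td_tri p q y
  have := td_tri x q y
  have := td_tri x p q
  omega

theorem gate_sum {S : Set (FreeGroup α)} {x y p q : FreeGroup α} (hp : IsGate S x p)
    (hq : IsGate S y q) (hne : p ≠ q) : td x y = td x p + td p q + td q y := by
  have h1 := hp.2 q hq.1
  have h2 := hq.2 p hp.1
  -- q between y and p ; p between x and q
  rcases h1.or y with h | h
  · -- Btw x p y
    -- then td p y = td p q + td q y
    unfold Btw at h h2
    rw [td_comm y q, td_comm q p, td_comm y p] at h2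
    omega
  · exfalso
    apply hne
    unfold Btw at h h2
    rw [td_comm q p] at h2
    rw [← td_eq_zero]
    omega

theorem gate_mem_btw {S : Set (FreeGroup α)} {x y p q : FreeGroup α} (hp : IsGate S x p)
    (hq : IsGate S y q) (hne : p ≠ q) : Btw x p y ∧ Btw x q y :=
  ⟨(btw_of_sum (gate_sum hp hq hne)).1, (btw_of_sum (gate_sum hp hq hne)).2.1⟩

theorem gate_self {S : Set (FreeGroup α)} {x : FreeGroup α} (h : x ∈ S) : IsGate S x x :=
  ⟨h, fun s _ => Btw.left _ _⟩

theorem gate_lip {S : Set (FreeGroup α)} {x y p q : FreeGroup α} (hp : IsGate S x p)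
    (hq : IsGate S y q) : td p q ≤ td x y := by
  by_cases h : p = q
  · subst h; simp [td_self]
  · rw [gate_sum hp hq h]; omega

theorem Cvx.union {S T : Set (FreeGroup α)} (hS : Cvx S) (hT : Cvx T) (h : (S ∩ T).Nonempty) :
    Cvx (S ∪ T) := by
  obtain ⟨c, hc1, hc2⟩ := h
  intro x hx y hy z hz
  rcases hz.or c with h | h
  · rcases hx with hx | hx
    · exact Or.inl (hS x hx c hc1 z h)
    · exact Or.inr (hT x hx c hc2 z h)
  · rcases hy with hy | hy
    · exact Or.inl (hS c hc1 y hy z h)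
    · exact Or.inr (hT c hc2 y hy z h)

/-- `[x,y] ⊆ S` for x in S, y with gate; gate between -/
theorem gate_mem_of_cvx {S T : Set (FreeGroup α)} (hT : Cvx T) {x s p : FreeGroup α}
    (hp : IsGate S x p) (hx : x ∈ T) (hs : s ∈ S) (hs' : s ∈ T) : p ∈ T :=
  hT x hx s hs' p (hp.2 s hs)

end P1
end KW

set_option linter.all false
namespace KW
section P2
variable {α : Type} [DecidableEq α]

/-- data of a family of axes with small overlaps -/
structure WD (I : Set (FreeGroup α)) (Ax : FreeGroup α → Set (FreeGroup α))
    (P L : FreeGroup α → ℕ) : Prop where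
  conjI : ∀ ρ ∈ I, ∀ g, g * ρ * g⁻¹ ∈ I
  conjAx : ∀ ρ ∈ I, ∀ g x, x ∈ Ax (g * ρ * g⁻¹) ↔ g⁻¹ * x ∈ Ax ρ
  conjP : ∀ ρ ∈ I, ∀ g, P (g * ρ * g⁻¹) = P ρ
  conjL : ∀ ρ ∈ I, ∀ g, L (g * ρ * g⁻¹) = L ρ
  cvx : ∀ ρ ∈ I, Cvx (Ax ρ)
  ne : ∀ ρ ∈ I, (Ax ρ).Nonempty
  tr : ∀ ρ ∈ I, ∀ x ∈ Ax ρ, ∀ e : ℤ, e ≠ 0 → L ρ ≤ td x (ρ ^ e * x)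
  big : ∀ ρ ∈ I, 8 * P ρ + 5 ≤ L ρ
  small : ∀ ρ ∈ I, ∀ ρ' ∈ I, ρ ≠ ρ' → ∀ x y, x ∈ Ax ρ → x ∈ Ax ρ' → y ∈ Ax ρ → y ∈ Ax ρ' →
    td x y ≤ P ρ

def Concl (I : Set (FreeGroup α)) (Ax : FreeGroup α → Set (FreeGroup α))
    (P L : FreeGroup α → ℕ) (n : FreeGroup α) : Prop :=
  ∃ ρ ∈ I, ∃ x ∈ Ax ρ, ∃ y ∈ Ax ρ, td 1 n = td 1 x + td x y + td y n ∧
    L ρ ≤ td x y + (4 * P ρ + 2)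

structure Wm (I : Set (FreeGroup α)) (Ax : FreeGroup α → Set (FreeGroup α))
    (P L : FreeGroup α → ℕ) (W : Set (FreeGroup α)) : Prop where
  one : 1 ∈ W
  cvx : Cvx W
  inv : ∀ ρ ∈ I, Ax ρ ⊆ W → ∀ x ∈ W, ρ * x ∈ W ∧ ρ⁻¹ * x ∈ W
  sm : ∀ ρ ∈ I, ¬ Ax ρ ⊆ W → ∀ x y, x ∈ Ax ρ → x ∈ W → y ∈ Ax ρ → y ∈ W → td x y ≤ 2 * P ρ + 2
  concl : ∀ n ∈ Subgroup.closure {ρ | ρ ∈ I ∧ Ax ρ ⊆ W}, n ≠ 1 → Concl I Ax P L n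

def Near (Ax : FreeGroup α → Set (FreeGroup α))
    (P : FreeGroup α → ℕ) (W : Set (FreeGroup α)) (ρ x : FreeGroup α) : Prop :=
  ∃ p, IsGate (Ax ρ) x p ∧ ∃ j, j ∈ Ax ρ ∧ j ∈ W ∧ td p j ≤ P ρ

/-- axes meeting W but not contained in it -/
def Mset (I : Set (FreeGroup α)) (Ax : FreeGroup α → Set (FreeGroup α))
    (W : Set (FreeGroup α)) : Set (FreeGroup α) :=
  {ρ | ρ ∈ I ∧ ¬ Ax ρ ⊆ W ∧ ∃ s, s ∈ Ax ρ ∧ s ∈ W}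

inductive QQ (Ax : FreeGroup α → Set (FreeGroup α))
    (P : FreeGroup α → ℕ) (W M Y : Set (FreeGroup α)) : FreeGroup α → Prop
  | base : ∀ y, y ∈ Y → QQ Ax P W M Y y
  | step : ∀ y ρ, ∀ e : ℤ, ρ ∈ M → e ≠ 0 → Near Ax P W ρ y → QQ Ax P W M Y y →
      QQ Ax P W M Y (ρ ^ e * y)

variable {I : Set (FreeGroup α)} {Ax : FreeGroup α → Set (FreeGroup α)}
    {P L : FreeGroup α → ℕ} {W : Set (FreeGroup α)}

theorem WD.pow_mem (D : WD I Ax P L) {ρ} (h : ρ ∈ I) (e : ℤ) {x} : ρ ^ e * x ∈ Ax ρ ↔ x ∈ Ax ρ := by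
  have := D.conjAx ρ h (ρ ^ e) (ρ ^ e * x)
  rw [inv_mul_cancel_left] at this
  rw [← this]
  have e1 : ρ ^ e * ρ * (ρ ^ e)⁻¹ = ρ := by
    rw [(Commute.refl ρ).zpow_left e |>.eq]; group
  rw [e1]

theorem WD.gate_conj (D : WD I Ax P L) {ρ} (h : ρ ∈ I) (g : FreeGroup α) {x p}
    (hp : IsGate (Ax ρ) x p) : IsGate (Ax (g * ρ * g⁻¹)) (g * x) (g * p) := by
  refine ⟨(D.conjAx ρ h g _).2 (by simpa using hp.1), fun s hs => ?_⟩
  have := hp.2 _ ((D.conjAx ρ h g s).1 hs)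
  have := this.mul g
  simpa using this

theorem WD.gate_pow (D : WD I Ax P L) {ρ} (h : ρ ∈ I) (e : ℤ) {x p}
    (hp : IsGate (Ax ρ) x p) : IsGate (Ax ρ) (ρ ^ e * x) (ρ ^ e * p) := by
  have := D.gate_conj h (ρ ^ e) hp
  have e1 : ρ ^ e * ρ * (ρ ^ e)⁻¹ = ρ := by
    rw [(Commute.refl ρ).zpow_left e |>.eq]; group
  rwa [e1] at this

theorem near_of_mem (D : WD I Ax P L) (hW : Wm I Ax P L W) {ρ x}
    (h : ρ ∈ Mset I Ax W) (hx : x ∈ W) : Near Ax P W ρ x := by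
  obtain ⟨hI, -, s, hs, hsW⟩ := h
  obtain ⟨p, hp⟩ := exists_gate (D.cvx ρ hI) (D.ne ρ hI) x
  refine ⟨p, hp, p, hp.1, hW.cvx x hx s hsW p (hp.2 s hs), by simp [td_self]⟩

theorem near_aux (D : WD I Ax P L) (hW : Wm I Ax P L W) {ρ ρ' p a s}
    (h : ρ ∈ Mset I Ax W) (h' : ρ' ∈ Mset I Ax W) (hne : ρ ≠ ρ') (hp : p ∈ Ax ρ)
    (ha : a ∈ Ax ρ') (hs : s ∈ Ax ρ) (hsW : s ∈ W) (hb : Btw a p s) :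
    ∃ j, j ∈ Ax ρ ∧ j ∈ W ∧ td p j ≤ P ρ := by
  obtain ⟨hI', -, s', hs', hsW'⟩ := h'
  have hI := h.1
  rcases hb.or s' with h1 | h1
  · have hp' := D.cvx ρ' hI' a ha s' hs' p h1
    obtain ⟨j, hj⟩ := exists_gate hW.cvx ⟨1, hW.one⟩ p
    have j1 := D.cvx ρ hI p hp s hs j (hj.2 s hsW)
    have j2 := D.cvx ρ' hI' p hp' s' hs' j (hj.2 s' hsW')
    exact ⟨j, j1, hj.1, D.small ρ hI ρ' hI' hne p j hp hp' j1 j2⟩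
  · exact ⟨p, hp, hW.cvx s' hsW' s hsW p h1, by simp [td_self]⟩

theorem near_of_axis (D : WD I Ax P L) (hW : Wm I Ax P L W) {ρ ρ' x}
    (h : ρ ∈ Mset I Ax W) (h' : ρ' ∈ Mset I Ax W) (hne : ρ ≠ ρ') (hx : x ∈ Ax ρ') :
    Near Ax P W ρ x := by
  have hM := h
  obtain ⟨hI, -, s, hs, hsW⟩ := h
  obtain ⟨p, hp⟩ := exists_gate (D.cvx ρ hI) (D.ne ρ hI) x
  exact ⟨p, hp, near_aux D hW hM h' hne hp.1 hx hs hsW (hp.2 s hs)⟩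

theorem near_of_not_near (D : WD I Ax P L) (hW : Wm I Ax P L W) {ρ ρ' x}
    (h : ρ ∈ Mset I Ax W) (h' : ρ' ∈ Mset I Ax W) (hne : ρ ≠ ρ') (hx : ¬ Near Ax P W ρ' x) :
    Near Ax P W ρ x := by
  have hM := h
  have hM' := h'
  obtain ⟨hI, -, s, hs, hsW⟩ := h
  obtain ⟨hI', -, s', hs', hsW'⟩ := h'
  obtain ⟨p, hp⟩ := exists_gate (D.cvx ρ hI) (D.ne ρ hI) x
  obtain ⟨p', hp'⟩ := exists_gate (D.cvx ρ' hI') (D.ne ρ' hI') x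
  have hb : ∀ w ∈ W, Btw x p' w := by
    intro w hw
    obtain ⟨q', hq'⟩ := exists_gate (D.cvx ρ' hI') (D.ne ρ' hI') w
    have hq'W : q' ∈ W := hW.cvx w hw s' hsW' q' (hq'.2 s' hs')
    refine (gate_mem_btw hp' hq' ?_).1
    rintro rfl
    exact hx ⟨p', hp', p', hp'.1, hq'W, by simp [td_self]⟩
  refine ⟨p, hp, ?_⟩
  rcases (hp.2 s hs).or p' with h1 | h1
  · exfalso
    have h2 := (btw_trans (hb s hsW) h1).2
    have hp'ρ := D.cvx ρ hI p hp.1 s hs p' h2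
    obtain ⟨j, hj⟩ := exists_gate hW.cvx ⟨1, hW.one⟩ p'
    have j1 := D.cvx ρ hI p' hp'ρ s hs j (hj.2 s hsW)
    have j2 := D.cvx ρ' hI' p' hp'.1 s' hs' j (hj.2 s' hsW')
    exact hx ⟨p', hp', j, j2, hj.1, D.small ρ' hI' ρ hI hne.symm p' j hp'.1 hp'ρ j2 j1⟩
  · exact near_aux D hW hM hM' hne hp.1 hp'.1 hs hsW h1

theorem near_far (D : WD I Ax P L) (hW : Wm I Ax P L W) {ρ x y p q} {e : ℤ}
    (h : ρ ∈ Mset I Ax W) (hx : Near Ax P W ρ x) (hy : Near Ax P W ρ y) (he : e ≠ 0)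
    (hp : IsGate (Ax ρ) x p) (hq : IsGate (Ax ρ) (ρ ^ e * y) q) :
    L ρ ≤ td p q + (4 * P ρ + 2) := by
  obtain ⟨p1, hp1, j, hj, hjW, hd⟩ := hx
  obtain ⟨q1, hq1, i, hi, hiW, hd'⟩ := hy
  obtain rfl := hp.unique hp1
  obtain rfl := hq.unique (D.gate_pow h.1 e hq1)
  have h1 := hW.sm ρ h.1 h.2.1 j i hj hjW hi hiW
  have h2 := D.tr ρ h.1 q1 hq1.1 e he
  have t1 := td_tri q1 p (ρ ^ e * q1)
  have t2 := td_tri q1 i p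
  have t3 := td_tri i j p
  rw [td_comm i j, td_comm j p] at t3
  omega

theorem not_near_pow (D : WD I Ax P L) (hW : Wm I Ax P L W) {ρ y} {e : ℤ}
    (h : ρ ∈ Mset I Ax W) (hy : Near Ax P W ρ y) (he : e ≠ 0) : ¬ Near Ax P W ρ (ρ ^ e * y) := by
  intro hn
  have hy' := hy
  have hn' := hn
  obtain ⟨p1, hp1, j, hj, hjW, hd⟩ := hy
  obtain ⟨q1, hq1, i, hi, hiW, hd'⟩ := hn
  have h0 := near_far D hW h hy' hy' he hp1 hq1
  have h1 := hW.sm ρ h.1 h.2.1 j i hj hjW hi hiW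
  have t2 := td_tri p1 i q1
  have t3 := td_tri p1 j i
  rw [td_comm i q1] at t2
  have := D.big ρ h.1
  omega

/-- the subgroup preserving W -/
def HW (I : Set (FreeGroup α)) (Ax : FreeGroup α → Set (FreeGroup α))
    (W : Set (FreeGroup α)) : Subgroup (FreeGroup α) :=
  Subgroup.closure {ρ | ρ ∈ I ∧ Ax ρ ⊆ W}

def NW (I : Set (FreeGroup α)) (Ax : FreeGroup α → Set (FreeGroup α))
    (W : Set (FreeGroup α)) : Subgroup (FreeGroup α) :=
  Subgroup.closure {ρ | ρ ∈ I ∧ ∃ s, s ∈ Ax ρ ∧ s ∈ W}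

theorem HW_mem (hW : Wm I Ax P L W) {h} (hh : h ∈ HW I Ax W) : ∀ x, h * x ∈ W ↔ x ∈ W := by
  unfold HW at hh
  induction hh using Subgroup.closure_induction with
  | mem g hg =>
    intro x
    constructor
    · intro hx
      have := (hW.inv g hg.1 hg.2 _ hx).2
      simpa using this
    · intro hx; exact (hW.inv g hg.1 hg.2 _ hx).1
  | one => simp
  | mul a b _ _ ha hb => intro x; rw [mul_assoc, ha, hb]
  | inv a _ ha => intro x; rw [← ha]; simp

theorem HW_conj (D : WD I Ax P L) (hW : Wm I Ax P L W) {h ρ} (hh : h ∈ HW I Ax W)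
    (hρ : ρ ∈ Mset I Ax W) : h * ρ * h⁻¹ ∈ Mset I Ax W := by
  obtain ⟨hI, hn, s, hs, hsW⟩ := hρ
  refine ⟨D.conjI ρ hI h, ?_, h * s, (D.conjAx ρ hI h _).2 (by simpa using hs), (HW_mem hW hh s).2 hsW⟩
  intro hsub
  apply hn
  intro x hx
  rw [← HW_mem hW hh]
  exact hsub ((D.conjAx ρ hI h _).2 (by simpa using hx))

theorem HW_near (D : WD I Ax P L) (hW : Wm I Ax P L W) {h ρ x} (hh : h ∈ HW I Ax W)
    (hρ : ρ ∈ Mset I Ax W) (hx : Near Ax P W ρ x) : Near Ax P W (h * ρ * h⁻¹) (h * x) := by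
  obtain ⟨p, hp, j, hj, hjW, hd⟩ := hx
  refine ⟨h * p, D.gate_conj hρ.1 h hp, h * j, (D.conjAx ρ hρ.1 h _).2 (by simpa using hj),
    (HW_mem hW hh j).2 hjW, ?_⟩
  rw [td_mul, D.conjP ρ hρ.1]; exact hd

theorem QQ_H (D : WD I Ax P L) (hW : Wm I Ax P L W) {Y : Set (FreeGroup α)}
    (hY : ∀ h ∈ HW I Ax W, ∀ y ∈ Y, h * y ∈ Y) {h} (hh : h ∈ HW I Ax W) {y}
    (hq : QQ Ax P W (Mset I Ax W) Y y) : QQ Ax P W (Mset I Ax W) Y (h * y) := by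
  induction hq with
  | base y hy => exact QQ.base _ (hY h hh y hy)
  | step y ρ e hρ he hn hq ih =>
    have : h * (ρ ^ e * y) = (h * ρ * h⁻¹) ^ e * (h * y) := by
      rw [conj_zpow]; group
    rw [this]
    exact QQ.step _ _ e (HW_conj D hW hh hρ) he (HW_near D hW hh hρ hn) ih

theorem QQ_pow (D : WD I Ax P L) (hW : Wm I Ax P L W) {Y : Set (FreeGroup α)}
    (hY : ∀ y ∈ Y, ∀ ρ ∈ Mset I Ax W, Near Ax P W ρ y ∨ ∀ e : ℤ, ρ ^ e * y ∈ Y)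
    {ρ} (hρ : ρ ∈ Mset I Ax W) (f : ℤ) {y}
    (hq : QQ Ax P W (Mset I Ax W) Y y) : QQ Ax P W (Mset I Ax W) Y (ρ ^ f * y) := by
  by_cases hf : f = 0
  · subst hf; simpa using hq
  cases hq with
  | base y hy =>
    rcases hY y hy ρ hρ with h | h
    · exact QQ.step _ _ f hρ hf h (QQ.base _ hy)
    · exact QQ.base _ (h f)
  | step y ρ1 e hρ1 he hn hq =>
    by_cases hr : ρ = ρ1
    · subst hr
      rw [← mul_assoc, ← zpow_add]
      by_cases h0 : f + e = 0
      · rw [h0]; simpa using hq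
      · exact QQ.step _ _ _ hρ h0 hn hq
    · have h1 := not_near_pow D hW hρ1 hn he
      exact QQ.step _ _ f hρ hf (near_of_not_near D hW hρ hρ1 hr h1) (QQ.step _ _ e hρ1 he hn hq)

theorem QQ_N (D : WD I Ax P L) (hW : Wm I Ax P L W) {Y : Set (FreeGroup α)}
    (hY0 : ∀ h ∈ HW I Ax W, ∀ y ∈ Y, h * y ∈ Y)
    (hY : ∀ y ∈ Y, ∀ ρ ∈ Mset I Ax W, Near Ax P W ρ y ∨ ∀ e : ℤ, ρ ^ e * y ∈ Y)
    {g} (hg : g ∈ NW I Ax W) : ∀ y, QQ Ax P W (Mset I Ax W) Y y →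
    QQ Ax P W (Mset I Ax W) Y (g * y) := by
  unfold NW at hg
  have gen : ∀ ρ ∈ {ρ | ρ ∈ I ∧ ∃ s, s ∈ Ax ρ ∧ s ∈ W}, ∀ f : ℤ, ∀ y,
      QQ Ax P W (Mset I Ax W) Y y → QQ Ax P W (Mset I Ax W) Y (ρ ^ f * y) := by
    intro ρ hρ f y hq
    by_cases hs : Ax ρ ⊆ W
    · have : ρ ∈ HW I Ax W := Subgroup.subset_closure ⟨hρ.1, hs⟩
      exact QQ_H D hW hY0 (Subgroup.zpow_mem _ this f) hq
    · exact QQ_pow D hW hY ⟨hρ.1, hs, hρ.2⟩ f hq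
  induction hg using Subgroup.closure_induction_left with
  | one => simp
  | mul_left x hx y hy ih =>
    intro z hz
    rw [mul_assoc]
    simpa using gen x hx 1 _ (ih z hz)
  | inv_mul_cancel x hx y hy ih =>
    intro z hz
    rw [mul_assoc]
    simpa using gen x hx (-1) _ (ih z hz)

theorem NW_concl (D : WD I Ax P L) (hW : Wm I Ax P L W) {n} (hn : n ∈ NW I Ax W) (h1 : n ≠ 1) :
    Concl I Ax P L n := by
  have hq : QQ Ax P W (Mset I Ax W) (HW I Ax W : Set (FreeGroup α)) (n * 1) := by
    apply QQ_N D hW _ _ hn _ (QQ.base 1 (Subgroup.one_mem _))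
    · intro h hh y hy; exact Subgroup.mul_mem _ hh hy
    · intro y hy ρ hρ
      left
      apply near_of_mem D hW hρ
      have := (HW_mem hW hy 1).2 hW.one
      simpa using this
  rw [mul_one] at hq
  cases hq with
  | base _ hy => exact hW.concl n hy h1
  | step y ρ e hρ he hny hq =>
    have hn1 := near_of_mem D hW hρ hW.one
    have hn1' := hn1
    obtain ⟨p, hp, -⟩ := hn1
    obtain ⟨q, hq⟩ := exists_gate (D.cvx ρ hρ.1) (D.ne ρ hρ.1) (ρ ^ e * y)
    have hf := near_far D hW hρ hn1' hny he hp hq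
    have hb := D.big ρ hρ.1
    refine ⟨ρ, hρ.1, p, hp.1, q, hq.1, gate_sum hp hq ?_, hf⟩
    rintro rfl
    rw [td_self] at hf; omega

def YW (I : Set (FreeGroup α)) (Ax : FreeGroup α → Set (FreeGroup α))
    (W : Set (FreeGroup α)) : Set (FreeGroup α) :=
  {x | x ∈ W ∨ ∃ ρ ∈ Mset I Ax W, x ∈ Ax ρ}

def W' (I : Set (FreeGroup α)) (Ax : FreeGroup α → Set (FreeGroup α))
    (W : Set (FreeGroup α)) : Set (FreeGroup α) :=
  {x | ∃ g ∈ NW I Ax W, ∃ y ∈ YW I Ax W, x = g * y}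

theorem W'_mul {g x} (hg : g ∈ NW I Ax W) (hx : x ∈ W' I Ax W) : g * x ∈ W' I Ax W := by
  obtain ⟨g', hg', y, hy, rfl⟩ := hx
  exact ⟨g * g', Subgroup.mul_mem _ hg hg', y, hy, by rw [mul_assoc]⟩

theorem YW_sub {x} (hx : x ∈ YW I Ax W) : x ∈ W' I Ax W :=
  ⟨1, Subgroup.one_mem _, x, hx, by simp⟩

theorem W'_cvx0 (D : WD I Ax P L) (hW : Wm I Ax P L W) {y} (hy : y ∈ YW I Ax W) {w}
    (hw : w ∈ W) {z} (hz : Btw w z y) : z ∈ YW I Ax W := by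
  rcases hy with hy | ⟨ρ, hρ, hy⟩
  · exact Or.inl (hW.cvx w hw y hy z hz)
  · have hρ' := hρ
    obtain ⟨hI, -, s, hs, hsW⟩ := hρ
    rcases hz.or s with h | h
    · exact Or.inl (hW.cvx w hw s hsW z h)
    · exact Or.inr ⟨ρ, hρ', D.cvx ρ hI s hs y hy z h⟩

theorem W'_cvx1 (D : WD I Ax P L) (hW : Wm I Ax P L W) {g} (hg : g ∈ NW I Ax W) :
    ∀ y ∈ YW I Ax W, ∀ w ∈ W, ∀ z, Btw w z (g * y) → z ∈ W' I Ax W := by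
  unfold NW at hg
  have gen : ∀ ρ ∈ {ρ | ρ ∈ I ∧ ∃ s, s ∈ Ax ρ ∧ s ∈ W}, ∀ f : ℤ, ∀ g',
      (∀ y ∈ YW I Ax W, ∀ w ∈ W, ∀ z, Btw w z (g' * y) → z ∈ W' I Ax W) →
      (∀ y ∈ YW I Ax W, ∀ w ∈ W, ∀ z, Btw w z ((ρ ^ f * g') * y) → z ∈ W' I Ax W) := by
    intro ρ hρ f g' ih y hy w hw z hz
    have hρN : ρ ∈ NW I Ax W := Subgroup.subset_closure hρ
    obtain ⟨hI, s, hs, hsW⟩ := hρ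
    rcases hz.or s with h | h
    · exact YW_sub (Or.inl (hW.cvx w hw s hsW z h))
    rcases h.or (ρ ^ f * s) with h | h
    · have hz' := D.cvx ρ hI s hs _ ((D.pow_mem hI f).2 hs) z h
      by_cases hsub : Ax ρ ⊆ W
      · exact YW_sub (Or.inl (hsub hz'))
      · exact YW_sub (Or.inr ⟨ρ, ⟨hI, hsub, s, hs, hsW⟩, hz'⟩)
    · have h2 := h.mul (ρ ^ f)⁻¹
      have h3 := ih y hy s hsW ((ρ ^ f)⁻¹ * z) (by simpa [mul_assoc] using h2)
      have := W'_mul (Subgroup.zpow_mem _ hρN f) h3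
      simpa using this
  induction hg using Subgroup.closure_induction_left with
  | one => intro y hy w hw z hz; rw [one_mul] at hz; exact YW_sub (W'_cvx0 D hW hy hw hz)
  | mul_left x hx y hy ih =>
    simpa using gen x hx 1 _ ih
  | inv_mul_cancel x hx y hy ih =>
    simpa using gen x hx (-1) _ ih

theorem W'_cvx (D : WD I Ax P L) (hW : Wm I Ax P L W) : Cvx (W' I Ax W) := by
  rintro x ⟨g1, hg1, y1, hy1, rfl⟩ y ⟨g2, hg2, y2, hy2, rfl⟩ z hz
  rcases hz.or (g1 * 1) with h | h
  · have h2 := h.mul g1⁻¹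
    simp only [inv_mul_cancel_left] at h2
    have := W'_mul hg1 (YW_sub (W'_cvx0 D hW hy1 hW.one h2.symm))
    simpa using this
  · have h2 := h.mul g1⁻¹
    simp only [inv_mul_cancel_left] at h2
    rw [← mul_assoc] at h2
    have := W'_mul hg1 (W'_cvx1 D hW (Subgroup.mul_mem _ (Subgroup.inv_mem _ hg1) hg2) y2 hy2 1 hW.one _ h2)
    simpa using this

/-- bad axes -/
def Bad (I : Set (FreeGroup α)) (Ax : FreeGroup α → Set (FreeGroup α))
    (W : Set (FreeGroup α)) (ρ : FreeGroup α) : Prop :=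
  ρ ∈ I ∧ ∀ g ∈ NW I Ax W, ∀ x ∈ Ax ρ, g * x ∉ W

theorem Bad.conj (D : WD I Ax P L) {ρ g} (h : Bad I Ax W ρ) (hg : g ∈ NW I Ax W) :
    Bad I Ax W (g * ρ * g⁻¹) := by
  refine ⟨D.conjI ρ h.1 g, fun g' hg' x hx => ?_⟩
  rw [D.conjAx ρ h.1] at hx
  have := h.2 (g' * g) (Subgroup.mul_mem _ hg' hg) _ hx
  simpa [mul_assoc] using this

theorem not_bad (D : WD I Ax P L) {ρ} (hρ : ρ ∈ I) (h : ¬ Bad I Ax W ρ) :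
    ρ ∈ NW I Ax W ∧ Ax ρ ⊆ W' I Ax W := by
  unfold Bad at h
  push Not at h
  obtain ⟨g, hg, x, hx, hxW⟩ := h hρ
  have hI := D.conjI ρ hρ g
  have hx' : g * x ∈ Ax (g * ρ * g⁻¹) := (D.conjAx ρ hρ g _).2 (by simpa using hx)
  have hN : g * ρ * g⁻¹ ∈ NW I Ax W := Subgroup.subset_closure ⟨hI, g * x, hx', hxW⟩
  constructor
  · have := Subgroup.mul_mem _ (Subgroup.mul_mem _ (Subgroup.inv_mem _ hg) hN) hg
    simpa [mul_assoc] using this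
  · intro y hy
    have hy' : g * y ∈ Ax (g * ρ * g⁻¹) := (D.conjAx ρ hρ g _).2 (by simpa using hy)
    refine ⟨g⁻¹, Subgroup.inv_mem _ hg, g * y, ?_, by simp⟩
    by_cases hsub : Ax (g * ρ * g⁻¹) ⊆ W
    · exact Or.inl (hsub hy')
    · exact Or.inr ⟨_, ⟨hI, hsub, g * x, hx', hxW⟩, hy'⟩

theorem Mset_sub_NW {ρ} (h : ρ ∈ Mset I Ax W) : ρ ∈ NW I Ax W :=
  Subgroup.subset_closure ⟨h.1, h.2.2⟩

theorem Bad.ne_M {ρ σ} (h : Bad I Ax W ρ) (h' : σ ∈ Mset I Ax W) : ρ ≠ σ := by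
  rintro rfl
  obtain ⟨-, -, s, hs, hsW⟩ := h'
  exact h.2 1 (Subgroup.one_mem _) s hs (by simpa using hsW)

theorem lemK (D : WD I Ax P L) (hW : Wm I Ax P L W) {y}
    (hq : QQ Ax P W (Mset I Ax W) (YW I Ax W) y) : ∀ ρ, Bad I Ax W ρ → ∀ σ ∈ Mset I Ax W,
    ∀ x, x ∈ Ax σ → x ∈ Ax ρ → y ∈ Ax ρ → td x y ≤ 2 * P ρ + 2 := by
  induction hq with
  | base y hy =>
    intro ρ hb σ hσ x hx hxρ hyρ
    have hnW : ∀ z ∈ Ax ρ, z ∉ W := fun z hz => by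
      simpa using hb.2 1 (Subgroup.one_mem _) z hz
    rcases hy with hy | ⟨σ', hσ', hy⟩
    · exact absurd hy (hnW y hyρ)
    have e1 := hb.ne_M hσ
    have e2 := hb.ne_M hσ'
    by_cases hss : σ = σ'
    · subst hss
      have := D.small ρ hb.1 σ hσ.1 e1 x y hxρ hx hyρ hy
      omega
    · obtain ⟨p, hp⟩ := exists_gate (D.cvx σ hσ.1) (D.ne σ hσ.1) y
      have hpρ : p ∈ Ax ρ := D.cvx ρ hb.1 y hyρ x hxρ p (hp.2 x hx)
      have d1 := D.small ρ hb.1 σ hσ.1 e1 x p hxρ hx hpρ hp.1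
      obtain ⟨j, hj⟩ := exists_gate hW.cvx ⟨1, hW.one⟩ p
      obtain ⟨j', hj'⟩ := exists_gate hW.cvx ⟨1, hW.one⟩ y
      have hjj : j = j' := by
        by_contra hne
        exact hnW j (D.cvx ρ hb.1 p hpρ y hyρ j (gate_mem_btw hj hj' hne).1) hj.1
      subst hjj
      obtain ⟨hI, -, s, hs, hsW⟩ := hσ
      obtain ⟨hI', -, s', hs', hsW'⟩ := hσ'
      have j1 : j ∈ Ax σ := D.cvx σ hI p hp.1 s hs j (hj.2 s hsW)
      have j2 : j ∈ Ax σ' := D.cvx σ' hI' y hy s' hs' j (hj'.2 s' hsW')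
      have hp' : p ∈ Ax σ' := D.cvx σ' hI' y hy j j2 p (hp.2 j j1)
      have d2 := D.small ρ hb.1 σ' hI' e2 p y hpρ hp' hyρ hy
      have := td_tri x p y
      omega
  | step y ρ1 e hρ1 he hn hq ih =>
    intro ρ hb σ hσ x hx hxρ hyρ
    by_cases hs : σ = ρ1
    · subst hs
      have hg : (σ ^ e)⁻¹ ∈ NW I Ax W := Subgroup.inv_mem _ (Subgroup.zpow_mem _ (Mset_sub_NW hσ) e)
      have hb' := hb.conj D hg
      have := ih _ hb' σ hσ ((σ ^ e)⁻¹ * x) (by rw [← zpow_neg]; exact (D.pow_mem hσ.1 _).2 hx)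
        ((D.conjAx ρ hb.1 _ _).2 (by simpa using hxρ)) ((D.conjAx ρ hb.1 _ _).2 (by simpa using hyρ))
      rw [D.conjP ρ hb.1, ← td_mul (σ ^ e)] at this
      simpa using this
    · exfalso
      have hnx := near_of_axis D hW hρ1 hσ (Ne.symm hs) hx
      obtain ⟨p, hp, -⟩ := id hnx
      obtain ⟨q, hq⟩ := exists_gate (D.cvx ρ1 hρ1.1) (D.ne ρ1 hρ1.1) (ρ1 ^ e * y)
      have hf := near_far D hW hρ1 hnx hn he hp hq
      have hb1 := D.big ρ1 hρ1.1
      have hne : p ≠ q := by rintro rfl; rw [td_self] at hf; omega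
      obtain ⟨b1, b2⟩ := gate_mem_btw hp hq hne
      have := D.small ρ1 hρ1.1 ρ hb.1 (hb.ne_M hρ1).symm p q hp.1 (D.cvx ρ hb.1 x hxρ _ hyρ p b1)
        hq.1 (D.cvx ρ hb.1 x hxρ _ hyρ q b2)
      omega

theorem W'_QQ (D : WD I Ax P L) (hW : Wm I Ax P L W) {y} (hy : y ∈ W' I Ax W) :
    QQ Ax P W (Mset I Ax W) (YW I Ax W) y := by
  obtain ⟨g, hg, y, hy, rfl⟩ := hy
  refine QQ_N D hW ?_ ?_ hg y (QQ.base _ hy)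
  · intro h hh y hy
    rcases hy with hy | ⟨σ, hσ, hy⟩
    · exact Or.inl ((HW_mem hW hh y).2 hy)
    · exact Or.inr ⟨_, HW_conj D hW hh hσ, (D.conjAx σ hσ.1 h _).2 (by simpa using hy)⟩
  · intro y hy ρ hρ
    rcases hy with hy | ⟨σ, hσ, hy⟩
    · exact Or.inl (near_of_mem D hW hρ hy)
    · by_cases hs : ρ = σ
      · subst hs
        exact Or.inr fun e => Or.inr ⟨ρ, hρ, (D.pow_mem hρ.1 e).2 hy⟩
      · exact Or.inl (near_of_axis D hW hρ hσ hs hy)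

theorem bad_diam (D : WD I Ax P L) (hW : Wm I Ax P L W) {ρ} (hb : Bad I Ax W ρ) {x y}
    (hx : x ∈ Ax ρ) (hx' : x ∈ W' I Ax W) (hy : y ∈ Ax ρ) (hy' : y ∈ W' I Ax W) :
    td x y ≤ 2 * P ρ + 2 := by
  obtain ⟨g, hg, x, hx1, rfl⟩ := hx'
  have hg' := Subgroup.inv_mem _ hg
  have hb' := hb.conj D hg'
  rcases hx1 with hx1 | ⟨σ, hσ, hx1⟩
  · exact absurd (by simpa using hx1) (hb.2 g⁻¹ hg' _ hx)
  have hq := W'_QQ D hW (W'_mul hg' hy')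
  have := lemK D hW hq _ hb' σ hσ x hx1 ((D.conjAx ρ hb.1 _ _).2 (by simpa using hx))
    ((D.conjAx ρ hb.1 _ _).2 (by simpa using hy))
  rw [D.conjP ρ hb.1, ← td_mul g] at this
  simpa using this

theorem WD.sub_of_far (D : WD I Ax P L) {ρ} (hρ : ρ ∈ I) {S : Set (FreeGroup α)} {c : ℕ}
    (hc : c < L ρ) (h : ¬ Ax ρ ⊆ S → ∀ x y, x ∈ Ax ρ → x ∈ S → y ∈ Ax ρ → y ∈ S → td x y ≤ c)
    {x} (hx : x ∈ Ax ρ) (hxS : x ∈ S) (hxS' : ρ * x ∈ S) : Ax ρ ⊆ S := by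
  by_contra hn
  have h1 := h hn x (ρ * x) hx hxS (by simpa using (D.pow_mem hρ 1).2 hx) hxS'
  have h2 := D.tr ρ hρ x hx 1 one_ne_zero
  rw [zpow_one] at h2
  omega

theorem W'_wm (D : WD I Ax P L) (hW : Wm I Ax P L W) : Wm I Ax P L (W' I Ax W) := by
  have key : ∀ ρ ∈ I, Ax ρ ⊆ W' I Ax W → ρ ∈ NW I Ax W := by
    intro ρ hρ hsub
    by_contra hn
    have hb : Bad I Ax W ρ := by
      by_contra hb; exact hn (not_bad D hρ hb).1
    obtain ⟨x, hx⟩ := D.ne ρ hρ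
    have hx2 : ρ * x ∈ Ax ρ := by simpa using (D.pow_mem hρ 1).2 hx
    have h1 := bad_diam D hW hb hx (hsub hx) hx2 (hsub hx2)
    have h2 := D.tr ρ hρ x hx 1 one_ne_zero
    have h3 := D.big ρ hρ
    rw [zpow_one] at h2
    omega
  refine ⟨YW_sub (Or.inl hW.one), W'_cvx D hW, ?_, ?_, ?_⟩
  · intro ρ hρ hsub x hx
    exact ⟨W'_mul (key ρ hρ hsub) hx, W'_mul (Subgroup.inv_mem _ (key ρ hρ hsub)) hx⟩
  · intro ρ hρ hn x y hx hx' hy hy'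
    have hb : Bad I Ax W ρ := by
      by_contra hb; exact hn (not_bad D hρ hb).2
    exact bad_diam D hW hb hx hx' hy hy'
  · intro n hn h1
    refine NW_concl D hW ?_ h1
    have : Subgroup.closure {ρ | ρ ∈ I ∧ Ax ρ ⊆ W' I Ax W} ≤ NW I Ax W := by
      rw [Subgroup.closure_le]
      intro ρ hρ; exact key ρ hρ.1 hρ.2
    exact this hn

def Wplus (W : Set (FreeGroup α)) : Set (FreeGroup α) := {x | ∃ w ∈ W, td x w ≤ 1}

theorem btw_short {x z y : FreeGroup α} (h : td x y ≤ 1) (hz : Btw x z y) : z = x ∨ z = y := by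
  unfold Btw at hz
  by_cases h0 : td x z = 0
  · left; exact (td_eq_zero.1 h0).symm
  · right; apply td_eq_zero.1; omega

theorem Wplus_cvx (hW : Cvx W) : Cvx (Wplus W) := by
  rintro x ⟨w, hw, hd⟩ y ⟨w', hw', hd'⟩ z hz
  have sub : ∀ v ∈ W, v ∈ Wplus W := fun v hv => ⟨v, hv, by simp [td_self]⟩
  rcases hz.or w with h | h
  · rcases btw_short hd h with rfl | rfl
    · exact ⟨w, hw, hd⟩
    · exact sub _ hw
  rcases h.or w' with h | h
  · exact sub _ (hW w hw w' hw' z h)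
  · rcases btw_short (by rw [td_comm]; exact hd') h with rfl | rfl
    · exact sub _ hw'
    · exact ⟨w', hw', hd'⟩

theorem Wplus_wm (D : WD I Ax P L) (hW : Wm I Ax P L W)
    (hA : ∀ ρ ∈ I, ¬ Ax ρ ⊆ W → ∀ x ∈ Ax ρ, x ∉ W) : Wm I Ax P L (Wplus W) := by
  have sub : ∀ v ∈ W, v ∈ Wplus W := fun v hv => ⟨v, hv, by simp [td_self]⟩
  have diam : ∀ ρ ∈ I, ¬ Ax ρ ⊆ W → ∀ x y, x ∈ Ax ρ → x ∈ Wplus W → y ∈ Ax ρ → y ∈ Wplus W →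
      td x y ≤ 2 := by
    rintro ρ hρ hn x y hx ⟨w, hw, hd⟩ hy ⟨w', hw', hd'⟩
    obtain ⟨p, hp⟩ := exists_gate hW.cvx ⟨1, hW.one⟩ x
    obtain ⟨q, hq⟩ := exists_gate hW.cvx ⟨1, hW.one⟩ y
    have h1 := hp.2 w hw
    have h2 := hq.2 w' hw'
    have hpq : p = q := by
      by_contra hne
      exact hA ρ hρ hn p (D.cvx ρ hρ x hx y hy p (gate_mem_btw hp hq hne).1) hp.1
    subst hpq
    have := td_tri x p y
    rw [td_comm p y] at this
    unfold Btw at h1 h2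
    omega
  have key : ∀ ρ ∈ I, Ax ρ ⊆ Wplus W → Ax ρ ⊆ W := by
    intro ρ hρ hsub
    by_contra hn
    obtain ⟨x, hx⟩ := D.ne ρ hρ
    have hx2 : ρ * x ∈ Ax ρ := by simpa using (D.pow_mem hρ 1).2 hx
    have h1 := diam ρ hρ hn x _ hx (hsub hx) hx2 (hsub hx2)
    have h2 := D.tr ρ hρ x hx 1 one_ne_zero
    have h3 := D.big ρ hρ
    rw [zpow_one] at h2
    omega
  refine ⟨sub _ hW.one, Wplus_cvx hW.cvx, ?_, ?_, ?_⟩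
  · rintro ρ hρ hsub x ⟨w, hw, hd⟩
    have := hW.inv ρ hρ (key ρ hρ hsub) w hw
    exact ⟨⟨_, this.1, by rwa [td_mul]⟩, ⟨_, this.2, by rwa [td_mul]⟩⟩
  · intro ρ hρ hn x y hx hx' hy hy'
    have := diam ρ hρ (fun h => hn (h.trans sub)) x y hx hx' hy hy'
    omega
  · intro n hn h1
    apply hW.concl n _ h1
    have : {ρ | ρ ∈ I ∧ Ax ρ ⊆ Wplus W} ⊆ {ρ | ρ ∈ I ∧ Ax ρ ⊆ W} :=
      fun ρ hρ => ⟨hρ.1, key ρ hρ.1 hρ.2⟩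
    exact Subgroup.closure_mono this hn

theorem univ_of_max (D : WD I Ax P L) (hW : Maximal (· ∈ {W | Wm I Ax P L W}) W) : W = Set.univ := by
  have hw : Wm I Ax P L W := hW.prop
  have hM : ∀ ρ ∈ I, ¬ Ax ρ ⊆ W → ∀ x ∈ Ax ρ, x ∉ W := by
    intro ρ hρ hn x hx hxW
    have hle : W ≤ W' I Ax W := fun x hx => YW_sub (Or.inl hx)
    have := hW.le_of_ge (W'_wm D hw) hle
    exact hn fun y hy => this (YW_sub (Or.inr ⟨ρ, ⟨hρ, hn, x, hx, hxW⟩, hy⟩))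
  have hle : W ≤ Wplus W := fun v hv => ⟨v, hv, by simp [td_self]⟩
  have hsub := hW.le_of_ge (Wplus_wm D hw hM) hle
  rw [Set.eq_univ_iff_forall]
  intro x
  by_contra hx
  obtain ⟨p, hp⟩ := exists_gate hw.cvx ⟨1, hw.one⟩ x
  have hpx : p ≠ x := by rintro rfl; exact hx hp.1
  have : 1 ≤ td p x := by
    rw [Nat.one_le_iff_ne_zero]; intro h; exact hpx (td_eq_zero.1 h)
  obtain ⟨z, hz, hz1⟩ := exists_btw this
  have hzW : z ∈ W := hsub ⟨p, hp.1, by rw [td_comm]; omega⟩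
  have h1 := hp.2 z hzW
  unfold Btw at hz h1
  rw [td_comm x p, td_comm x z] at h1
  omega

theorem chain_ub (D : WD I Ax P L) {c : Set (Set (FreeGroup α))} (hc : c ⊆ {W | Wm I Ax P L W})
    (hch : IsChain (· ⊆ ·) c) (hne : c.Nonempty) : Wm I Ax P L (⋃₀ c) := by
  have two : ∀ x y, x ∈ ⋃₀ c → y ∈ ⋃₀ c → ∃ V ∈ c, x ∈ V ∧ y ∈ V := by
    rintro x y ⟨V, hV, hx⟩ ⟨V', hV', hy⟩
    rcases hch.total hV hV' with h | h
    · exact ⟨V', hV', h hx, hy⟩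
    · exact ⟨V, hV, hx, h hy⟩
  have key : ∀ ρ ∈ I, Ax ρ ⊆ ⋃₀ c → ∃ V ∈ c, Ax ρ ⊆ V := by
    intro ρ hρ hs
    obtain ⟨x, hx⟩ := D.ne ρ hρ
    have hx2 : ρ * x ∈ Ax ρ := by simpa using (D.pow_mem hρ 1).2 hx
    obtain ⟨V, hV, h1, h2⟩ := two x _ (hs hx) (hs hx2)
    have := D.big ρ hρ
    exact ⟨V, hV, D.sub_of_far (c := 2 * P ρ + 2) hρ (by omega) ((hc hV).sm ρ hρ) hx h1 h2⟩
  obtain ⟨V0, hV0⟩ := hne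
  refine ⟨⟨V0, hV0, (hc hV0).one⟩, ?_, ?_, ?_, ?_⟩
  · intro x hx y hy z hz
    obtain ⟨V, hV, h1, h2⟩ := two x y hx hy
    exact ⟨V, hV, (hc hV).cvx x h1 y h2 z hz⟩
  · intro ρ hρ hs x hx
    obtain ⟨V, hV, hs'⟩ := key ρ hρ hs
    obtain ⟨V', hV', hx'⟩ := hx
    rcases hch.total hV hV' with h | h
    · have := (hc hV').inv ρ hρ (hs'.trans h) x hx'
      exact ⟨⟨V', hV', this.1⟩, ⟨V', hV', this.2⟩⟩
    · have := (hc hV).inv ρ hρ hs' x (h hx')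
      exact ⟨⟨V, hV, this.1⟩, ⟨V, hV, this.2⟩⟩
  · intro ρ hρ hn x y hx hx' hy hy'
    obtain ⟨V, hV, h1, h2⟩ := two x y hx' hy'
    refine (hc hV).sm ρ hρ (fun h => hn ?_) x y hx h1 hy h2
    exact h.trans (Set.subset_sUnion_of_mem hV)
  · intro n hn h1
    have : ∃ V ∈ c, n ∈ Subgroup.closure {ρ | ρ ∈ I ∧ Ax ρ ⊆ V} := by
      clear h1
      have mono : ∀ V V' : Set (FreeGroup α), V ⊆ V' → {ρ | ρ ∈ I ∧ Ax ρ ⊆ V} ⊆ {ρ | ρ ∈ I ∧ Ax ρ ⊆ V'} :=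
        fun V V' h ρ hρ => ⟨hρ.1, hρ.2.trans h⟩
      induction hn using Subgroup.closure_induction with
      | mem g hg =>
        obtain ⟨V, hV, h⟩ := key g hg.1 hg.2
        exact ⟨V, hV, Subgroup.subset_closure ⟨hg.1, h⟩⟩
      | one => exact ⟨V0, hV0, Subgroup.one_mem _⟩
      | mul a b _ _ ha hb =>
        obtain ⟨V, hV, ha⟩ := ha
        obtain ⟨V', hV', hb⟩ := hb
        rcases hch.total hV hV' with h | h
        · exact ⟨V', hV', Subgroup.mul_mem _
            (Subgroup.closure_mono (mono _ _ h) ha) hb⟩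
        · exact ⟨V, hV, Subgroup.mul_mem _ ha
            (Subgroup.closure_mono (mono _ _ h) hb)⟩
      | inv a _ ha =>
        obtain ⟨V, hV, ha⟩ := ha
        exact ⟨V, hV, Subgroup.inv_mem _ ha⟩
    obtain ⟨V, hV, h⟩ := this
    exact (hc hV).concl n h h1

theorem wm_singleton (D : WD I Ax P L) : Wm I Ax P L {1} := by
  have key : ∀ ρ ∈ I, ¬ Ax ρ ⊆ {1} := by
    intro ρ hρ hs
    obtain ⟨x, hx⟩ := D.ne ρ hρ
    have hx2 : ρ * x ∈ Ax ρ := by simpa using (D.pow_mem hρ 1).2 hx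
    have h2 := D.tr ρ hρ x hx 1 one_ne_zero
    have h3 := D.big ρ hρ
    have e1 := hs hx
    have e2 := hs hx2
    simp only [Set.mem_singleton_iff] at e1 e2
    rw [zpow_one, e2, e1, td_self] at h2
    omega
  refine ⟨rfl, ?_, ?_, ?_, ?_⟩
  · rintro x rfl y rfl z hz
    unfold Btw at hz
    rw [td_self] at hz
    exact (td_eq_zero.1 (by omega : td 1 z = 0)).symm
  · intro ρ hρ hs; exact absurd hs (key ρ hρ)
  · rintro ρ hρ - x y - rfl - rfl
    simp [td_self]
  · intro n hn h1
    exfalso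
    have : {ρ | ρ ∈ I ∧ Ax ρ ⊆ {1}} = ∅ := by
      ext ρ; simp only [Set.mem_setOf_eq, Set.mem_empty_iff_false, iff_false]
      rintro ⟨a, b⟩; exact key ρ a b
    rw [this, Subgroup.closure_empty] at hn
    exact h1 hn

theorem windmill (D : WD I Ax P L) {n} (hn : n ∈ Subgroup.closure I) (h1 : n ≠ 1) :
    Concl I Ax P L n := by
  obtain ⟨W, hW⟩ := zorn_subset {W | Wm I Ax P L W} (by
    intro c hc hch
    rcases c.eq_empty_or_nonempty with rfl | hne
    · exact ⟨{1}, wm_singleton D, by simp⟩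
    · exact ⟨⋃₀ c, chain_ub D hc hch hne, fun s hs => Set.subset_sUnion_of_mem hs⟩)
  have hu := univ_of_max D hW
  subst hu
  have := hW.prop.concl n
  simp only [Set.subset_univ, and_true, Set.setOf_mem_eq] at this
  exact this hn h1

end P2
end KW

set_option linter.all false
namespace KW
section P3
variable {α : Type} [DecidableEq α]

/-- cyclically reduced, metric form -/
def CR (c : FreeGroup α) : Prop := (c * c).norm = 2 * c.norm

theorem seg_sub {x y a z : FreeGroup α} (ha : Btw x a y) (hz : Btw x z a) : Btw x z y :=
  (btw_trans ha hz).1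

theorem seg_cvx (x y : FreeGroup α) : Cvx {z | Btw x z y} := by
  intro a ha b hb z hz
  rcases hz.or x with h | h
  · exact seg_sub ha h.symm
  · exact seg_sub hb h

theorem seg_dist {x y a b : FreeGroup α} (ha : Btw x a y) (hb : Btw x b y)
    (h : td x a ≤ td x b) : Btw x a b := by
  rcases ha.or b with h1 | h1
  · exact h1
  · unfold Btw at *
    have := td_tri a b y
    have t : td b a = 0 := by omega
    have := td_eq_zero.1 t
    subst this
    simp [td_self]

/-- the pow identity -/
theorem CR.pow {c : FreeGroup α} (h : CR c) (n : ℕ) : (c ^ n).norm = n * c.norm := by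
  -- Btw 1 (c^n) (c^(n+1))
  by_cases hc : c = 1
  · subst hc; simp
  have hpos : 0 < c.norm := Nat.pos_of_ne_zero (by rwa [Ne, FreeGroup.norm_eq_zero])
  have b1 : Btw 1 c (c * c) := by
    unfold Btw; rw [td_one, td_one, h]; unfold td; rw [inv_mul_cancel_left]; omega
  have key : ∀ n : ℕ, Btw 1 (c ^ n) (c ^ (n + 1)) ∧ (c ^ n).norm = n * c.norm := by
    intro n
    induction n with
    | zero => simp [Btw, td_self]
    | succ n ih =>
      obtain ⟨ih1, ih2⟩ := ih
      have e : (c ^ (n + 1)).norm = (n + 1) * c.norm := by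
        unfold Btw at ih1
        rw [td_one, td_one] at ih1
        have : td (c ^ n) (c ^ (n + 1)) = c.norm := by
          unfold td; rw [pow_succ, inv_mul_cancel_left]
        rw [this, ih2] at ih1
        rw [← ih1]; ring
      refine ⟨?_, e⟩
      -- Btw (c^n) (c^(n+1)) (c^(n+2))
      have b2 : Btw (c ^ n) (c ^ (n + 1)) (c ^ (n + 1 + 1)) := by
        have := b1.mul (c ^ n)
        simpa [pow_succ, mul_assoc] using this
      rcases b2.symm.or 1 with h1 | h1
      · exact h1.symm
      · -- Btw 1 c^(n+1) c^n
        exfalso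
        unfold Btw at h1
        rw [td_one, td_one, e, ih2] at h1
        have : (n + 1) * c.norm = n * c.norm + c.norm := by ring
        omega
  exact (key n).2

theorem td_zpow (c x : FreeGroup α) (a b : ℤ) :
    td (c ^ a * x) (c ^ b * x) = td x (c ^ (b - a) * x) := by
  rw [← td_mul (c ^ (-a)) (c ^ a * x)]
  simp only [← mul_assoc, ← zpow_add]
  congr 1
  · simp
  · rw [neg_add_eq_sub]

/-- axis -/
def Axis (ρ : FreeGroup α) : Set (FreeGroup α) := {x | CR (x⁻¹ * ρ * x)}

theorem mem_axis_iff {ρ x : FreeGroup α} :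
    x ∈ Axis ρ ↔ td x (ρ * (ρ * x)) = 2 * td x (ρ * x) := by
  unfold Axis CR td
  simp only [Set.mem_setOf_eq, mul_assoc, mul_inv_cancel_left]

theorem axis_conj {ρ g x : FreeGroup α} : x ∈ Axis (g * ρ * g⁻¹) ↔ g⁻¹ * x ∈ Axis ρ := by
  unfold Axis
  simp [mul_assoc]

theorem td_axis_nat {ρ x : FreeGroup α} (h : x ∈ Axis ρ) (n : ℕ) :
    td x (ρ ^ n * x) = n * td x (ρ * x) := by
  have := CR.pow h n
  have e : (x⁻¹ * ρ * x) ^ n = x⁻¹ * (ρ ^ n * x) := by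
    have := conj_pow (i := n) (a := x⁻¹) (b := ρ)
    rw [inv_inv] at this
    rw [this, mul_assoc]
  rw [e, mul_assoc] at this
  exact this

theorem td_axis {ρ x : FreeGroup α} (h : x ∈ Axis ρ) (e : ℤ) :
    td x (ρ ^ e * x) = e.natAbs * td x (ρ * x) := by
  rcases Int.natAbs_eq e with he | he
  · conv_lhs => rw [he, zpow_natCast]
    exact td_axis_nat h _
  · conv_lhs => rw [he, zpow_neg, zpow_natCast]
    rw [td_comm, ← td_mul (ρ ^ e.natAbs), mul_inv_cancel_left]
    exact td_axis_nat h _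

theorem btw_axis {ρ x : FreeGroup α} (h : x ∈ Axis ρ) {a b c : ℤ} (hab : a ≤ b) (hbc : b ≤ c) :
    Btw (ρ ^ a * x) (ρ ^ b * x) (ρ ^ c * x) := by
  unfold Btw
  rw [td_zpow, td_zpow, td_zpow, td_axis h, td_axis h, td_axis h, ← add_mul]
  congr 1
  omega

/-- the line through x -/
def Line (ρ x : FreeGroup α) : Set (FreeGroup α) :=
  {z | ∃ n : ℕ, Btw (ρ ^ (-(n : ℤ)) * x) z (ρ ^ (n : ℤ) * x)}

theorem line_mono {ρ x z : FreeGroup α} (h : x ∈ Axis ρ) {n m : ℕ} (hnm : n ≤ m)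
    (hz : Btw (ρ ^ (-(n : ℤ)) * x) z (ρ ^ (n : ℤ) * x)) :
    Btw (ρ ^ (-(m : ℤ)) * x) z (ρ ^ (m : ℤ) * x) := by
  have h1 : Btw (ρ ^ (-(m : ℤ)) * x) (ρ ^ (-(n : ℤ)) * x) (ρ ^ (m : ℤ) * x) :=
    btw_axis h (by omega) (by omega)
  have h2 : Btw (ρ ^ (-(m : ℤ)) * x) (ρ ^ (n : ℤ) * x) (ρ ^ (m : ℤ) * x) :=
    btw_axis h (by omega) (by omega)
  exact seg_cvx _ _ _ h1 _ h2 z hz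

theorem line_cvx {ρ x : FreeGroup α} (h : x ∈ Axis ρ) : Cvx (Line ρ x) := by
  rintro a ⟨n, ha⟩ b ⟨m, hb⟩ z hz
  refine ⟨max n m, ?_⟩
  exact seg_cvx _ _ _ (line_mono h (le_max_left n m) ha) _ (line_mono h (le_max_right n m) hb) z hz

theorem self_line (ρ x : FreeGroup α) : x ∈ Line ρ x := ⟨0, by simp [Btw, td_self]⟩

theorem line_disp {ρ x z : FreeGroup α} (h : x ∈ Axis ρ) (hz : z ∈ Line ρ x) :
    ∀ m : ℕ, td z (ρ ^ m * z) = m * td x (ρ * x) := by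
  intro m
  obtain ⟨n, hz⟩ := hz
  -- both in the segment [-(n+m), n+m]
  have hz1 := line_mono h (Nat.le_add_right n m) hz
  have hz2 := (hz.mul (ρ ^ m))
  have e1 : ρ ^ m * (ρ ^ (-(n : ℤ)) * x) = ρ ^ ((m : ℤ) - n) * x := by
    rw [← mul_assoc, ← zpow_natCast, ← zpow_add]; rfl
  have e2 : ρ ^ m * (ρ ^ (n : ℤ) * x) = ρ ^ ((m : ℤ) + n) * x := by
    rw [← mul_assoc, ← zpow_natCast, ← zpow_add]
  rw [e1, e2] at hz2
  have hz3 : Btw (ρ ^ (-((n + m : ℕ) : ℤ)) * x) (ρ ^ m * z) (ρ ^ ((n + m : ℕ) : ℤ) * x) := by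
    have h1 : Btw (ρ ^ (-((n + m : ℕ) : ℤ)) * x) (ρ ^ ((m : ℤ) - n) * x) (ρ ^ ((n + m : ℕ) : ℤ) * x) :=
      btw_axis h (by omega) (by omega)
    have h2 : Btw (ρ ^ (-((n + m : ℕ) : ℤ)) * x) (ρ ^ ((m : ℤ) + n) * x) (ρ ^ ((n + m : ℕ) : ℤ) * x) :=
      btw_axis h (by omega) (by omega)
    exact seg_cvx _ _ _ h1 _ h2 _ hz2
  -- distances from the left end
  set l := ρ ^ (-((n + m : ℕ) : ℤ)) * x with hl
  set q := td x (ρ * x) with hq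
  have d1 : td l z = m * q + td (ρ ^ (-(n : ℤ)) * x) z := by
    have hb : Btw l (ρ ^ (-(n : ℤ)) * x) (ρ ^ ((n : ℕ) : ℤ) * x) :=
      btw_axis h (by omega) (by omega)
    have := btw_trans hb.symm hz.symm
    have := this.2
    unfold Btw at this
    have e : td l (ρ ^ (-(n : ℤ)) * x) = m * q := by
      rw [hl, td_zpow, td_axis h]; congr 1; omega
    rw [td_comm l, ← this, td_comm _ l, e, td_comm z]; omega
  have d2 : td l (ρ ^ m * z) = 2 * m * q + td (ρ ^ (-(n : ℤ)) * x) z := by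
    have hb : Btw l (ρ ^ ((m : ℤ) - n) * x) (ρ ^ ((m : ℤ) + n) * x) :=
      btw_axis h (by omega) (by omega)
    have := btw_trans hb.symm hz2.symm
    have := this.2
    unfold Btw at this
    have e : td l (ρ ^ ((m : ℤ) - n) * x) = 2 * m * q := by
      rw [hl, td_zpow, td_axis h]; congr 1; omega
    have e3 : td (ρ ^ ((m : ℤ) - n) * x) (ρ ^ m * z) = td (ρ ^ (-(n : ℤ)) * x) z := by
      rw [← e1, td_mul]
    rw [td_comm (ρ ^ m * z)] at this
    rw [td_comm l, ← this, td_comm _ l, e, e3]; omega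
  have := seg_dist hz1 hz3 (by rw [d1, d2]; nlinarith)
  unfold Btw at this
  rw [d1, d2] at this
  nlinarith

theorem line_sub_axis {ρ x z : FreeGroup α} (h : x ∈ Axis ρ) (hz : z ∈ Line ρ x) : z ∈ Axis ρ := by
  rw [mem_axis_iff]
  have h1 := line_disp h hz 1
  have h2 := line_disp h hz 2
  rw [pow_one] at h1
  rw [pow_two, mul_assoc] at h2
  rw [h1, h2]; ring

theorem line_mul {ρ x z : FreeGroup α} (h : x ∈ Axis ρ) (hz : z ∈ Line ρ x) (e : ℤ) :
    ρ ^ e * z ∈ Line ρ x := by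
  obtain ⟨n, hz⟩ := hz
  refine ⟨n + e.natAbs, ?_⟩
  have hz2 := (hz.mul (ρ ^ e))
  rw [← mul_assoc, ← mul_assoc, ← zpow_add, ← zpow_add] at hz2
  refine seg_cvx _ _ _ ?_ _ ?_ _ hz2
  · exact btw_axis h (by omega) (by omega)
  · exact btw_axis h (by omega) (by omega)

theorem axis_disp {ρ x y : FreeGroup α} (h : x ∈ Axis ρ) (hy : y ∈ Axis ρ) (hρ : ρ ≠ 1) :
    y ∈ Line ρ x := by
  obtain ⟨p, hp⟩ := exists_gate (line_cvx h) ⟨x, self_line ρ x⟩ y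
  have hgate : ∀ e : ℤ, IsGate (Line ρ x) (ρ ^ e * y) (ρ ^ e * p) := by
    intro e
    refine ⟨line_mul h hp.1 e, fun s hs => ?_⟩
    have := (hp.2 _ (line_mul h hs (-e))).mul (ρ ^ e)
    rw [← mul_assoc (ρ ^ e), ← zpow_add] at this
    simpa using this
  have hq : 0 < td x (ρ * x) := by
    apply Nat.pos_of_ne_zero
    intro h0
    have := td_eq_zero.1 h0
    exact hρ (by simpa using this.symm)
  have d1 := line_disp h hp.1 1
  have d2 := line_disp h hp.1 2
  have g1 := gate_sum hp (hgate 1) (by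
    intro h0; rw [zpow_one] at h0; rw [pow_one] at d1; rw [← h0, td_self] at d1; omega)
  have g2 := gate_sum hp (hgate 2) (by
    intro h0; rw [zpow_ofNat] at h0; rw [← h0, td_self] at d2; omega)
  rw [mem_axis_iff] at hy
  rw [zpow_ofNat, td_mul, d2, pow_two, mul_assoc, hy] at g2
  rw [zpow_one, td_mul] at g1
  rw [pow_one] at d1
  rw [g1, d1, td_comm p y] at g2
  have : td y p = 0 := by omega
  have := td_eq_zero.1 this
  rw [this]; exact hp.1

theorem axis_eq_line {ρ x : FreeGroup α} (h : x ∈ Axis ρ) (hρ : ρ ≠ 1) : Axis ρ = Line ρ x :=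
  Set.Subset.antisymm (fun _ hy => axis_disp h hy hρ) (fun _ hy => line_sub_axis h hy)

/-- translation length -/
noncomputable def tl (ρ : FreeGroup α) : ℕ := sInf (Set.range fun x => td x (ρ * x))

theorem tl_conj (ρ g : FreeGroup α) : tl (g * ρ * g⁻¹) = tl ρ := by
  unfold tl
  congr 1
  ext n
  constructor
  · rintro ⟨x, rfl⟩
    refine ⟨g⁻¹ * x, ?_⟩
    show td _ _ = td _ _
    rw [← td_mul g]; simp [mul_assoc]
  · rintro ⟨x, rfl⟩
    refine ⟨g * x, ?_⟩
    show td _ _ = td _ _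
    rw [← td_mul g x]; simp [mul_assoc]

theorem tl_eq {ρ x : FreeGroup α} (h : x ∈ Axis ρ) : tl ρ = td x (ρ * x) := by
  apply le_antisymm
  · exact Nat.sInf_le ⟨x, rfl⟩
  · apply le_csInf (Set.range_nonempty _)
    rintro n ⟨y, rfl⟩
    show td x (ρ * x) ≤ td y (ρ * y)
    by_contra hc
    push Not at hc
    -- n * tl ≤ 2 d + n * d(y)
    have hy : ∀ n : ℕ, td y (ρ ^ n * y) ≤ n * td y (ρ * y) := by
      intro n
      induction n with
      | zero => simp [td_self]
      | succ n ih =>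
        have := td_tri y (ρ ^ n * y) (ρ ^ (n+1) * y)
        rw [pow_succ, mul_assoc, td_mul] at this
        rw [pow_succ, mul_assoc]
        nlinarith
    have hn := td_axis_nat h (2 * td x y + 1)
    have t1 := td_tri x y (ρ ^ (2 * td x y + 1) * x)
    have t2 := td_tri y (ρ ^ (2 * td x y + 1) * y) (ρ ^ (2 * td x y + 1) * x)
    rw [td_mul, td_comm y x] at t2
    have := hy (2 * td x y + 1)
    have h3 : (2 * td x y + 1) * (td y (ρ * y) + 1) ≤ (2 * td x y + 1) * td x (ρ * x) :=
      Nat.mul_le_mul_left _ hc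
    nlinarith

theorem btw_or_cut {x : FreeGroup α} {ρ : FreeGroup α} (h : 1 ∈ Axis ρ) (hρ : ρ ≠ 1) {z}
    (hz : z ∈ Axis ρ) (hle : z.norm ≤ ρ.norm) : Btw 1 z ρ ∨ Btw 1 z ρ⁻¹ := by
  obtain ⟨n, hn⟩ := axis_disp h hz hρ
  -- enlarge n to n+1
  have hn := line_mono h (Nat.le_add_right n 1) hn
  rcases hn.or 1 with h1 | h1
  · right
    have h2 : Btw 1 ρ⁻¹ (ρ ^ (-((n + 1 : ℕ) : ℤ)) * 1) := by
      have := btw_axis h (a := -((n + 1 : ℕ) : ℤ)) (b := -1) (c := 0) (by omega) (by omega)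
      simpa using this.symm
    apply seg_dist h1.symm h2
    rw [td_one, td_one, FreeGroup.norm_inv_eq]; exact hle
  · left
    have h2 : Btw 1 ρ (ρ ^ (((n + 1 : ℕ) : ℤ)) * 1) := by
      have := btw_axis h (a := 0) (b := 1) (c := ((n + 1 : ℕ) : ℤ)) (by omega) (by omega)
      simpa using this
    apply seg_dist h1 h2
    rw [td_one, td_one]; exact hle

/-- Greendlinger type lemma. -/
theorem greendlinger {R : Set (FreeGroup α)} (hR : ∀ r ∈ R, CR r ∧ 20 ≤ r.norm)
    (hconj : ∀ r ∈ R, ∀ g, CR (g⁻¹ * r * g) → g⁻¹ * r * g ∈ R)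
    (hpiece : ∀ r ∈ R, ∀ r' ∈ R, r ≠ r' → ∀ z, (Btw 1 z r ∨ Btw 1 z r⁻¹) →
      (Btw 1 z r' ∨ Btw 1 z r'⁻¹) → 20 * z.norm ≤ r.norm ∧ 20 * z.norm ≤ r'.norm)
    {n : FreeGroup α} (hn : n ∈ Subgroup.normalClosure R) (h1 : n ≠ 1) :
    ∃ r ∈ R, ∃ x z y : FreeGroup α, n = x * z * y ∧ n.norm = x.norm + z.norm + y.norm ∧
      (Btw 1 z r ∨ Btw 1 z r⁻¹) ∧ r.norm ≤ z.norm + 4 * (r.norm / 20) + 2 := by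
  set I : Set (FreeGroup α) := {ρ | ∃ x, x⁻¹ * ρ * x ∈ R} with hI
  have ne1 : ∀ ρ ∈ I, ρ ≠ 1 := by
    rintro ρ ⟨x, hx⟩ rfl
    have := (hR _ hx).2
    simp at this
  have axR : ∀ ρ ∈ I, ∀ x ∈ Axis ρ, x⁻¹ * ρ * x ∈ R := by
    rintro ρ ⟨y, hy⟩ x hx
    have := hconj _ hy (y⁻¹ * x)
    have e : (y⁻¹ * x)⁻¹ * (y⁻¹ * ρ * y) * (y⁻¹ * x) = x⁻¹ * ρ * x := by group
    rw [e] at this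
    exact this hx
  have ntl : ∀ ρ ∈ I, ∀ x ∈ Axis ρ, (x⁻¹ * ρ * x).norm = tl ρ := by
    intro ρ hρ x hx
    rw [tl_eq hx]; unfold td; rw [mul_assoc]
  have D : WD I Axis (fun ρ => tl ρ / 20) tl := by
    refine ⟨?_, fun ρ _ g x => axis_conj, ?_, fun ρ _ g => tl_conj ρ g, ?_, ?_, ?_, ?_, ?_⟩
    · rintro ρ ⟨x, hx⟩ g
      exact ⟨g * x, by simpa [mul_assoc] using hx⟩
    · intro ρ _ g; simp only [tl_conj]
    · intro ρ hρ
      obtain ⟨x, hx⟩ := id hρ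
      have hx' : x ∈ Axis ρ := (hR _ hx).1
      rw [axis_eq_line hx' (ne1 ρ hρ)]
      exact line_cvx hx'
    · rintro ρ ⟨x, hx⟩; exact ⟨x, (hR _ hx).1⟩
    · intro ρ hρ x hx e he
      rw [td_axis hx, tl_eq hx]
      exact Nat.le_mul_of_pos_left _ (by omega)
    · rintro ρ hρ
      obtain ⟨x, hx⟩ := id hρ
      have h1 := (hR _ hx).2
      have := ntl ρ hρ x (hR _ hx).1
      omega
    · intro ρ hρ ρ' hρ' hne x y hx hx' hy hy'
      -- translate to x
      set r := x⁻¹ * ρ * x with hr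
      set r' := x⁻¹ * ρ' * x with hr'
      have hrR := axR ρ hρ x hx
      have hrR' := axR ρ' hρ' x hx'
      have hrne : r ≠ r' := by
        intro h; apply hne
        have : x * r * x⁻¹ = x * r' * x⁻¹ := by rw [h]
        simpa [hr, hr', mul_assoc] using this
      have n1 := ntl ρ hρ x hx
      rw [← hr] at n1 hrR
      rw [← hr'] at hrR'
      have c1 := hR r hrR
      have c2 := hR r' hrR'
      set t := min (td x y) (min r.norm r'.norm) with ht
      obtain ⟨z0, hz0, hz1⟩ := exists_btw (x := x) (y := y) (t := t) (by omega)
      have cv : ∀ ρ ∈ I, Cvx (Axis ρ) := by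
        intro ρ hρ
        obtain ⟨x, hx⟩ := id hρ
        have hx' : x ∈ Axis ρ := (hR _ hx).1
        rw [axis_eq_line hx' (ne1 ρ hρ)]
        exact line_cvx hx'
      have a1 : z0 ∈ Axis ρ := cv ρ hρ x hx y hy z0 hz0
      have a2 : z0 ∈ Axis ρ' := cv ρ' hρ' x hx' y hy' z0 hz0
      have b1 : x⁻¹ * z0 ∈ Axis r := by
        have := axis_conj (ρ := ρ) (g := x⁻¹) (x := x⁻¹ * z0)
        rw [inv_inv, mul_inv_cancel_left] at this
        exact this.2 a1
      have b2 : x⁻¹ * z0 ∈ Axis r' := by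
        have := axis_conj (ρ := ρ') (g := x⁻¹) (x := x⁻¹ * z0)
        rw [inv_inv, mul_inv_cancel_left] at this
        exact this.2 a2
      have o1 : (1 : FreeGroup α) ∈ Axis r := by
        show CR _; simpa using c1.1
      have o2 : (1 : FreeGroup α) ∈ Axis r' := by
        show CR _; simpa using c2.1
      have r1 : r ≠ 1 := by intro h; rw [h] at c1; simp at c1
      have r2 : r' ≠ 1 := by intro h; rw [h] at c2; simp at c2
      have hzn : (x⁻¹ * z0).norm = t := hz1
      have := hpiece r hrR r' hrR' hrne (x⁻¹ * z0)
        (btw_or_cut (x := 1) o1 r1 b1 (by omega)) (btw_or_cut (x := 1) o2 r2 b2 (by omega))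
      omega
  have hcl : n ∈ Subgroup.closure I := by
    have : Subgroup.normalClosure R ≤ Subgroup.closure I := by
      unfold Subgroup.normalClosure
      rw [Subgroup.closure_le]
      intro g hg
      apply Subgroup.subset_closure
      rw [Group.mem_conjugatesOfSet_iff] at hg
      obtain ⟨r, hr, hc⟩ := hg
      rw [isConj_iff] at hc
      obtain ⟨c, rfl⟩ := hc
      exact ⟨c, by simpa [mul_assoc] using hr⟩
    exact this hn
  obtain ⟨ρ, hρ, x, hx, y, hy, hsum, hlen⟩ := windmill D hcl h1
  simp only at hlen
  have n1 := ntl ρ hρ x hx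
  have hrR := axR ρ hρ x hx
  set r := x⁻¹ * ρ * x with hr
  have c1 := hR r hrR
  set t := min (td x y) r.norm with ht
  obtain ⟨z0, hz0, hz1⟩ := exists_btw (x := x) (y := y) (t := t) (by omega)
  have a1 : z0 ∈ Axis ρ := D.cvx ρ hρ x hx y hy z0 hz0
  have b1 : x⁻¹ * z0 ∈ Axis r := by
    have := axis_conj (ρ := ρ) (g := x⁻¹) (x := x⁻¹ * z0)
    rw [inv_inv, mul_inv_cancel_left] at this
    exact this.2 a1
  have o1 : (1 : FreeGroup α) ∈ Axis r := by
    show CR _; simpa using c1.1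
  have r1 : r ≠ 1 := by intro h; rw [h] at c1; simp at c1
  have hzn : (x⁻¹ * z0).norm = t := hz1
  refine ⟨r, hrR, x, x⁻¹ * z0, z0⁻¹ * n, by group, ?_, btw_or_cut (x := 1) o1 r1 b1 (by omega), by omega⟩
  have t1 := td_tri 1 z0 n
  have t2 := td_tri 1 x z0
  have t3 := td_tri z0 y n
  unfold Btw at hz0
  have e1 : n.norm = td 1 n := by rw [td_one]
  have e2 : x.norm = td 1 x := by rw [td_one]
  have e3 : (z0⁻¹ * n).norm = td z0 n := rfl
  have e4 : (x⁻¹ * z0).norm = td x z0 := rfl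
  omega

/-- conjugates that are cyclically reduced are rotations -/
theorem rotation {c g : FreeGroup α} (hc : CR c) (h1 : c ≠ 1) (hg : CR (g⁻¹ * c * g)) :
    ∃ a b : FreeGroup α, c = a * b ∧ c.norm = a.norm + b.norm ∧ g⁻¹ * c * g = b * a := by
  have o1 : (1 : FreeGroup α) ∈ Axis c := by show CR _; simpa using hc
  obtain ⟨n, hn⟩ := axis_disp o1 (show g ∈ Axis c from hg) h1
  have key : ∀ (m : ℕ) (a : ℤ), Btw (c ^ a * 1) g (c ^ (a + m) * 1) →
      ∃ i : ℤ, Btw (c ^ i * 1) g (c ^ (i + 1) * 1) := by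
    intro m
    induction m with
    | zero =>
      intro a h
      refine ⟨a, ?_⟩
      simp only [Nat.cast_zero, add_zero] at h
      unfold Btw at h
      rw [td_self] at h
      have := td_eq_zero.1 (show td (c ^ a * 1) g = 0 by omega)
      rw [← this]
      exact Btw.left _ _
    | succ m ih =>
      intro a h
      rcases h.or (c ^ (a + 1) * 1) with h | h
      · exact ⟨a, h⟩
      · apply ih (a + 1)
        convert h using 3
        push_cast; ring
  obtain ⟨i, hi⟩ := key (2 * n) (-n) (by convert hn using 3; push_cast; ring)
  have h2 := hi.mul (c ^ (-i))
  simp only [mul_one, ← zpow_add] at h2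
  rw [neg_add_cancel, zpow_zero, neg_add_cancel_left, zpow_one] at h2
  refine ⟨c ^ (-i) * g, (c ^ (-i) * g)⁻¹ * c, by group, ?_, ?_⟩
  · unfold Btw at h2
    rw [td_one, td_one] at h2
    exact h2.symm
  · group

end P3
end KW

set_option linter.all false
namespace KW
section P4
variable {α : Type} [DecidableEq α]

/-- signed body -/
def sb (body : α → List (α × Bool)) (y : α × Bool) : List (α × Bool) :=
  if y.2 then FreeGroup.invRev (body y.1) else body y.1

def nl (y : α × Bool) : α × Bool := (y.1, !y.2)

theorem sb_nl (body : α → List (α × Bool)) (y : α × Bool) :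
    sb body (nl y) = FreeGroup.invRev (sb body y) := by
  obtain ⟨x, e⟩ := y
  cases e <;> simp [sb, nl]

theorem nl_nl (y : α × Bool) : nl (nl y) = y := by simp [nl]
theorem nl_ne (y : α × Bool) : nl y ≠ y := by
  obtain ⟨x, e⟩ := y; simp [nl]

structure SC (cl : α → Bool) (body : α → List (α × Bool)) : Prop where
  red : ∀ x, FreeGroup.IsReduced (body x)
  opp : ∀ x, ∀ l ∈ body x, cl l.1 ≠ cl x
  len : ∀ x x', cl x = cl x' → (body x).length = (body x').length
  big : ∀ x, 1000 ≤ (body x).length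
  norep : ∀ y y' : α × Bool, cl y.1 = cl y'.1 → ∀ p z s p' s', sb body y = p ++ z ++ s →
    sb body y' = p' ++ z ++ s' → (body y.1).length ≤ 20 * z.length → y = y' ∧ p.length = p'.length

variable {cl : α → Bool} {body : α → List (α × Bool)}

theorem sb_length (y : α × Bool) : (sb body y).length = (body y.1).length := by
  unfold sb; split <;> simp

theorem mem_invRev {L : List (α × Bool)} {l : α × Bool} (h : l ∈ FreeGroup.invRev L) : nl l ∈ L := by
  unfold FreeGroup.invRev at h
  simp at h
  obtain ⟨a, h⟩ := h
  rcases h with ⟨h, rfl⟩ | ⟨h, rfl⟩ <;> simpa [nl] using h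

theorem SC.opp' (S : SC cl body) (y : α × Bool) : ∀ l ∈ sb body y, cl l.1 ≠ cl y.1 := by
  intro l hl
  unfold sb at hl
  split at hl
  · have := S.opp y.1 _ (mem_invRev hl)
    exact this
  · exact S.opp y.1 l hl

theorem isReduced_invRev {L : List (α × Bool)} (h : FreeGroup.IsReduced L) :
    FreeGroup.IsReduced (FreeGroup.invRev L) := by
  have := FreeGroup.isReduced_toWord (x := (FreeGroup.mk L)⁻¹)
  rwa [FreeGroup.toWord_inv, FreeGroup.toWord_mk, h.reduce_eq] at this

theorem SC.red' (S : SC cl body) (y : α × Bool) : FreeGroup.IsReduced (sb body y) := by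
  unfold sb
  split
  · exact isReduced_invRev (S.red _)
  · exact S.red _

/-- words which are cyclic rotations of `y :: sb y` -/
def Rot (body : α → List (α × Bool)) (y : α × Bool) (W : List (α × Bool)) : Prop :=
  ∃ c d, sb body y = c ++ d ∧ W = d ++ y :: c

theorem Rot.length {y : α × Bool} {W} (h : Rot body y W) : W.length = (body y.1).length + 1 := by
  obtain ⟨c, d, h1, rfl⟩ := h
  rw [← sb_length, h1]; simp; omega

theorem Rot.inv {y : α × Bool} {W} (h : Rot body y W) : Rot body (nl y) (FreeGroup.invRev W) := by
  obtain ⟨c, d, h1, rfl⟩ := h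
  refine ⟨FreeGroup.invRev d, FreeGroup.invRev c, ?_, ?_⟩
  · rw [sb_nl, h1, FreeGroup.invRev_append]
  · rw [FreeGroup.invRev_append, FreeGroup.invRev_cons]; simp [nl, FreeGroup.invRev]

theorem Rot.rot {y : α × Bool} {A B} (h : Rot body y (A ++ B)) : Rot body y (B ++ A) := by
  obtain ⟨c, d, h1, h2⟩ := h
  rw [List.append_eq_append_iff] at h2
  rcases h2 with ⟨e, rfl, rfl⟩ | ⟨e, rfl, h2⟩
  · exact ⟨c ++ A, e, by rw [h1, List.append_assoc], by simp⟩
  · cases e with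
    | nil => 
      simp at h2 ⊢; subst h2
      exact ⟨sb body y, [], by simp, by simp [h1]⟩
    | cons l e =>
      simp at h2
      obtain ⟨rfl, rfl⟩ := h2
      exact ⟨e, B ++ d, by rw [h1, List.append_assoc], by simp⟩

theorem Rot.suffix {y : α × Bool} {W} (h : Rot body y W) {A z B} (e : W = A ++ z ++ B) :
    ∃ W', Rot body y W' ∧ z <+: W' := by
  subst e
  rw [List.append_assoc] at h
  exact ⟨_, h.rot, by rw [List.append_assoc]; exact List.prefix_append _ _⟩

theorem isReduced_append {A B : List (α × Bool)} (hA : FreeGroup.IsReduced A)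
    (hB : FreeGroup.IsReduced B) (h : ∀ a ∈ A.getLast?, ∀ b ∈ B.head?, b ≠ nl a) :
    FreeGroup.IsReduced (A ++ B) := by
  unfold FreeGroup.IsReduced
  rw [List.isChain_append]
  refine ⟨hA, hB, fun a ha b hb hab => ?_⟩
  by_contra hne
  apply h a ha b hb
  obtain ⟨a1, a2⟩ := a
  obtain ⟨b1, b2⟩ := b
  simp at hab hne
  simp only [nl]
  ext
  · exact hab.symm
  · cases a2 <;> cases b2 <;> simp_all

theorem isReduced_append_cl {A B : List (α × Bool)} (hA : FreeGroup.IsReduced A)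
    (hB : FreeGroup.IsReduced B) (h : ∀ a ∈ A, ∀ b ∈ B, cl b.1 ≠ cl a.1) :
    FreeGroup.IsReduced (A ++ B) := by
  apply isReduced_append hA hB
  intro a ha b hb hab
  have ha' : a ∈ A := by
    have := List.mem_of_getLast? ha; exact this
  have hb' : b ∈ B := List.mem_of_head? hb
  apply h a ha' b hb'
  rw [hab]; rfl

theorem Rot.red (S : SC cl body) {y : α × Bool} {W} (h : Rot body y W) : FreeGroup.IsReduced W := by
  obtain ⟨c, d, h1, rfl⟩ := h
  have hr := S.red' y
  have ho := S.opp' y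
  rw [h1] at hr ho
  have rd : FreeGroup.IsReduced d := hr.subw (List.suffix_append c d).isInfix
  have rc : FreeGroup.IsReduced c := hr.subw (List.prefix_append c d).isInfix
  have ryc : FreeGroup.IsReduced (y :: c) := by
    apply isReduced_append_cl (cl := cl) (A := [y]) (B := c) _ rc
    · intro a ha b hb
      simp at ha; subst ha
      exact ho b (by simp [hb])
    · exact FreeGroup.IsReduced.singleton
  apply isReduced_append rd ryc
  intro a ha b hb hab
  have ha' : a ∈ d := List.mem_of_getLast? ha
  simp at hb
  subst hb
  apply ho a (by simp [ha'])
  rw [hab]; rfl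

theorem Rot.CR (S : SC cl body) {y : α × Bool} {W} (h : Rot body y W) : CR (FreeGroup.mk W) := by
  unfold KW.CR
  rw [FreeGroup.mul_mk, norm_mk_red, norm_mk_red (h.red S)]
  · simp; omega
  · -- W ++ W reduced: d ++ (y::c ++ d) ++ y :: c
    obtain ⟨c, d, h1, rfl⟩ := h
    have r1 := Rot.red S ⟨c, d, h1, rfl⟩
    have r2 : FreeGroup.IsReduced (y :: c ++ d) :=
      Rot.red S (W := y :: c ++ d) (y := y) ⟨c ++ d, [], by simpa using h1, by simp⟩
    have r3 : FreeGroup.IsReduced (d ++ y :: c ++ d) :=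
      FreeGroup.IsReduced.append_overlap (L₁ := d) (L₂ := y :: c) (L₃ := d) r1 r2 (by simp)
    have r4 : FreeGroup.IsReduced ((y :: c) ++ d ++ y :: c) := by
      by_cases hd : d = []
      · subst hd
        simp at h1 ⊢
        have r5 : FreeGroup.IsReduced (y :: c) := by simpa using r2
        have r6 : FreeGroup.IsReduced (c ++ [y]) := by
          apply Rot.red S (y := y); exact ⟨[], c, by simpa using h1, by simp⟩
        have hc : c ≠ [] := by
          rintro rfl
          have := S.big y.1
          rw [← sb_length, h1] at this; simp at this
        have r7 : FreeGroup.IsReduced ([y] ++ c ++ [y]) :=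
          FreeGroup.IsReduced.append_overlap r5 r6 hc
        have := FreeGroup.IsReduced.append_overlap (L₁ := [y] ++ c) (L₂ := [y]) (L₃ := c) r7 r5 (by simp)
        simpa using this
      · exact FreeGroup.IsReduced.append_overlap r2 r1 hd
    have := FreeGroup.IsReduced.append_overlap (L₁ := d) (L₂ := y :: c) (L₃ := d ++ y :: c)
      r1 (by simpa using r4) (by simp)
    simpa using this

theorem pre_split {z d c : List (α × Bool)} {y} (h : z <+: d ++ y :: c) :
    z <+: d ∨ ∃ t, z = d ++ y :: t ∧ t <+: c := by
  rcases pre_or_pre h (List.prefix_append d (y :: c)) with h1 | ⟨t, rfl⟩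
  · exact Or.inl h1
  · rw [List.prefix_append_right_inj] at h
    cases t with
    | nil => left; simp
    | cons l t =>
      obtain ⟨rfl, h2⟩ := List.cons_prefix_cons.1 h
      exact Or.inr ⟨t, rfl, h2⟩

theorem uniq_split {f : α × Bool → Prop} : ∀ {d d' t t' : List (α × Bool)} {y y' : α × Bool},
    (∀ l ∈ d, ¬ f l) → (∀ l ∈ d', ¬ f l) → f y → f y' → d ++ y :: t = d' ++ y' :: t' →
    d = d' ∧ y = y' ∧ t = t' := by
  intro d
  induction d with
  | nil =>
    intro d' t t' y y' h1 h2 h3 h4 h5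
    cases d' with
    | nil => simpa using h5
    | cons a d' =>
      simp at h5
      exact absurd h3 (h2 y (by simp [h5.1]))
  | cons a d ih =>
    intro d' t t' y y' h1 h2 h3 h4 h5
    cases d' with
    | nil =>
      simp at h5
      exact absurd h4 (h1 y' (by simp [h5.1]))
    | cons b d' =>
      simp at h5
      obtain ⟨rfl, h5⟩ := h5
      obtain ⟨r1, r2⟩ := ih (fun l hl => h1 l (by simp [hl])) (fun l hl => h2 l (by simp [hl])) h3 h4 h5
      exact ⟨by rw [r1], r2⟩

theorem Rot.countP (S : SC cl body) {y : α × Bool} {W} (h : Rot body y W) :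
    W.countP (fun l => cl l.1 == cl y.1) = 1 := by
  obtain ⟨c, d, h1, rfl⟩ := h
  have ho := S.opp' y
  rw [h1] at ho
  rw [List.countP_append, List.countP_cons]
  have e1 : d.countP (fun l => cl l.1 == cl y.1) = 0 := by
    rw [List.countP_eq_zero]; intro l hl; simpa using ho l (by simp [hl])
  have e2 : c.countP (fun l => cl l.1 == cl y.1) = 0 := by
    rw [List.countP_eq_zero]; intro l hl; simpa using ho l (by simp [hl])
  rw [e1, e2]; simp

theorem piece (S : SC cl body) {y y' : α × Bool} {W W' z} (h : Rot body y W) (h' : Rot body y' W')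
    (hz : z <+: W) (hz' : z <+: W') (hne : ¬ (y = y' ∧ W = W')) :
    20 * z.length ≤ (body y.1).length ∧ 20 * z.length ≤ (body y'.1).length := by
  have hL := h.length
  have hL' := h'.length
  have b1 := S.big y.1
  have b2 := S.big y'.1
  obtain ⟨c, d, h1, rfl⟩ := h
  obtain ⟨c', d', h1', rfl⟩ := h'
  have ho := S.opp' y
  have ho' := S.opp' y'
  rw [h1] at ho
  rw [h1'] at ho'
  by_cases hc : cl y.1 = cl y'.1
  · have hlen := S.len _ _ hc
    suffices 20 * z.length < (body y.1).length by omega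
    by_contra hlt
    push Not at hlt
    apply hne
    rcases pre_split hz with hz | ⟨t, ht, htc⟩
    · rcases pre_split hz' with hz' | ⟨t', ht', htc'⟩
      · obtain ⟨d2, rfl⟩ := hz
        obtain ⟨d2', rfl⟩ := hz'
        obtain ⟨e1, e2⟩ := S.norep y y' hc c z d2 c' d2' (by simpa using h1) (by simpa using h1') hlt
        subst e1
        rw [h1] at h1'
        obtain ⟨e3, e4⟩ := List.append_inj h1' e2
        rw [e3, e4]; simp
      · exfalso
        have : y' ∈ d := hz.subset (by simp [ht'])
        exact ho y' (by simp [this]) hc.symm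
    · rcases pre_split hz' with hz' | ⟨t', ht', htc'⟩
      · exfalso
        have : y ∈ d' := hz'.subset (by simp [ht])
        exact ho' y (by simp [this]) hc
      · rw [ht] at ht'
        obtain ⟨e1, e2, e3⟩ := uniq_split (f := fun l => cl l.1 = cl y.1)
          (fun l hl => ho l (by simp [hl])) (fun l hl => by rw [hc]; exact ho' l (by simp [hl])) rfl hc.symm ht'
        subst e1 e2 e3
        rw [h1] at h1'
        have := List.append_cancel_right h1'
        rw [this]; simp
  · suffices z.length ≤ 2 by omega
    have c1 := Rot.countP S (y := y) (W := d ++ y :: c) ⟨c, d, h1, rfl⟩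
    have c2 := Rot.countP S (y := y') (W := d' ++ y' :: c') ⟨c', d', h1', rfl⟩
    have l1 := hz.sublist.countP_le (p := fun l => cl l.1 == cl y.1)
    have l2 := hz'.sublist.countP_le (p := fun l => cl l.1 == cl y'.1)
    rw [c1] at l1
    rw [c2] at l2
    have := List.length_eq_countP_add_countP (fun l : α × Bool => cl l.1 == cl y.1) (l := z)
    have e : z.countP (fun l : α × Bool => decide ¬ (cl l.1 == cl y.1) = true) = z.countP (fun l => cl l.1 == cl y'.1) := by
      apply List.countP_congr
      intro l _
      generalize cl l.1 = a at *
      generalize cl y.1 = b at *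
      generalize cl y'.1 = c at *
      revert hc; cases a <;> cases b <;> cases c <;> simp
    rw [e] at this
    omega

/-- the symmetrised set of relators (positive ones) -/
def RR (body : α → List (α × Bool)) : Set (FreeGroup α) :=
  {r | ∃ x, Rot body (x, true) r.toWord}

theorem RR_length {r : FreeGroup α} {x : α} (h : Rot body (x, true) r.toWord) : r.norm = (body x).length + 1 :=
  h.length

theorem btw_pre {z r : FreeGroup α} (h : Btw 1 z r) : z.toWord <+: r.toWord := by
  unfold Btw at h
  rw [td_one, td_one] at h
  have : (z * (z⁻¹ * r)).norm = z.norm + (z⁻¹ * r).norm := by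
    rw [mul_inv_cancel_left]; exact h.symm
  have := toWord_mul_of_norm this
  rw [mul_inv_cancel_left] at this
  exact ⟨_, this.symm⟩

theorem Rot.of_btw {r : FreeGroup α} {x : α} (h : Rot body (x, true) r.toWord) {z}
    (hz : Btw 1 z r ∨ Btw 1 z r⁻¹) : ∃ e : Bool, Rot body (x, e) (if e then r else r⁻¹).toWord ∧
      z.toWord <+: (if e then r else r⁻¹).toWord := by
  rcases hz with hz | hz
  · exact ⟨true, h, btw_pre hz⟩
  · refine ⟨false, ?_, btw_pre hz⟩
    have := h.inv
    simpa [nl] using this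

theorem sc_greendlinger (S : SC cl body) {n : FreeGroup α}
    (hn : n ∈ Subgroup.normalClosure (RR body)) (h1 : n ≠ 1) :
    ∃ y W A z B, Rot body y W ∧ n.toWord = A ++ z ++ B ∧ z <+: W ∧
      W.length ≤ z.length + 4 * (W.length / 20) + 2 := by
  have hg := greendlinger (R := RR body) ?_ ?_ ?_ hn h1
  · obtain ⟨r, ⟨x, hr⟩, a, z, b, e, hnorm, hz, hlen⟩ := hg
    obtain ⟨ε, h2, h3⟩ := hr.of_btw hz
    refine ⟨_, _, a.toWord, z.toWord, b.toWord, h2, ?_, h3, ?_⟩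
    · have t1 := FreeGroup.norm_mul_le a z
      have t2 := FreeGroup.norm_mul_le (a * z) b
      rw [← e] at t2
      have e1 := toWord_mul_of_norm (a := a) (b := z) (by omega)
      have e2 := toWord_mul_of_norm (a := a * z) (b := b) (by rw [← e]; omega)
      rw [e, e2, e1]
    · rw [h2.length]
      rw [RR_length hr] at hlen
      exact hlen
  · rintro r ⟨x, hr⟩
    constructor
    · have := hr.CR S
      rwa [FreeGroup.mk_toWord] at this
    · rw [RR_length hr]
      have := S.big x
      omega
  · rintro r ⟨x, hr⟩ g hcr
    have hc := hr.CR S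
    rw [FreeGroup.mk_toWord] at hc
    have hr1 : r ≠ 1 := by
      rintro rfl
      have := hr.length
      simp at this
    obtain ⟨a, b, e1, e2, e3⟩ := rotation hc hr1 hcr
    have ew : r.toWord = a.toWord ++ b.toWord := by
      rw [e1]; exact toWord_mul_of_norm (by rw [← e1]; exact e2)
    rw [ew] at hr
    have hr' := hr.rot
    refine ⟨x, ?_⟩
    have : (b * a).toWord = b.toWord ++ a.toWord := by
      rw [FreeGroup.toWord_mul, (hr'.red S).reduce_eq]
    rw [e3, this]
    exact hr'
  · rintro r ⟨x, hr⟩ r' ⟨x', hr'⟩ hne z hz hz'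
    obtain ⟨ε, h2, h3⟩ := hr.of_btw hz
    obtain ⟨ε', h2', h3'⟩ := hr'.of_btw hz'
    have := piece S h2 h2' h3 h3' (by
      rintro ⟨e1, e2⟩
      simp at e1
      obtain ⟨rfl, rfl⟩ := e1
      have := FreeGroup.toWord_injective e2
      cases ε <;> simp at this <;> exact hne this)
    rw [RR_length hr, RR_length hr']
    simp only at this
    unfold FreeGroup.norm
    omega

end P4
end KW

set_option linter.all false
namespace KW
section P5
variable {α : Type} [DecidableEq α]
variable {cl : α → Bool} {body : α → List (α × Bool)}

theorem split3 {β : Type} {A z B X Y : List β} (h : A ++ z ++ B = X ++ Y) :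
    z <:+: X ∨ z <:+: Y ∨ ∃ z1 z2, z = z1 ++ z2 ∧ z1 <:+ X ∧ z2 <+: Y := by
  rw [List.append_assoc, List.append_eq_append_iff] at h
  rcases h with ⟨e, rfl, h⟩ | ⟨e, rfl, h⟩
  · rw [List.append_eq_append_iff] at h
    rcases h with ⟨f, rfl, h⟩ | ⟨f, rfl, h⟩
    · left; exact ⟨A, f, by simp⟩
    · right; right; exact ⟨e, f, rfl, ⟨A, rfl⟩, ⟨B, h.symm⟩⟩
  · right; left; exact ⟨e, B, by rw [h]; simp⟩

theorem suffix_split {β : Type} {z X Y : List β} (h : z <:+ X ++ Y) :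
    z <:+ Y ∨ ∃ z1, z = z1 ++ Y ∧ z1 <:+ X := by
  obtain ⟨A, h⟩ := h
  rw [List.append_eq_append_iff] at h
  rcases h with ⟨e, rfl, h⟩ | ⟨e, rfl, h⟩
  · right; exact ⟨e, h, ⟨A, rfl⟩⟩
  · left; exact ⟨e, h.symm⟩

theorem prefix_split {β : Type} {z X Y : List β} (h : z <+: X ++ Y) :
    z <+: X ∨ ∃ z1, z = X ++ z1 ∧ z1 <+: Y := by
  obtain ⟨A, h⟩ := h
  rw [List.append_eq_append_iff] at h
  rcases h with ⟨e, rfl, h⟩ | ⟨e, rfl, h⟩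
  · left; exact ⟨e, rfl⟩
  · right; exact ⟨e, rfl, ⟨A, h.symm⟩⟩

theorem four {β : Type} {A z B G p G' : List β} {b : β} (h : A ++ z ++ B = (G ++ p) ++ (G' ++ [b])) :
    ∃ z1 z2 z3 z4, z = z1 ++ z2 ++ z3 ++ z4 ∧ z1 <:+: G ∧ z2 <:+: p ∧ z3 <:+: G' ∧ z4.length ≤ 1 ∧
      (z1 = [] ∨ z3 = [] ∨ (z1 <:+ G ∧ z3 <+: G')) := by
  have nilI : ∀ X : List β, [] <:+: X := fun X => ⟨[], X, by simp⟩
  rcases split3 h with h | h | ⟨l, r, rfl, hl, hr⟩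
  · obtain ⟨A', B', h⟩ := h
    rcases split3 h with h | h | ⟨l, r, rfl, hl, hr⟩
    · exact ⟨z, [], [], [], by simp, h, nilI _, nilI _, by simp, by simp⟩
    · exact ⟨[], z, [], [], by simp, nilI _, h, nilI _, by simp, by simp⟩
    · exact ⟨l, r, [], [], by simp, hl.isInfix, hr.isInfix, nilI _, by simp, by simp⟩
  · obtain ⟨A', B', h⟩ := h
    rcases split3 h with h | h | ⟨l, r, rfl, hl, hr⟩
    · exact ⟨[], [], z, [], by simp, nilI _, nilI _, h, by simp, by simp⟩
    · exact ⟨[], [], [], z, by simp, nilI _, nilI _, nilI _, by simpa using h.length_le, by simp⟩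
    · exact ⟨[], [], l, r, by simp, nilI _, nilI _, hl.isInfix, by simpa using hr.length_le, by simp⟩
  · have hr' : ∃ z3 z4, r = z3 ++ z4 ∧ z3 <+: G' ∧ z4.length ≤ 1 := by
      rcases prefix_split hr with h5 | ⟨z1, rfl, h5⟩
      · exact ⟨r, [], by simp, h5, by simp⟩
      · exact ⟨G', z1, rfl, List.prefix_rfl, by simpa using h5.length_le⟩
    obtain ⟨z3, z4, rfl, h3, h4⟩ := hr'
    rcases suffix_split hl with h5 | ⟨z1, rfl, h5⟩
    · exact ⟨[], l, z3, z4, by simp, nilI _, h5.isInfix, h3.isInfix, h4, by simp⟩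
    · exact ⟨z1, p, z3, z4, by simp, h5.isInfix, List.infix_rfl, h3.isInfix, h4, Or.inr (Or.inr ⟨h5, h3⟩)⟩

theorem invRev_subw {z W : List (α × Bool)} (h : z <:+: W) :
    FreeGroup.invRev z <:+: FreeGroup.invRev W := by
  obtain ⟨A, B, rfl⟩ := h
  exact ⟨FreeGroup.invRev B, FreeGroup.invRev A, by simp [FreeGroup.invRev_append]⟩

theorem invRev_pre {z W : List (α × Bool)} (h : z <+: W) :
    FreeGroup.invRev z <:+ FreeGroup.invRev W := by
  obtain ⟨A, rfl⟩ := h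
  exact ⟨FreeGroup.invRev A, by simp [FreeGroup.invRev_append]⟩

theorem Rot.subw {y : α × Bool} {W z} (h : Rot body y W) (hz : z <:+: W) :
    ∃ W', Rot body y W' ∧ z <+: W' := by
  obtain ⟨A, B, e⟩ := hz
  exact h.suffix e.symm

theorem piece_inv (S : SC cl body) {y : α × Bool} {W z} (h : Rot body y W) (hz : z <:+: W)
    (hz' : z <:+: FreeGroup.invRev W) : 20 * z.length ≤ (body y.1).length := by
  obtain ⟨W1, h1, h2⟩ := h.subw hz
  obtain ⟨W2, h3, h4⟩ := h.inv.subw hz'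
  exact (piece S h1 h3 h2 h4 (fun h => nl_ne y h.1.symm)).1

theorem Rot.mem (S : SC cl body) {y : α × Bool} {W} (h : Rot body y W) :
    FreeGroup.mk W ∈ Subgroup.normalClosure (RR body) := by
  obtain ⟨x, e⟩ := y
  cases e
  · have h' := h.inv
    have : FreeGroup.mk (FreeGroup.invRev W) ∈ Subgroup.normalClosure (RR body) := by
      apply Subgroup.subset_normalClosure
      refine ⟨x, ?_⟩
      rw [FreeGroup.toWord_mk, (h'.red S).reduce_eq]
      exact h'
    rw [← FreeGroup.inv_mk] at this
    exact inv_mem_iff.1 this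
  · apply Subgroup.subset_normalClosure
    refine ⟨x, ?_⟩
    rw [FreeGroup.toWord_mk, (h.red S).reduce_eq]
    exact h

theorem Rot.z2 (S : SC cl body) {y : α × Bool} {W z} (h : Rot body y W) (hz : z <:+: W)
    (hcl : ∀ l ∈ z, cl l.1 ≠ cl y.1) : z <:+: sb body y := by
  obtain ⟨c, d, h1, rfl⟩ := h
  have hd : d <:+: sb body y := by rw [h1]; exact (List.suffix_append c d).isInfix
  have hc : c <:+: sb body y := by rw [h1]; exact (List.prefix_append c d).isInfix
  have hpre : ∀ r, r <+: y :: c → (∀ l ∈ r, cl l.1 ≠ cl y.1) → r = [] := by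
    intro r hr hl
    cases r with
    | nil => rfl
    | cons a r =>
      obtain ⟨rfl, _⟩ := List.cons_prefix_cons.1 hr
      exact absurd rfl (hl a (by simp))
  obtain ⟨A, B, e⟩ := hz
  rcases split3 e with h | h | ⟨l, r, rfl, hl, hr⟩
  · exact h.trans hd
  · rcases List.infix_cons_iff.1 h with h | h
    · rw [hpre z h hcl]; exact ⟨[], sb body y, by simp⟩
    · exact h.trans hc
  · rw [hpre r hr (fun a ha => hcl a (by simp [ha]))]
    simpa using hl.isInfix.trans hd

theorem core (S : SC cl body) (c0 : Bool) (P : List (α × Bool) → Prop)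
    (hne : ∀ p, P p → p ≠ []) (hred : ∀ p, P p → FreeGroup.IsReduced p)
    (hrot : ∀ A B, P (A ++ B) → P (B ++ A)) (hcl : ∀ p, P p → ∀ l ∈ p, cl l.1 = c0)
    (hstar : ∀ y : α × Bool, cl y.1 ≠ c0 → ∀ p, P p → ∀ z, z <:+: sb body y → z <:+: p →
      20 * z.length < (body y.1).length)
    (b : α) (hb : cl b ≠ c0) :
    ∀ (n : ℕ) (g : FreeGroup α) (p : List (α × Bool)), g.norm = n → P p →
      (QuotientGroup.mk' (Subgroup.normalClosure (RR body)) g) *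
      (QuotientGroup.mk' (Subgroup.normalClosure (RR body)) (FreeGroup.mk p)) *
      (QuotientGroup.mk' (Subgroup.normalClosure (RR body)) g)⁻¹ ≠
      (QuotientGroup.mk' (Subgroup.normalClosure (RR body)) (FreeGroup.of b)) := by
  intro n
  induction n using Nat.strong_induction_on with
  | _ n ih =>
  intro g p hgn hP heq
  have ih' : ∀ (g' : FreeGroup α) p', g'.norm < g.norm → P p' → _ := 
    fun g' p' h => ih g'.norm (hgn ▸ h) g' p' rfl
  set N := Subgroup.normalClosure (RR body) with hN
  set π := QuotientGroup.mk' N with hπ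
  set G := g.toWord with hG
  have hgG : g = FreeGroup.mk G := FreeGroup.mk_toWord.symm
  have hGr : FreeGroup.IsReduced G := FreeGroup.isReduced_toWord
  have hgl : g.norm = G.length := rfl
  have nle : ∀ L : List (α × Bool), (FreeGroup.mk L).norm ≤ L.length := fun L => FreeGroup.norm_mk_le
  -- last letter
  have c1 : ∀ l G', G = G' ++ [l] → ∀ p', p = nl l :: p' → False := by
    intro l G' e p' e2
    have : P (p' ++ [nl l]) := hrot [nl l] p' (by simpa [e2] using hP)
    apply ih' (FreeGroup.mk G') _ _ this
    · have e3 : FreeGroup.mk (nl l :: p') = FreeGroup.mk [nl l] * FreeGroup.mk p' := by simp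
      rw [← heq, hgG, e, e2, e3, ← FreeGroup.mul_mk, ← FreeGroup.mul_mk]
      have : FreeGroup.mk [nl l] = (FreeGroup.mk [l])⁻¹ := by simp [FreeGroup.inv_mk, FreeGroup.invRev, nl]
      rw [this]
      simp only [map_mul, map_inv]
      group
    · have := nle G'
      rw [hgl, e]; simp; omega
  have c2 : ∀ l G', G = G' ++ [l] → ∀ p', p = p' ++ [l] → False := by
    intro l G' e p' e2
    have : P ([l] ++ p') := hrot p' [l] (by simpa [e2] using hP)
    apply ih' (FreeGroup.mk G') _ _ this
    · rw [← heq, hgG, e, e2, ← FreeGroup.mul_mk, ← FreeGroup.mul_mk, ← FreeGroup.mul_mk]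
      simp only [map_mul, map_inv]
      group
    · have := nle G'
      rw [hgl, e]; simp; omega
  have c3 : ∀ G', G = (b, false) :: G' → False := by
    intro G' e
    apply ih' (FreeGroup.mk G') _ _ hP
    · have e1 : FreeGroup.mk [(b, false)] = (FreeGroup.of b)⁻¹ := by
        simp [FreeGroup.of, FreeGroup.inv_mk, FreeGroup.invRev]
      rw [hgG, e, ← List.singleton_append, ← FreeGroup.mul_mk, e1] at heq
      simp only [map_mul, map_inv] at heq
      generalize π (FreeGroup.of b) = x at *
      generalize π (FreeGroup.mk G') = y at *
      generalize π (FreeGroup.mk p) = w at *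
      have h3 : y * w * y⁻¹ = x * (x⁻¹ * y * w * (x⁻¹ * y)⁻¹) * x⁻¹ := by group
      rw [h3, heq]; group
    · have := nle G'
      rw [hgl, e]; simp; omega
  -- short
  have c4 : ∀ y W z, Rot body y W → z <:+: W → z <:+: G → 2 * z.length ≤ W.length := by
    intro y W z hW hz hzG
    by_contra hlt
    obtain ⟨W', hW', t, rfl⟩ := hW.subw hz
    have hl := hW'.length
    rw [← hW.length] at hl
    obtain ⟨A, B, e⟩ := hzG
    have hm := hW'.mem S
    rw [← hN, ← FreeGroup.mul_mk] at hm
    have h1 : π (FreeGroup.mk z) = π (FreeGroup.mk (FreeGroup.invRev t)) := by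
      have : π (FreeGroup.mk z * FreeGroup.mk t) = 1 := by
        simpa [hπ] using hm
      rw [map_mul] at this
      rw [← FreeGroup.inv_mk, map_inv]
      exact eq_inv_of_mul_eq_one_left this
    have h2 : π (FreeGroup.mk (A ++ FreeGroup.invRev t ++ B)) = π g := by
      rw [hgG, ← e, ← FreeGroup.mul_mk, ← FreeGroup.mul_mk, ← FreeGroup.mul_mk, ← FreeGroup.mul_mk]
      simp only [map_mul, h1]
    apply ih' (FreeGroup.mk (A ++ FreeGroup.invRev t ++ B)) p _ hP
    · rw [h2]; exact heq
    · refine (nle _).trans_lt ?_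
      rw [hgl, ← e]
      simp at hl ⊢
      omega
  have c4' : ∀ y W z, Rot body y W → z <:+: W → z <:+: FreeGroup.invRev G → 2 * z.length ≤ W.length := by
    intro y W z hW hz hzG
    have := c4 _ _ (FreeGroup.invRev z) hW.inv (invRev_subw hz) (by simpa using invRev_subw hzG)
    simpa using this
  -- reducedness
  have pne := hne p hP
  have pr := hred p hP
  have r1 : FreeGroup.IsReduced (G ++ p) := by
    apply isReduced_append hGr pr
    intro a ha l hl hal
    obtain ⟨p', e⟩ : ∃ p', p = l :: p' := by
      cases p with
      | nil => simp at hl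
      | cons x p' => simp at hl; exact ⟨p', by rw [hl]⟩
    obtain ⟨G', e'⟩ : ∃ G', G = G' ++ [a] := by
      replace ha := List.mem_getLast?_eq_getLast ha
      obtain ⟨h, ha⟩ := ha
      exact ⟨_, by rw [ha]; exact (List.dropLast_append_getLast h).symm⟩
    exact c1 a G' e' p' (by rw [e, hal])
  have r2 : FreeGroup.IsReduced (p ++ FreeGroup.invRev G) := by
    apply isReduced_append pr (isReduced_invRev hGr)
    intro a ha l hl hal
    obtain ⟨p', e⟩ : ∃ p', p = p' ++ [a] := by
      replace ha := List.mem_getLast?_eq_getLast ha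
      obtain ⟨h, ha⟩ := ha
      exact ⟨_, by rw [ha]; exact (List.dropLast_append_getLast h).symm⟩
    obtain ⟨G', e'⟩ : ∃ G', FreeGroup.invRev G = l :: G' := by
      cases h : FreeGroup.invRev G with
      | nil => simp [h] at hl
      | cons x p' => simp [h] at hl; exact ⟨p', by rw [hl]⟩
    have e2 : G = FreeGroup.invRev G' ++ [nl l] := by
      rw [← FreeGroup.invRev_invRev (L₁ := G), e', FreeGroup.invRev_cons]; simp [FreeGroup.invRev, nl]
    rw [hal, nl_nl] at e2
    exact c2 a _ e2 p' e
  have r3 : FreeGroup.IsReduced (FreeGroup.invRev G ++ [(b, false)]) := by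
    apply isReduced_append (isReduced_invRev hGr) (by simp)
    intro a ha l hl hal
    obtain ⟨G', e⟩ : ∃ p', FreeGroup.invRev G = p' ++ [a] := by
      replace ha := List.mem_getLast?_eq_getLast ha
      obtain ⟨h, ha⟩ := ha
      exact ⟨_, by rw [ha]; exact (List.dropLast_append_getLast h).symm⟩
    have e2 : G = nl a :: FreeGroup.invRev G' := by
      rw [← FreeGroup.invRev_invRev (L₁ := G), e, FreeGroup.invRev_append]; simp [FreeGroup.invRev, nl]
    rw [← hal] at e2
    simp at hl
    rw [← hl] at e2
    exact c3 _ e2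
  have r4 : FreeGroup.IsReduced (p ++ FreeGroup.invRev G ++ [(b, false)]) := by
    by_cases hGe : G = []
    · simp only [hGe, FreeGroup.invRev_empty, List.append_nil]
      apply isReduced_append_cl (cl := cl) pr (by simp)
      intro a ha l hl
      simp at hl
      rw [hl, hcl p hP a ha]; exact hb
    · exact FreeGroup.IsReduced.append_overlap r2 r3 (by
        intro h; apply hGe; have := congrArg FreeGroup.invRev h; simpa using this)
  have r5 : FreeGroup.IsReduced ((G ++ p) ++ (FreeGroup.invRev G ++ [(b, false)])) := by
    have := FreeGroup.IsReduced.append_overlap r1 (by rw [List.append_assoc] at r4; exact r4) pne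
    simpa using this
  set w := (G ++ p) ++ (FreeGroup.invRev G ++ [(b, false)]) with hw
  have hwN : FreeGroup.mk w ∈ N := by
    have e1 : FreeGroup.mk [(b, false)] = (FreeGroup.of b)⁻¹ := by
      simp [FreeGroup.of, FreeGroup.inv_mk, FreeGroup.invRev]
    have : π (FreeGroup.mk w) = 1 := by
      rw [hw, ← FreeGroup.mul_mk, ← FreeGroup.mul_mk, ← FreeGroup.mul_mk, ← FreeGroup.inv_mk, e1, ← hgG]
      simp only [map_mul, map_inv]
      rw [← heq]; group
    simpa [hπ] using this
  have hw1 : FreeGroup.mk w ≠ 1 := by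
    intro h
    have := norm_mk_red r5
    rw [h] at this
    simp [hw] at this
  obtain ⟨y, W, A, z, B, hW, hz, hzW, hlen⟩ := sc_greendlinger S hwN hw1
  rw [FreeGroup.toWord_mk, r5.reduce_eq] at hz
  obtain ⟨z1, z2, z3, z4, rfl, h1, h2, h3, h4, h13⟩ := four hz.symm
  have hzW' := hzW.isInfix
  have i1 : z1 <:+: W := List.IsInfix.trans ⟨[], z2 ++ z3 ++ z4, by simp⟩ hzW'
  have i2 : z2 <:+: W := List.IsInfix.trans ⟨z1, z3 ++ z4, by simp⟩ hzW'
  have i3 : z3 <:+: W := List.IsInfix.trans ⟨z1 ++ z2, z4, by simp⟩ hzW'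
  have b1 := c4 _ _ _ hW i1 h1
  have b3 := c4' _ _ _ hW i3 h3
  have hWl := hW.length
  have hbig := S.big y.1
  have b2 : 20 * z2.length ≤ W.length := by
    by_cases hy : cl y.1 = c0
    · have hc := hW.countP S
      have : z2.length ≤ 1 := by
        rw [← hc]
        calc z2.length = z2.countP (fun l => cl l.1 == cl y.1) := by
              symm; rw [List.countP_eq_length]
              intro a ha
              simp [hy, hcl p hP a (h2.subset ha)]
          _ ≤ _ := i2.sublist.countP_le
      omega
    · have := hW.z2 S i2 (fun l hl => by rw [hcl p hP l (h2.subset hl)]; exact fun h => hy h.symm)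
      have := hstar y hy p hP z2 this h2
      omega
  have b13 : z1.length = 0 ∨ z3.length = 0 ∨ 20 * z1.length ≤ W.length ∨ 20 * z3.length ≤ W.length := by
    rcases h13 with h | h | ⟨ha, hb⟩
    · left; simp [h]
    · right; left; simp [h]
    · right; right
      have hb' := invRev_pre hb
      rw [FreeGroup.invRev_invRev] at hb'
      rcases List.suffix_or_suffix_of_suffix ha hb' with h | h
      · left
        have := piece_inv S hW i1 (h.isInfix.trans (invRev_subw i3))
        omega
      · right
        have := piece_inv S hW i3 (by simpa using invRev_subw (h.isInfix.trans i1))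
        omega
  simp only [List.length_append] at hlen
  omega

end P5
end KW

set_option linter.all false
namespace KW
section P6
variable {α : Type} [DecidableEq α]

/-- a signed letter as a group element -/
def ltr (l : α × Bool) : FreeGroup α := FreeGroup.mk [l]

theorem ltr_nl (l : α × Bool) : ltr (nl l) = (ltr l)⁻¹ := by
  simp [ltr, FreeGroup.inv_mk, FreeGroup.invRev, nl]

theorem of_eq_ltr (a : α) : FreeGroup.of a = ltr (a, true) := rfl

theorem toWord_of_red {L : List (α × Bool)} (h : FreeGroup.IsReduced L) : (FreeGroup.mk L).toWord = L := by
  rw [FreeGroup.toWord_mk, h.reduce_eq]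

theorem toWord_mul_ltr {x : FreeGroup α} {l} (h : FreeGroup.IsReduced (x.toWord ++ [l])) :
    (x * ltr l).toWord = x.toWord ++ [l] := by
  conv_lhs => rw [← FreeGroup.mk_toWord (x := x)]
  rw [ltr, FreeGroup.mul_mk, toWord_of_red h]

theorem out_or (x : FreeGroup α) (l : α × Bool) :
    FreeGroup.IsReduced (x.toWord ++ [l]) ∨ ∃ w, x.toWord = w ++ [nl l] := by
  by_cases h : ∃ w, x.toWord = w ++ [nl l]
  · exact Or.inr h
  · left
    apply isReduced_append FreeGroup.isReduced_toWord (by simp)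
    intro a ha b hb hab
    simp at hb
    subst hb
    apply h
    replace ha := List.mem_getLast?_eq_getLast ha
    obtain ⟨h0, ha⟩ := ha
    refine ⟨x.toWord.dropLast, ?_⟩
    rw [hab, nl_nl, ha]; exact (List.dropLast_append_getLast h0).symm

theorem head_mul_ltr (x : FreeGroup α) (l : α × Bool) (h1 : x ≠ 1) (h2 : x * ltr l ≠ 1) :
    (x * ltr l).toWord.head? = x.toWord.head? := by
  rcases out_or x l with h | ⟨w, hw⟩
  · rw [toWord_mul_ltr h]
    have : x.toWord ≠ [] := by simpa using h1
    rw [List.head?_append_of_ne_nil _ this]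
  · have hr : FreeGroup.IsReduced w := (FreeGroup.isReduced_toWord (x := x)).subw ⟨[], [nl l], by rw [hw]; simp⟩
    have e : x * ltr l = FreeGroup.mk w := by
      rw [← FreeGroup.mk_toWord (x := x), hw, ← FreeGroup.mul_mk]
      change _ * ltr (nl l) * _ = _
      rw [ltr_nl]; group
    rw [e, toWord_of_red hr, hw]
    rw [e] at h2
    have : w ≠ [] := by rintro rfl; exact h2 rfl
    rw [List.head?_append_of_ne_nil _ this]

/-- edge boundary -/
def bd (S : Set (FreeGroup α)) : Set (FreeGroup α × α) :=
  {e | ¬ (e.1 ∈ S ↔ e.1 * FreeGroup.of e.2 ∈ S)}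

def S0 (a : α) : Set (FreeGroup α) := {g | g.toWord.head? = some (a, true)}

theorem S0_right (a : α) (h : FreeGroup α) : {g | ¬ (g ∈ S0 a ↔ g * h ∈ S0 a)}.Finite := by
  have hl : ∀ l : α × Bool, {g | ¬ (g ∈ S0 a ↔ g * ltr l ∈ S0 a)}.Finite := by
    intro l
    apply Set.Finite.subset (s := {1, (ltr l)⁻¹}) (by simp)
    intro g hg
    by_contra hc
    simp at hc
    apply hg
    show _ = _ ↔ _ = _
    rw [head_mul_ltr g l hc.1 (fun h => hc.2 (eq_inv_of_mul_eq_one_left h))]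
  rw [← FreeGroup.mk_toWord (x := h)]
  induction h.toWord with
  | nil => simp [← FreeGroup.one_eq_mk]
  | cons l t ih =>
    have e : FreeGroup.mk (l :: t) = ltr l * FreeGroup.mk t := by simp [ltr]
    rw [e]
    have : {g | ¬ (g ∈ S0 a ↔ g * (ltr l * FreeGroup.mk t) ∈ S0 a)} ⊆
      {g | ¬ (g ∈ S0 a ↔ g * ltr l ∈ S0 a)} ∪ (fun g => g * ltr l) ⁻¹' {g | ¬ (g ∈ S0 a ↔ g * FreeGroup.mk t ∈ S0 a)} := by
      intro g hg
      simp only [Set.mem_union, Set.mem_setOf_eq, Set.mem_preimage, mul_assoc] at *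
      tauto
    exact ((hl l).union (ih.preimage (fun x _ y _ h => mul_right_cancel h))).subset this

theorem S0_inv {a b : α} (hab : b ≠ a) (g : FreeGroup α) : g ∈ S0 a ↔ g * FreeGroup.of b ∈ S0 a := by
  by_cases h1 : g = 1
  · subst h1
    simp [S0, hab]
  by_cases h2 : g * FreeGroup.of b = 1
  · rw [h2, eq_inv_of_mul_eq_one_left h2]
    simp [S0, FreeGroup.toWord_inv, FreeGroup.invRev]
  show _ = _ ↔ _ = _
  rw [of_eq_ltr, head_mul_ltr g _ h1 h2]

theorem toWord_of_pow (a : α) (n : ℕ) : (FreeGroup.of a ^ n).toWord = List.replicate n (a, true) := by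
  simp

theorem pow_inj_of_CR {p : FreeGroup α} (hp : CR p) (h1 : p ≠ 1) : Function.Injective (fun n : ℕ => p ^ n) := by
  intro m n h
  have := congrArg FreeGroup.norm h
  simp only [hp.pow] at this
  have h0 : 0 < p.norm := by rw [Nat.pos_iff_ne_zero]; simpa [FreeGroup.norm_eq_zero] using h1
  exact Nat.eq_of_mul_eq_mul_right h0 this

theorem CR.inv {p : FreeGroup α} (hp : CR p) : CR p⁻¹ := by
  unfold CR at *
  rw [← mul_inv_rev, FreeGroup.norm_inv_eq, FreeGroup.norm_inv_eq, hp]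

theorem CR.pow_word {p : FreeGroup α} (hp : CR p) (n : ℕ) :
    (p ^ (n + 1)).toWord = p.toWord ++ (p ^ n).toWord := by
  rw [pow_succ', toWord_mul_of_norm]
  rw [← pow_succ', hp.pow, hp.pow]; ring

theorem half_line {p x : FreeGroup α} (hp : CR p) {A B c d} (e : p.toWord = A ++ [c, d] ++ B)
    (hx : FreeGroup.IsReduced (x.toWord ++ [d])) (n : ℕ) :
    FreeGroup.IsReduced ((x * ltr d).toWord ++ (B ++ (p ^ n).toWord)) := by
  rw [toWord_mul_ltr hx]
  apply FreeGroup.IsReduced.append_overlap hx _ (by simp)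
  have := FreeGroup.isReduced_toWord (x := p ^ (n + 1))
  rw [hp.pow_word, e] at this
  exact this.subw ⟨A ++ [c], [], by simp⟩

theorem cone {S : Set (FreeGroup α)} {N : ℕ}
    (hm : ∀ y l, FreeGroup.IsReduced (y.toWord ++ [l]) → N < y.norm → (y ∈ S ↔ y * ltr l ∈ S)) :
    ∀ (t : List (α × Bool)) (y : FreeGroup α), FreeGroup.IsReduced (y.toWord ++ t) → N < y.norm →
      (y ∈ S ↔ y * FreeGroup.mk t ∈ S) := by
  intro t
  induction t with
  | nil => intro y _ _; simp [← FreeGroup.one_eq_mk]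
  | cons l t ih =>
    intro y hy hN
    have e : FreeGroup.mk (l :: t) = ltr l * FreeGroup.mk t := by simp [ltr]
    have h1 : FreeGroup.IsReduced (y.toWord ++ [l]) := hy.subw ⟨[], t, by simp⟩
    rw [e, ← mul_assoc, hm y l h1 hN]
    have h2 := toWord_mul_ltr h1
    apply ih
    · rw [h2]; simpa using hy
    · unfold FreeGroup.norm at *; rw [h2]; simp; omega

/-- letters at `x` as edges -/
def edg (x : FreeGroup α) (l : α × Bool) : FreeGroup α × α :=
  if l.2 then (x, l.1) else (x * ltr l, l.1)

theorem edg_bd (S : Set (FreeGroup α)) (x : FreeGroup α) (l : α × Bool) :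
    edg x l ∈ bd S ↔ ¬ (x ∈ S ↔ x * ltr l ∈ S) := by
  obtain ⟨a, e⟩ := l
  cases e
  · have : x * ltr (a, false) * FreeGroup.of a = x := by
      have := ltr_nl (a, true)
      simp only [nl, Bool.not_true] at this
      rw [this, of_eq_ltr]; group
    simp only [edg, bd, Set.mem_setOf_eq, Bool.false_eq_true, if_false, this]
    tauto
  · simp [edg, bd, of_eq_ltr]

theorem edg_inj (x : FreeGroup α) : Function.Injective (edg x) := by
  have hne : ∀ l : α × Bool, x * ltr l ≠ x := by
    intro l h
    have : ltr l = 1 := by simpa using h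
    have h2 := congrArg FreeGroup.norm this
    rw [ltr, norm_mk_red (by simp)] at h2
    simp at h2
  rintro ⟨a, e⟩ ⟨b, f⟩ h
  cases e <;> cases f <;> simp [edg] at h
  · simp [h]
  · exact absurd (by rw [h.1, mul_one]) (hne (a, false))
  · exact absurd (by rw [h.1, mul_one]) (hne (b, false))
  · simp [h]

theorem edg_of (S : Set (FreeGroup α)) (x : FreeGroup α) (e : FreeGroup α × α)
    (h : e ∉ Set.range (edg x)) : e.1 ≠ x ∧ e.1 * FreeGroup.of e.2 ≠ x := by
  obtain ⟨y, a⟩ := e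
  constructor
  · rintro rfl
    exact h ⟨(a, true), by simp [edg]⟩
  · intro hx
    apply h
    refine ⟨(a, false), ?_⟩
    have := ltr_nl (a, true)
    simp only [nl, Bool.not_true] at this
    simp only [edg, Bool.false_eq_true, if_false, this, ← of_eq_ltr, ← hx]
    simp

/-- connectivity -/
theorem bd_empty {S : Set (FreeGroup α)} (h : bd S = ∅) (x y : FreeGroup α) : x ∈ S ↔ y ∈ S := by
  have hl : ∀ l x, x ∈ S ↔ x * ltr l ∈ S := by
    intro l x
    by_contra hc
    have := (edg_bd S x l).2 hc
    rw [h] at this; exact this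
  have : ∀ (t : List (α × Bool)) x, x ∈ S ↔ x * FreeGroup.mk t ∈ S := by
    intro t
    induction t with
    | nil => intro x; simp [← FreeGroup.one_eq_mk]
    | cons l t ih =>
      intro x
      have e : FreeGroup.mk (l :: t) = ltr l * FreeGroup.mk t := by simp [ltr]
      rw [e, ← mul_assoc, hl l x, ih]
  rw [this (x⁻¹ * y).toWord x, FreeGroup.mk_toWord, mul_inv_cancel_left]

theorem bd_finite [Finite α] {S S1 : Set (FreeGroup α)} (h : (bd S1).Finite) (hs : (symmDiff S S1).Finite) :
    (bd S).Finite := by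
  have : bd S ⊆ bd S1 ∪ ((symmDiff S S1) ×ˢ Set.univ ∪
      (fun e : FreeGroup α × α => (e.1 * FreeGroup.of e.2, e.2)) ⁻¹' ((symmDiff S S1) ×ˢ Set.univ)) := by
    rintro ⟨x, a⟩ hx
    simp only [bd, Set.mem_setOf_eq, Set.mem_union, Set.mem_prod, Set.mem_preimage, Set.mem_univ, and_true,
      Set.mem_symmDiff] at *
    tauto
  refine Set.Finite.subset (h.union ((hs.prod Set.finite_univ).union ((hs.prod Set.finite_univ).preimage ?_))) this
  rintro ⟨x, a⟩ _ ⟨y, b⟩ _ h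
  simp at h
  obtain ⟨h1, rfl⟩ := h
  simp at h1
  simp [h1]

theorem two_out {a b : α} (hab : a ≠ b) (x : FreeGroup α) : ∃ l l' : α × Bool, l ≠ l' ∧
    FreeGroup.IsReduced (x.toWord ++ [l]) ∧ FreeGroup.IsReduced (x.toWord ++ [l']) := by
  have sub : ∀ l l' : α × Bool, l ≠ l' → FreeGroup.IsReduced (x.toWord ++ [l]) ∨ FreeGroup.IsReduced (x.toWord ++ [l']) := by
    intro l l' hne
    rcases out_or x l with h | ⟨w, hw⟩
    · exact Or.inl h
    rcases out_or x l' with h | ⟨w', hw'⟩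
    · exact Or.inr h
    exfalso
    rw [hw'] at hw
    have := (List.append_inj' hw rfl).2
    simp only [List.cons.injEq, and_true] at this
    apply hne
    rw [← nl_nl l, ← this, nl_nl]
  have h1 := sub (a, true) (a, false) (by simp)
  have h2 := sub (a, true) (b, true) (by simp [hab])
  have h3 := sub (a, false) (b, true) (by simp)
  by_cases ha : FreeGroup.IsReduced (x.toWord ++ [(a, true)])
  · rcases h3 with h | h
    · exact ⟨_, _, by simp, ha, h⟩
    · exact ⟨(a, true), (b, true), by simp [hab], ha, h⟩
  · exact ⟨(a, false), (b, true), by simp, by tauto, by tauto⟩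

theorem prim_core [Finite α] {p : FreeGroup α} (hp : CR p) {S1 : Set (FreeGroup α)} (hbd : (bd S1).Finite)
    (hi : S1.Infinite) (hci : S1ᶜ.Infinite) (hinv : ∀ g, g ∈ S1 ↔ g * p ∈ S1) {a b : α} (hab : a ≠ b) :
    ∃ c d : α × Bool, FreeGroup.IsReduced [c, d] ∧ ¬ [c, d] <:+: p.toWord := by
  classical
  have hex : ∃ n, ∃ S : Set (FreeGroup α), (symmDiff S S1).Finite ∧ (bd S).ncard = n :=
    ⟨_, S1, by simp, rfl⟩
  obtain ⟨S, hS, hSn⟩ := Nat.find_spec hex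
  have hmin : ∀ S' : Set (FreeGroup α), (symmDiff S' S1).Finite → (bd S).ncard ≤ (bd S').ncard := by
    intro S' h'
    rw [hSn]; exact Nat.find_min' hex ⟨S', h', rfl⟩
  have hSfin := bd_finite hbd hS
  have hSi : ∃ x, x ∈ S := by
    by_contra hc
    push Not at hc
    apply hi
    apply hS.subset
    intro x hx
    rw [Set.mem_symmDiff]; exact Or.inr ⟨hx, hc x⟩
  have hSci : ∃ x, x ∉ S := by
    by_contra hc
    push Not at hc
    apply hci
    apply hS.subset
    intro x hx
    rw [Set.mem_symmDiff]; exact Or.inl ⟨hc x, hx⟩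
  have hne : (bd S).Nonempty := by
    rw [Set.nonempty_iff_ne_empty]
    intro h
    obtain ⟨x, hx⟩ := hSi
    obtain ⟨y, hy⟩ := hSci
    exact hy ((bd_empty h x y).1 hx)
  set I := {x : FreeGroup α | ∃ l, FreeGroup.IsReduced (x.toWord ++ [l]) ∧ ¬ (x ∈ S ↔ x * ltr l ∈ S)} with hI
  have hIfin : I.Finite := by
    have : I ⊆ (fun e : FreeGroup α × α => e.1) '' (bd S) ∪ (fun e : FreeGroup α × α => e.1 * FreeGroup.of e.2) '' (bd S) := by
      rintro x ⟨⟨a, e⟩, _, h⟩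
      rw [← edg_bd] at h
      cases e
      · right
        refine ⟨_, h, ?_⟩
        have := ltr_nl (a, true)
        simp only [nl, Bool.not_true] at this
        simp only [edg, Bool.false_eq_true, if_false, this, ← of_eq_ltr]
        simp
      · left; exact ⟨_, h, by simp [edg]⟩
    exact ((hSfin.image _).union (hSfin.image _)).subset this
  have hIne : I.Nonempty := by
    obtain ⟨⟨x, a⟩, hx⟩ := hne
    rcases out_or x (a, true) with h | ⟨w, hw⟩
    · exact ⟨x, (a, true), h, hx⟩
    · have hr := FreeGroup.isReduced_toWord (x := x)
      rw [hw] at hr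
      have hrw : FreeGroup.IsReduced w := hr.subw ⟨[], [nl (a, true)], by simp⟩
      have e1 : x = FreeGroup.mk w * ltr (nl (a, true)) := by
        rw [← FreeGroup.mk_toWord (x := x), hw, ltr, FreeGroup.mul_mk]
      refine ⟨FreeGroup.mk w, nl (a, true), ?_, ?_⟩
      · rw [toWord_of_red hrw]; exact hr
      · rw [← e1]
        have : x * FreeGroup.of a = FreeGroup.mk w := by rw [e1, ltr_nl, of_eq_ltr]; group
        rw [← this]
        intro h; exact hx h.symm
  obtain ⟨x, hxI, hxmax⟩ := Set.exists_max_image I FreeGroup.norm hIfin hIne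
  have hmono : ∀ y l, FreeGroup.IsReduced (y.toWord ++ [l]) → x.norm < y.norm → (y ∈ S ↔ y * ltr l ∈ S) := by
    intro y l hy hn
    by_contra hc
    have := hxmax y ⟨l, hy, hc⟩
    omega
  have hcone := cone hmono
  -- outward neighbours of both colours
  have hboth : ∃ l l', FreeGroup.IsReduced (x.toWord ++ [l]) ∧ FreeGroup.IsReduced (x.toWord ++ [l']) ∧
      x * ltr l ∈ S ∧ x * ltr l' ∉ S := by
    by_contra hc
    push Not at hc
    obtain ⟨l0, hl0, hx0⟩ := hxI
    have hall : ∀ l, FreeGroup.IsReduced (x.toWord ++ [l]) → ¬ (x ∈ S ↔ x * ltr l ∈ S) := by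
      intro l hl
      have h1 := hc l l0 hl hl0
      have h2 := hc l0 l hl0 hl
      tauto
    obtain ⟨l1, l2, h12, hl1, hl2⟩ := two_out hab x
    set S' := symmDiff S {x} with hS'
    have hS'fin : (symmDiff S' S1).Finite := by
      apply (hS.union (Set.finite_singleton x)).subset
      intro y
      simp only [hS', Set.mem_symmDiff, Set.mem_union, Set.mem_singleton_iff]
      tauto
    have hlne : ∀ l : α × Bool, x * ltr l ≠ x := by
      intro l h
      have : ltr l = 1 := by simpa using h
      have h2 := congrArg FreeGroup.norm this
      rw [ltr, norm_mk_red (by simp)] at h2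
      simp at h2
    set D := bd S \ Set.range (edg x) with hD
    have hDfin : D.Finite := hSfin.subset Set.diff_subset
    have hlow : D ∪ {edg x l1, edg x l2} ⊆ bd S := by
      rintro e (h | h)
      · exact h.1
      · rcases h with rfl | h
        · rw [edg_bd]; exact hall _ hl1
        · rw [Set.mem_singleton_iff] at h
          subst h
          rw [edg_bd]; exact hall _ hl2
    have hup : ∃ e0, bd S' ⊆ insert e0 D := by
      have hnon : ∀ l, edg x l ∈ bd S' → ∃ w, x.toWord = w ++ [nl l] := by
        intro l hl
        rcases out_or x l with h | h
        · exfalso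
          have h1 := hall l h
          rw [edg_bd] at hl
          apply hl
          have := hlne l
          simp only [hS', Set.mem_symmDiff, Set.mem_singleton_iff]
          tauto
        · exact h
      have hD' : ∀ e ∈ bd S', e ∉ Set.range (edg x) → e ∈ D := by
        intro e he hr
        refine ⟨?_, hr⟩
        obtain ⟨g1, g2⟩ := edg_of S x e hr
        simp only [bd, Set.mem_setOf_eq, hS', Set.mem_symmDiff, Set.mem_singleton_iff] at he ⊢
        tauto
      by_cases hx' : ∃ l, edg x l ∈ bd S'
      · obtain ⟨l, hl⟩ := hx'
        refine ⟨edg x l, ?_⟩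
        intro e he
        by_cases hr : e ∈ Set.range (edg x)
        · obtain ⟨l', rfl⟩ := hr
          obtain ⟨w, hw⟩ := hnon l hl
          obtain ⟨w', hw'⟩ := hnon l' he
          rw [hw'] at hw
          have := (List.append_inj' hw rfl).2
          simp only [List.cons.injEq, and_true] at this
          left
          rw [← nl_nl l, ← this, nl_nl]
        · right; exact hD' e he hr
      · refine ⟨(1, a), ?_⟩
        intro e he
        right
        apply hD' e he
        rintro ⟨l, rfl⟩
        exact hx' ⟨l, he⟩
    obtain ⟨e0, hup⟩ := hup
    have c1 : (bd S').ncard ≤ D.ncard + 1 :=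
      (Set.ncard_le_ncard hup (hDfin.insert _)).trans (Set.ncard_insert_le _ _)
    have c2 : D.ncard + 2 ≤ (bd S).ncard := by
      rw [← Set.ncard_pair (a := edg x l1) (b := edg x l2) (fun h => h12 (edg_inj x h)),
        ← Set.ncard_union_eq _ hDfin (by simp)]
      · exact Set.ncard_le_ncard hlow hSfin
      · rw [Set.disjoint_left]
        rintro e he (rfl | h)
        · exact he.2 ⟨_, rfl⟩
        · rw [Set.mem_singleton_iff] at h
          subst h; exact he.2 ⟨_, rfl⟩
    have := hmin S' hS'fin
    omega
  obtain ⟨l, l', hl, hl', hxl, hxl'⟩ := hboth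
  refine ⟨nl l, l', ?_, ?_⟩
  · have : FreeGroup.IsReduced ([nl l] ++ [l']) := by
      apply isReduced_append (by simp) (by simp)
      intro a ha b hb
      simp at ha hb
      rw [← ha, ← hb, nl_nl]
      rintro rfl; exact hxl' hxl
    simpa using this
  rintro ⟨A, B, e⟩
  have hp1 : p ≠ 1 := by rintro rfl; simp at e
  have einv : p⁻¹.toWord = FreeGroup.invRev B ++ [nl l', l] ++ FreeGroup.invRev A := by
    rw [FreeGroup.toWord_inv, ← e, FreeGroup.invRev_append, FreeGroup.invRev_append]
    simp [FreeGroup.invRev, nl]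
  set g := x * (FreeGroup.mk (A ++ [nl l]))⁻¹ with hg
  have hnorm : ∀ l, FreeGroup.IsReduced (x.toWord ++ [l]) → x.norm < (x * ltr l).norm := by
    intro l hl
    unfold FreeGroup.norm
    rw [toWord_mul_ltr hl]; simp
  have pos : ∀ n : ℕ, g * p ^ (n + 1) ∉ S := by
    intro n
    have h1 := (hcone _ _ (half_line hp e.symm hl' n) (hnorm l' hl')).not.1 hxl'
    have : g * p ^ (n + 1) = x * ltr l' * FreeGroup.mk (B ++ (p ^ n).toWord) := by
      rw [hg, pow_succ', ← FreeGroup.mul_mk (L₁ := B), FreeGroup.mk_toWord]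
      have e2 : p = FreeGroup.mk (A ++ [nl l]) * (ltr l' * FreeGroup.mk B) := by
        rw [← FreeGroup.mk_toWord (x := p), ← e, ltr, FreeGroup.mul_mk, FreeGroup.mul_mk]; simp
      generalize p ^ n = q
      rw [e2]; group
    rw [this]; exact h1
  have neg : ∀ n : ℕ, g * (p⁻¹) ^ n ∈ S := by
    intro n
    have h1 := (hcone _ _ (half_line hp.inv einv hl n) (hnorm l hl)).1 hxl
    have : g * (p⁻¹) ^ n = x * ltr l * FreeGroup.mk (FreeGroup.invRev A ++ (p⁻¹ ^ n).toWord) := by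
      rw [hg, ← FreeGroup.mul_mk, ← FreeGroup.mul_mk, FreeGroup.mk_toWord]
      change x * (_ * ltr (nl l))⁻¹ * _ = _
      rw [ltr_nl, ← FreeGroup.inv_mk]
      group
    rw [this]; exact h1
  have i1 : ∀ n : ℕ, g ∈ S1 ↔ g * p ^ n ∈ S1 := by
    intro n
    induction n with
    | zero => simp
    | succ n ih => rw [ih, pow_succ, ← mul_assoc]; exact hinv _
  have i2 : ∀ n : ℕ, g ∈ S1 ↔ g * p⁻¹ ^ n ∈ S1 := by
    intro n
    induction n with
    | zero => simp
    | succ n ih => rw [ih, pow_succ, ← mul_assoc, hinv (g * p⁻¹ ^ n * p⁻¹)]; simp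
  have hinf : ∀ f : ℕ → FreeGroup α, Function.Injective f → (∀ n, f n ∈ symmDiff S S1) → False := by
    intro f hf hm
    exact (Set.infinite_range_of_injective hf) (hS.subset (by rintro _ ⟨n, rfl⟩; exact hm n))
  by_cases hgS : g ∈ S1
  · apply hinf (fun n => g * p ^ (n + 1))
    · intro m n h
      have := pow_inj_of_CR hp hp1 (mul_left_cancel h)
      omega
    · intro n
      rw [Set.mem_symmDiff]; exact Or.inr ⟨(i1 _).1 hgS, pos n⟩
  · apply hinf (fun n => g * p⁻¹ ^ n)
    · intro m n h
      exact pow_inj_of_CR hp.inv (by simpa using hp1) (mul_left_cancel h)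
    · intro n
      rw [Set.mem_symmDiff]; exact Or.inl ⟨neg n, (i2 n).not.1 hgS⟩

theorem primitive [Finite α] {p : FreeGroup α} (hp : CR p) (φ : FreeGroup α ≃* FreeGroup α) {a b : α}
    (hab : a ≠ b) (hpa : p = φ (FreeGroup.of a)) :
    ∃ c d : α × Bool, FreeGroup.IsReduced [c, d] ∧ ¬ [c, d] <:+: p.toWord := by
  have hinjpow : ∀ (q : FreeGroup α) , CR q → q ≠ 1 → Function.Injective (fun n : ℕ => φ (q ^ (n + 1))) := by
    intro q hq h1 m n h
    have := pow_inj_of_CR hq h1 (φ.injective h)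
    omega
  have hcr : CR (FreeGroup.of b) := by
    unfold CR
    have : (FreeGroup.of b * FreeGroup.of b) = FreeGroup.of b ^ 2 := (pow_two _).symm
    rw [this]
    unfold FreeGroup.norm
    rw [toWord_of_pow]; simp
  apply prim_core hp (S1 := {g | φ.symm g ∈ S0 b}) _ _ _ _ hab
  · -- bd finite
    have : bd {g | φ.symm g ∈ S0 b} ⊆ ⋃ c : α, (fun g => (φ g, c)) '' {g | ¬ (g ∈ S0 b ↔ g * φ.symm (FreeGroup.of c) ∈ S0 b)} := by
      rintro ⟨x, c⟩ hx
      rw [Set.mem_iUnion]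
      refine ⟨c, φ.symm x, ?_, by simp⟩
      simpa [bd] using hx
    exact (Set.finite_iUnion (fun c => (S0_right b _).image _)).subset this
  · refine Set.infinite_of_injective_forall_mem (hinjpow (FreeGroup.of b) hcr (FreeGroup.of_ne_one b)) ?_
    intro n
    simp [S0, List.replicate_succ]
  · refine Set.infinite_of_injective_forall_mem (hinjpow (FreeGroup.of b)⁻¹ hcr.inv (by simp)) ?_
    intro n
    have h := (CR.inv hcr).pow_word n
    simp only [Set.mem_compl_iff, Set.mem_setOf_eq, MulEquiv.symm_apply_apply, S0]
    rw [h]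
    simp [FreeGroup.toWord_inv, FreeGroup.invRev]
  · intro g
    simp only [Set.mem_setOf_eq, map_mul, hpa, MulEquiv.symm_apply_apply]
    exact S0_inv hab _

end P6
end KW

set_option linter.all false
namespace KW
section P7

/-- signed word of a tuple -/
def sw {r t : ℕ} (T : Fin t → FreeGroup (Fin r)) (y : Fin t × Bool) : List (Fin r × Bool) :=
  if y.2 then FreeGroup.invRev (T y.1).toWord else (T y.1).toWord

def NoRep {r t : ℕ} (T : Fin t → FreeGroup (Fin r)) (n : ℕ) : Prop :=
  ∀ y y' : Fin t × Bool, ∀ p z s p' s', sw T y = p ++ z ++ s → sw T y' = p' ++ z ++ s' →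
    n ≤ 20 * z.length → y = y' ∧ p.length = p'.length

def Full {r t : ℕ} (T : Fin t → FreeGroup (Fin r)) (n : ℕ) : Prop :=
  ∀ i z, z <:+: (T i).toWord → n ≤ 20 * z.length → ∀ c d : Fin r × Bool,
    FreeGroup.IsReduced [c, d] → [c, d] <:+: z

def Good {r t : ℕ} (T : Fin t → FreeGroup (Fin r)) (n : ℕ) : Prop :=
  1000 ≤ n ∧ (∀ i, (T i).toWord.length = n) ∧ NoRep T n ∧ Full T n

section maps
variable {α β : Type} [DecidableEq α] [DecidableEq β]

def lm (f : α → β) (L : List (α × Bool)) : List (β × Bool) := L.map (fun l => (f l.1, l.2))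

theorem lm_red {f : α → β} (hf : Function.Injective f) {L : List (α × Bool)} (h : FreeGroup.IsReduced L) :
    FreeGroup.IsReduced (lm f L) := by
  unfold FreeGroup.IsReduced lm at *
  rw [List.isChain_map]
  refine h.imp ?_
  intro a b hab h1
  exact hab (hf h1)

theorem lm_fun_inj {f : α → β} (hf : Function.Injective f) :
    Function.Injective (fun l : α × Bool => (f l.1, l.2)) := by
  rintro ⟨a, e⟩ ⟨b, e'⟩ h
  simp at h
  simp [hf h.1, h.2]

theorem lm_inj {f : α → β} (hf : Function.Injective f) {L L' : List (α × Bool)} (h : lm f L = lm f L') : L = L' :=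
  List.map_injective_iff.2 (lm_fun_inj hf) h

theorem lm_invRev (f : α → β) (L : List (α × Bool)) : lm f (FreeGroup.invRev L) = FreeGroup.invRev (lm f L) := by
  simp [lm, FreeGroup.invRev, List.map_reverse]

theorem map_mk_lm (f : α → β) (L : List (α × Bool)) : FreeGroup.map f (FreeGroup.mk L) = FreeGroup.mk (lm f L) := by
  rw [FreeGroup.map.mk]; rfl

theorem lm_length (f : α → β) (L : List (α × Bool)) : (lm f L).length = L.length := by simp [lm]

end maps

variable {k m : ℕ}

def bodyM (u : Fin k → FreeGroup (Fin m)) (v : Fin m → FreeGroup (Fin k)) :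
    Fin k ⊕ Fin m → List ((Fin k ⊕ Fin m) × Bool)
  | Sum.inl i => lm Sum.inr (u i).toWord
  | Sum.inr j => lm Sum.inl (v j).toWord

variable {u : Fin k → FreeGroup (Fin m)} {v : Fin m → FreeGroup (Fin k)}

theorem sb_inl (i : Fin k) (e : Bool) : sb (bodyM u v) (Sum.inl i, e) = lm Sum.inr (sw u (i, e)) := by
  cases e <;> simp [sb, sw, bodyM, lm_invRev]

theorem sb_inr (i : Fin m) (e : Bool) : sb (bodyM u v) (Sum.inr i, e) = lm Sum.inl (sw v (i, e)) := by
  cases e <;> simp [sb, sw, bodyM, lm_invRev]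

theorem lm_split {α β : Type} {f : α → β} {L : List (α × Bool)} {p z s : List (β × Bool)}
    (h : lm f L = p ++ z ++ s) : ∃ p1 z1 s1, L = p1 ++ z1 ++ s1 ∧ p = lm f p1 ∧ z = lm f z1 := by
  unfold lm at h
  rw [List.map_eq_append_iff] at h
  obtain ⟨q, s1, rfl, h2, rfl⟩ := h
  rw [List.map_eq_append_iff] at h2
  obtain ⟨p1, z1, rfl, h3, h4⟩ := h2
  exact ⟨p1, z1, s1, rfl, h3.symm, h4.symm⟩

theorem SC_M {n n' : ℕ} (hu : Good u n) (hv : Good v n') : SC Sum.isLeft (bodyM u v) := by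
  have hlu : ∀ i, (bodyM u v (Sum.inl i)).length = n := fun i => by
    simp only [bodyM]; rw [lm_length]; exact hu.2.1 i
  have hlv : ∀ i, (bodyM u v (Sum.inr i)).length = n' := fun i => by
    simp only [bodyM]; rw [lm_length]; exact hv.2.1 i
  constructor
  · rintro (i | j)
    · exact lm_red Sum.inr_injective FreeGroup.isReduced_toWord
    · exact lm_red Sum.inl_injective FreeGroup.isReduced_toWord
  · rintro (i | j) l hl <;> simp only [bodyM, lm, List.mem_map] at hl <;> obtain ⟨a, _, rfl⟩ := hl <;> simp
  · rintro (i | j) (i' | j') h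
    · rw [hlu, hlu]
    · simp at h
    · simp at h
    · rw [hlv, hlv]
  · rintro (i | j)
    · rw [hlu]; exact hu.1
    · rw [hlv]; exact hv.1
  · rintro ⟨i | j, e⟩ ⟨i' | j', e'⟩ h p z s p' s' h1 h2 h3
    · rw [sb_inl] at h1 h2
      obtain ⟨p1, z1, s1, e1, rfl, rfl⟩ := lm_split h1
      obtain ⟨p2, z2, s2, e2, rfl, h4⟩ := lm_split h2
      have := lm_inj Sum.inr_injective h4
      subst this
      rw [hlu, lm_length] at h3
      obtain ⟨g1, g2⟩ := hu.2.2.1 _ _ _ _ _ _ _ e1 e2 h3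
      rw [lm_length, lm_length]
      simp at g1
      simp [g1, g2]
    · simp at h
    · simp at h
    · rw [sb_inr] at h1 h2
      obtain ⟨p1, z1, s1, e1, rfl, rfl⟩ := lm_split h1
      obtain ⟨p2, z2, s2, e2, rfl, h4⟩ := lm_split h2
      have := lm_inj Sum.inl_injective h4
      subst this
      rw [hlv, lm_length] at h3
      obtain ⟨g1, g2⟩ := hv.2.2.1 _ _ _ _ _ _ _ e1 e2 h3
      rw [lm_length, lm_length]
      simp at g1
      simp [g1, g2]

theorem mixed_le {n n' : ℕ} (hu : Good u n) (hv : Good v n') :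
    Subgroup.normalClosure (mixedRels u v) ≤ Subgroup.normalClosure (RR (bodyM u v)) := by
  have S := SC_M hu hv
  apply Subgroup.normalClosure_le_normal
  have key : ∀ x, FreeGroup.of x * (FreeGroup.mk (bodyM u v x))⁻¹ ∈ Subgroup.normalClosure (RR (bodyM u v)) := by
    intro x
    have h : Rot (bodyM u v) (x, true) ((x, true) :: sb (bodyM u v) (x, true)) :=
      ⟨sb (bodyM u v) (x, true), [], by simp, by simp⟩
    have := h.mem S
    rw [FreeGroup.inv_mk, FreeGroup.of, FreeGroup.mul_mk]
    simpa [sb] using this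
  rintro r (⟨i, rfl⟩ | ⟨j, rfl⟩)
  · have := key (Sum.inl i)
    simp only [bodyM] at this
    rwa [← map_mk_lm, FreeGroup.mk_toWord] at this
  · have := key (Sum.inr j)
    simp only [bodyM] at this
    rwa [← map_mk_lm, FreeGroup.mk_toWord] at this

theorem nielsen_aut {G : Type*} [Group G] {T T' : Fin k → G} (h : NielsenEquiv T T') :
    ∃ φ : FreeGroup (Fin k) ≃* FreeGroup (Fin k), ∀ i, T' i = FreeGroup.lift T (φ (FreeGroup.of i)) := by
  unfold NielsenEquiv at h
  induction h with
  | rel T T' h =>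
    rcases h with ⟨σ, h⟩ | ⟨i, h1, h2⟩ | ⟨i, j, hij, h1, h2⟩
    · exact ⟨FreeGroup.freeGroupCongr σ, fun i => by simp [h]⟩
    · set f : FreeGroup (Fin k) →* FreeGroup (Fin k) :=
        FreeGroup.lift (Function.update FreeGroup.of i (FreeGroup.of i)⁻¹) with hf
      have hff : f.comp f = MonoidHom.id _ := by
        ext t
        by_cases ht : t = i
        · subst ht; simp [hf]
        · simp [hf, ht]
      refine ⟨MonoidHom.toMulEquiv f f hff hff, fun t => ?_⟩
      by_cases ht : t = i
      · subst ht; simp [hf, h1]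
      · simp [hf, ht, h2 t ht]
    · set f : FreeGroup (Fin k) →* FreeGroup (Fin k) :=
        FreeGroup.lift (Function.update FreeGroup.of i (FreeGroup.of i * FreeGroup.of j)) with hf
      set f' : FreeGroup (Fin k) →* FreeGroup (Fin k) :=
        FreeGroup.lift (Function.update FreeGroup.of i (FreeGroup.of i * (FreeGroup.of j)⁻¹)) with hf'
      have hff : f.comp f' = MonoidHom.id _ := by
        ext t
        by_cases ht : t = i
        · subst ht; simp [hf, hf', hij.symm]
        · simp [hf, hf', ht]
      have hff' : f'.comp f = MonoidHom.id _ := by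
        ext t
        by_cases ht : t = i
        · subst ht; simp [hf, hf', hij.symm]
        · simp [hf, hf', ht]
      refine ⟨MonoidHom.toMulEquiv f f' hff' hff, fun t => ?_⟩
      by_cases ht : t = i
      · subst ht; simp [hf, h1]
      · simp [hf, ht, h2 t ht]
  | refl T => exact ⟨MulEquiv.refl _, by simp⟩
  | symm T T' h ih =>
    obtain ⟨φ, hφ⟩ := ih
    refine ⟨φ.symm, fun i => ?_⟩
    have : FreeGroup.lift T' = (FreeGroup.lift T).comp φ.toMonoidHom := by
      ext i; simp [hφ]
    rw [this]; simp
  | trans T T' T'' h h' ih ih' =>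
    obtain ⟨φ, hφ⟩ := ih
    obtain ⟨ψ, hψ⟩ := ih'
    refine ⟨ψ.trans φ, fun i => ?_⟩
    have : FreeGroup.lift T' = (FreeGroup.lift T).comp φ.toMonoidHom := by
      ext i; simp [hφ]
    rw [hψ, this]; simp

theorem exists_cyc {α : Type} [DecidableEq α] (p : FreeGroup α) : ∃ c p0 : FreeGroup α, p = c * p0 * c⁻¹ ∧ CR p0 := by
  have h1 := FreeGroup.reduceCyclically.isCyclicallyReduced (FreeGroup.isReduced_toWord (x := p))
  have h2 := FreeGroup.reduceCyclically.conj_conjugator_reduceCyclically p.toWord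
  refine ⟨FreeGroup.mk (FreeGroup.reduceCyclically.conjugator p.toWord), FreeGroup.mk (FreeGroup.reduceCyclically p.toWord), ?_, ?_⟩
  · rw [FreeGroup.inv_mk, FreeGroup.mul_mk, FreeGroup.mul_mk, h2, FreeGroup.mk_toWord]
  · have h3 := h1.flatten_replicate 2
    simp [List.replicate_succ] at h3
    unfold CR
    rw [FreeGroup.mul_mk, norm_mk_red h3.1, norm_mk_red h1.1]
    simp; omega

theorem CR.rot {α : Type} [DecidableEq α] {p : FreeGroup α} (hp : CR p) {A B} (h : p.toWord = A ++ B) :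
    CR (FreeGroup.mk (B ++ A)) ∧ (FreeGroup.mk (B ++ A)).toWord = B ++ A := by
  have h3 := FreeGroup.isReduced_toWord (x := p ^ 3)
  rw [hp.pow_word, hp.pow_word, hp.pow_word, h] at h3
  have h1 : FreeGroup.IsReduced (B ++ A) := h3.subw ⟨A, B ++ (A ++ B), by simp⟩
  have h2 : FreeGroup.IsReduced ((B ++ A) ++ (B ++ A)) := h3.subw ⟨A, B, by simp⟩
  refine ⟨?_, toWord_of_red h1⟩
  unfold CR
  rw [FreeGroup.mul_mk, norm_mk_red h2, norm_mk_red h1]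
  simp; omega

theorem main_alg {n n' : ℕ} (hu : Good u n) (hv : Good v n') (a0 a1 : Fin k) (h01 : a0 ≠ a1) (b0 : Fin m)
    (T' : Fin k → PresentedGroup (mixedRels u v)) (hT : T' a0 = PresentedGroup.of (Sum.inr b0)) :
    ¬ NielsenEquiv (fun i : Fin k => (PresentedGroup.of (Sum.inl i) : PresentedGroup (mixedRels u v))) T' := by
  intro hN
  obtain ⟨φ, hφ⟩ := nielsen_aut hN
  have S := SC_M hu hv
  obtain ⟨c, p0, hc, hp0⟩ := exists_cyc (φ (FreeGroup.of a0))
  have e1 : FreeGroup.lift (fun i : Fin k => (PresentedGroup.of (Sum.inl i) : PresentedGroup (mixedRels u v))) =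
      (PresentedGroup.mk (mixedRels u v)).comp (FreeGroup.map Sum.inl) := by
    ext i; simp [PresentedGroup.of]
  have e2 := hφ a0
  rw [hT, e1, hc] at e2
  have e3 : (QuotientGroup.mk' (Subgroup.normalClosure (RR (bodyM u v)))) (FreeGroup.of (Sum.inr b0)) =
      (QuotientGroup.mk' (Subgroup.normalClosure (RR (bodyM u v)))) (FreeGroup.map Sum.inl (c * p0 * c⁻¹)) := by
    have : (QuotientGroup.mk' (Subgroup.normalClosure (mixedRels u v))) (FreeGroup.of (Sum.inr b0)) =
      (QuotientGroup.mk' (Subgroup.normalClosure (mixedRels u v))) (FreeGroup.map Sum.inl (c * p0 * c⁻¹)) := e2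
    rw [QuotientGroup.mk'_eq_mk'] at this ⊢
    obtain ⟨z, hz, h⟩ := this
    exact ⟨z, mixed_le hu hv hz, h⟩
  let P : List ((Fin k ⊕ Fin m) × Bool) → Prop := fun w => ∃ p : FreeGroup (Fin k), CR p ∧
    (∃ ψ : FreeGroup (Fin k) ≃* FreeGroup (Fin k), p = ψ (FreeGroup.of a0)) ∧ w = lm Sum.inl p.toWord
  have hP0 : P (lm Sum.inl p0.toWord) := by
    refine ⟨p0, hp0, ⟨φ.trans (MulAut.conj c⁻¹), ?_⟩, rfl⟩
    simp [hc]; group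
  refine core S true P ?_ ?_ ?_ ?_ ?_ (Sum.inr b0) (by simp) _ (FreeGroup.map Sum.inl c) _ rfl hP0 ?_
  · rintro _ ⟨p, hp, ⟨ψ, rfl⟩, rfl⟩ h
    have : (ψ (FreeGroup.of a0)).toWord = [] := by simpa [lm] using h
    rw [FreeGroup.toWord_eq_nil_iff] at this
    simp at this
  · rintro _ ⟨p, hp, _, rfl⟩
    exact lm_red Sum.inl_injective FreeGroup.isReduced_toWord
  · rintro A B ⟨p, hp, ⟨ψ, hψ⟩, h⟩
    obtain ⟨A', B', s', e, rfl, hB⟩ := lm_split (p := A) (z := B) (s := []) (by simpa using h.symm)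
    have hs' : s' = [] := by
      rw [e, hB] at h
      have := congrArg List.length h
      simp [lm_length] at this
      simpa using this
    subst hs' hB
    rw [List.append_nil] at e
    obtain ⟨g1, g2⟩ := hp.rot e
    refine ⟨_, g1, ⟨ψ.trans (MulAut.conj (FreeGroup.mk A')⁻¹), ?_⟩, ?_⟩
    · simp only [MulEquiv.trans_apply, ← hψ, MulAut.conj_apply]
      rw [← FreeGroup.mk_toWord (x := p), e, ← FreeGroup.mul_mk, ← FreeGroup.mul_mk]
      group
    · rw [g2]; simp [lm]
  · rintro _ ⟨p, hp, _, rfl⟩ l hl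
    simp only [lm, List.mem_map] at hl
    obtain ⟨a, _, rfl⟩ := hl
    rfl
  · rintro ⟨i | j, e⟩ hy _ ⟨p, hp, ⟨ψ, hψ⟩, rfl⟩ z hz1 hz2
    · simp at hy
    · by_contra hlt
      obtain ⟨c, d, hcd, hno⟩ := primitive hp ψ h01 hψ
      rw [sb_inr] at hz1
      obtain ⟨_, _, h1⟩ := hz1
      obtain ⟨_, z1, _, g1, _, rfl⟩ := lm_split h1.symm
      obtain ⟨_, _, h2⟩ := hz2
      obtain ⟨_, z2, _, g2, _, h3⟩ := lm_split h2.symm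
      have := lm_inj Sum.inl_injective h3
      subst this
      have i1 : z1 <:+: sw v (j, e) := ⟨_, _, g1.symm⟩
      have i2 : z1 <:+: p.toWord := ⟨_, _, g2.symm⟩
      have hl : n' ≤ 20 * z1.length := by
        simp only [bodyM] at hlt
        rw [lm_length, lm_length, hv.2.1] at hlt
        omega
      apply hno
      refine List.IsInfix.trans ?_ i2
      cases e
      · exact hv.2.2.2 j z1 (by simpa [sw] using i1) hl c d hcd
      · have i3 := invRev_subw i1
        simp only [sw, if_true, FreeGroup.invRev_invRev] at i3
        have := hv.2.2.2 j _ i3 (by simpa using hl) (nl d) (nl c) (by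
          have := isReduced_invRev hcd
          simpa [FreeGroup.invRev, nl] using this)
        have := invRev_subw this
        rw [FreeGroup.invRev_invRev] at this
        simpa [FreeGroup.invRev, nl] using this
  · rw [e3]
    simp only [map_mul, map_inv]
    rw [← map_mk_lm, FreeGroup.mk_toWord]

end P7
end KW

set_option linter.all false
namespace KW
section P8
variable {α : Type} [DecidableEq α] [Fintype α]

open Classical in
/-- reduced words of length n -/
noncomputable def Rw (α : Type) [DecidableEq α] [Fintype α] (n : ℕ) : Finset (List (α × Bool)) :=
  ((List.finite_length_eq (α × Bool) n).toFinset).filter (fun L => FreeGroup.IsReduced L)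

theorem mem_Rw {n : ℕ} {L : List (α × Bool)} : L ∈ Rw α n ↔ FreeGroup.IsReduced L ∧ L.length = n := by
  simp [Rw, and_comm]

theorem red_snoc {L : List (α × Bool)} {x : α × Bool} (hL : FreeGroup.IsReduced L) (h : ∀ a ∈ L.getLast?, x ≠ nl a) :
    FreeGroup.IsReduced (L ++ [x]) := by
  apply isReduced_append hL (by simp)
  intro a ha b hb
  simp at hb
  subst hb; exact h a ha

theorem red_snoc_iff {L : List (α × Bool)} {a x : α × Bool} :
    FreeGroup.IsReduced (L ++ [a] ++ [x]) ↔ FreeGroup.IsReduced (L ++ [a]) ∧ x ≠ nl a := by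
  constructor
  · intro h
    refine ⟨h.subw ⟨[], [x], by simp⟩, ?_⟩
    rintro rfl
    have : FreeGroup.IsReduced [a, nl a] := h.subw ⟨L, [], by simp⟩
    simp [nl] at this
  · rintro ⟨h1, h2⟩
    apply red_snoc h1
    intro b hb
    simp at hb
    subst hb; exact h2

/-- one-letter extensions -/
theorem ext_fiber {D : ℕ} (hD : Fintype.card (α × Bool) = D + 1) {q : ℕ} {L0 : List (α × Bool)}
    (h0 : L0 ∈ Rw α (q + 1)) : ((Rw α (q + 2)).filter (fun L => L.take (q + 1) = L0)).card = D := by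
  rw [mem_Rw] at h0
  obtain ⟨L1, a, rfl⟩ : ∃ L1 a, L0 = L1 ++ [a] := by
    have : L0 ≠ [] := by rintro rfl; simp at h0
    exact ⟨_, _, (List.dropLast_append_getLast this).symm⟩
  have : (Rw α (q + 2)).filter (fun L => L.take (q + 1) = L1 ++ [a]) =
      (Finset.univ.erase (nl a)).image (fun x => L1 ++ [a] ++ [x]) := by
    ext L
    simp only [Finset.mem_filter, mem_Rw, Finset.mem_image, Finset.mem_erase, Finset.mem_univ, and_true]
    constructor
    · rintro ⟨⟨h1, h2⟩, h3⟩
      have h4 := List.take_append_drop (q + 1) L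
      have h5 : (L.drop (q + 1)).length = 1 := by rw [List.length_drop, h2]; omega
      obtain ⟨x, hx⟩ := List.length_eq_one_iff.1 h5
      rw [h3, hx] at h4
      refine ⟨x, ?_, h4⟩
      rw [← h4] at h1
      exact (red_snoc_iff.1 h1).2
    · rintro ⟨x, hx, rfl⟩
      refine ⟨⟨red_snoc_iff.2 ⟨h0.1, hx⟩, ?_⟩, ?_⟩
      · have := h0.2; simp at this ⊢; omega
      · rw [← h0.2]; exact List.take_left
  rw [this, Finset.card_image_of_injective, Finset.card_erase_of_mem (Finset.mem_univ _), Finset.card_univ, hD]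
  · rfl
  · intro x y h; simpa using h

theorem ext_card {D : ℕ} (hD : Fintype.card (α × Bool) = D + 1) {q : ℕ} {Z : Finset (List (α × Bool))}
    (hZ : Z ⊆ Rw α (q + 1)) : ((Rw α (q + 2)).filter (fun L => L.take (q + 1) ∈ Z)).card ≤ D * Z.card := by
  apply Finset.card_le_mul_card_image_of_maps_to (f := fun L => L.take (q + 1))
  · intro L hL; exact (Finset.mem_filter.1 hL).2
  · intro L0 h0
    rw [← ext_fiber hD (hZ h0)]
    apply Finset.card_le_card
    intro L
    simp only [Finset.mem_filter]
    tauto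

theorem Rw_take {n i : ℕ} {L : List (α × Bool)} (h : L ∈ Rw α n) (hi : i ≤ n) : L.take i ∈ Rw α i := by
  rw [mem_Rw] at *
  refine ⟨h.1.subw (KW.take_pre _ _).isInfix, ?_⟩
  rw [List.length_take]; omega

theorem Rw_drop {n i : ℕ} {L : List (α × Bool)} (h : L ∈ Rw α n) : L.drop i ∈ Rw α (n - i) := by
  rw [mem_Rw] at *
  refine ⟨h.1.subw (List.drop_suffix _ _).isInfix, ?_⟩
  rw [List.length_drop, h.2]

theorem Rw_zero : (Rw α 0).card = 1 := by
  rw [Finset.card_eq_one]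
  refine ⟨[], ?_⟩
  ext L
  simp only [mem_Rw, List.length_eq_zero_iff, Finset.mem_singleton]
  constructor
  · exact fun h => h.2
  · rintro rfl; simp

theorem Rw_one {D : ℕ} (hD : Fintype.card (α × Bool) = D + 1) : (Rw α 1).card = D + 1 := by
  rw [← hD, ← Finset.card_univ, ← Finset.card_image_of_injective Finset.univ (f := fun x : α × Bool => [x])
    (fun x y h => by simpa using h)]
  congr 1
  ext L
  simp only [mem_Rw, List.length_eq_one_iff, Finset.mem_image, Finset.mem_univ, true_and]
  constructor
  · rintro ⟨_, x, rfl⟩; exact ⟨x, rfl⟩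
  · rintro ⟨x, rfl⟩; exact ⟨by simp, x, rfl⟩

theorem Rw_succ {D : ℕ} (hD : Fintype.card (α × Bool) = D + 1) (q : ℕ) :
    (Rw α (q + 2)).card = D * (Rw α (q + 1)).card := by
  rw [Finset.card_eq_sum_card_fiberwise (f := fun L => L.take (q + 1)) (t := Rw α (q + 1))
    (fun L hL => Rw_take hL (by omega))]
  rw [Finset.sum_congr rfl (fun L0 h0 => ext_fiber hD h0)]
  simp [mul_comm]

theorem Rw_card {D : ℕ} (hD : Fintype.card (α × Bool) = D + 1) (q : ℕ) :
    (Rw α (q + 1)).card = (D + 1) * D ^ q := by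
  induction q with
  | zero => simp [Rw_one hD]
  | succ q ih => rw [Rw_succ hD, ih, pow_succ]; ring

theorem Rw_le {D : ℕ} (hD : Fintype.card (α × Bool) = D + 1) (h3 : 3 ≤ D) (q : ℕ) :
    (Rw α q).card ≤ 2 * D ^ q := by
  cases q with
  | zero => rw [Rw_zero]; simp
  | succ q => 
    rw [Rw_card hD, pow_succ]
    nlinarith [Nat.pow_pos (n := q) (by omega : 0 < D)]

theorem Rw_ge {D : ℕ} (hD : Fintype.card (α × Bool) = D + 1) (q : ℕ) :
    D ^ q ≤ (Rw α q).card := by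
  cases q with
  | zero => rw [Rw_zero]; simp
  | succ q => 
    rw [Rw_card hD, pow_succ, mul_comm]
    exact Nat.mul_le_mul_right _ (by omega)

/-- words avoiding a two letter word -/
noncomputable def Av (c d : α × Bool) (n : ℕ) : Finset (List (α × Bool)) :=
  open Classical in (Rw α n).filter (fun L => ¬ [c, d] <:+: L)

theorem mem_Av {c d : α × Bool} {n : ℕ} {L : List (α × Bool)} : L ∈ Av c d n ↔ L ∈ Rw α n ∧ ¬ [c, d] <:+: L := by
  simp [Av]

theorem Av_step {D : ℕ} (hD : Fintype.card (α × Bool) = D + 1) (h3 : 3 ≤ D) {c d : α × Bool}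
    (hcd : FreeGroup.IsReduced [c, d]) (q : ℕ) :
    (Av c d (q + 4)).card + (Av c d (q + 1)).card ≤ D ^ 3 * (Av c d (q + 1)).card := by
  classical
  set Z := Av c d (q + 1) with hZ
  have hZR : Z ⊆ Rw α (q + 1) := fun L hL => (mem_Av.1 hL).1
  set Y1 := (Rw α (q + 2)).filter (fun L => L.take (q + 1) ∈ Z) with hY1
  set Y2 := (Rw α (q + 3)).filter (fun L => L.take (q + 2) ∈ Y1) with hY2
  set Y3 := (Rw α (q + 4)).filter (fun L => L.take (q + 3) ∈ Y2) with hY3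
  have b1 : Y1.card ≤ D * Z.card := ext_card hD hZR
  have b2 : Y2.card ≤ D * Y1.card := ext_card hD (Finset.filter_subset _ _)
  have b3 : Y3.card ≤ D * Y2.card := ext_card hD (Finset.filter_subset _ _)
  have b : Y3.card ≤ D ^ 3 * Z.card := by
    calc Y3.card ≤ D * (D * (D * Z.card)) := b3.trans (Nat.mul_le_mul_left _ (b2.trans (Nat.mul_le_mul_left _ b1)))
      _ = _ := by ring
  have memY3 : ∀ L, L ∈ Rw α (q + 4) → L.take (q + 1) ∈ Z → L ∈ Y3 := by
    intro L hL hz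
    simp only [hY3, hY2, hY1, Finset.mem_filter, List.take_take]
    refine ⟨hL, Rw_take hL (by omega), ?_, ?_⟩
    · rw [show min (q + 2) (q + 3) = q + 2 by omega]; exact Rw_take hL (by omega)
    · rw [show min (min (q + 1) (q + 2)) (q + 3) = q + 1 by omega]; exact hz
  have hx : ∀ L : List (α × Bool), ∃ x, (∀ a ∈ L.getLast?, x ≠ nl a) ∧ x ≠ nl c := by
    intro L
    have h2 : 2 < (Finset.univ : Finset (α × Bool)).card := by rw [Finset.card_univ, hD]; omega
    have key : ∀ a b : α × Bool, ∃ x, x ≠ a ∧ x ≠ b := by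
      intro a b
      by_contra hc
      push Not at hc
      have : (Finset.univ : Finset (α × Bool)) ⊆ {a, b} := by
        intro x _
        by_cases h : x = a
        · simp [h]
        · simp [hc x h]
      have := (Finset.card_le_card this).trans Finset.card_le_two
      omega
    cases h : L.getLast? with
    | none => obtain ⟨x, h1, h2⟩ := key (nl c) (nl c); exact ⟨x, by simp, h1⟩
    | some a => obtain ⟨x, h1, h2⟩ := key (nl a) (nl c); exact ⟨x, by simpa using h1, h2⟩
  choose X hX1 hX2 using hx
  set E := Z.image (fun L => L ++ [X L] ++ [c, d]) with hE
  have hEc : E.card = Z.card := by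
    apply Finset.card_image_of_injOn
    intro L hL L' hL' h
    have l1 := (mem_Rw.1 (hZR hL)).2
    have l2 := (mem_Rw.1 (hZR hL')).2
    simp only [List.append_assoc] at h
    exact (List.append_inj h (by rw [l1, l2])).1
  have hEY : E ⊆ Y3 := by
    intro L hL
    obtain ⟨L0, h0, rfl⟩ := Finset.mem_image.1 hL
    have l1 := mem_Rw.1 (hZR h0)
    apply memY3
    · rw [mem_Rw]
      refine ⟨?_, by simp [l1.2]⟩
      have r1 : FreeGroup.IsReduced (L0 ++ [X L0]) := red_snoc l1.1 (hX1 L0)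
      have r2 : FreeGroup.IsReduced ([X L0] ++ [c, d]) := by
        apply isReduced_append (by simp) hcd
        intro a ha b hb
        simp at ha hb
        subst ha hb
        intro h; apply hX2 L0; rw [h, nl_nl]
      exact FreeGroup.IsReduced.append_overlap r1 r2 (by simp)
    · have : (L0 ++ [X L0] ++ [c, d]).take (q + 1) = L0 := by rw [← l1.2]; simp
      rw [this]; exact h0
  have hAY : Av c d (q + 4) ⊆ Y3 := by
    intro L hL
    rw [mem_Av] at hL
    apply memY3 L hL.1
    rw [hZ, mem_Av]
    exact ⟨Rw_take hL.1 (by omega), fun h => hL.2 (h.trans (KW.take_pre _ _).isInfix)⟩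
  have hdis : Disjoint (Av c d (q + 4)) E := by
    rw [Finset.disjoint_left]
    intro L hL hE'
    obtain ⟨L0, h0, rfl⟩ := Finset.mem_image.1 hE'
    exact (mem_Av.1 hL).2 ⟨L0 ++ [X L0], [], by simp⟩
  rw [← hEc, ← Finset.card_union_of_disjoint hdis, hEc]
  exact (Finset.card_le_card (Finset.union_subset hAY hEY)).trans b

theorem Av_card {D : ℕ} (hD : Fintype.card (α × Bool) = D + 1) (h3 : 3 ≤ D) {c d : α × Bool}
    (hcd : FreeGroup.IsReduced [c, d]) (j : ℕ) :
    (Av c d (3 * j + 1)).card ≤ 2 * D * (D ^ 3 - 1) ^ j := by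
  induction j with
  | zero =>
    have : (Av c d 1).card ≤ (Rw α 1).card := Finset.card_le_card (fun L hL => (mem_Av.1 hL).1)
    rw [Rw_one hD] at this
    simp; omega
  | succ j ih =>
    have := Av_step hD h3 hcd (3 * j)
    have h1 : (Av c d (3 * (j + 1) + 1)).card ≤ (D ^ 3 - 1) * (Av c d (3 * j + 1)).card := by
      rw [Nat.sub_mul, one_mul]
      rw [show 3 * (j + 1) + 1 = 3 * j + 4 by ring]
      omega
    calc _ ≤ _ := h1
      _ ≤ (D ^ 3 - 1) * (2 * D * (D ^ 3 - 1) ^ j) := Nat.mul_le_mul_left _ ih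
      _ = _ := by ring

/-- predictor lemma -/
theorem predictor {D : ℕ} (hD : Fintype.card (α × Bool) = D + 1) (h3 : 3 ≤ D) {n c h : ℕ} (hc : c + h ≤ n)
    (X : Finset (List (α × Bool))) (hX : X ⊆ Rw α n) (Φ : ℕ → List (α × Bool) → Option (α × Bool))
    (hΦ : ∀ w ∈ X, ∀ i, c ≤ i → i < c + h → w[i]? = Φ i (w.take i)) : X.card ≤ 4 * D ^ (n - h) := by
  classical
  have hinj : Set.InjOn (fun w : List (α × Bool) => (w.take c, w.drop (c + h))) X := by
    intro w hw w' hw' heq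
    simp only [Prod.mk.injEq] at heq
    have l1 := (mem_Rw.1 (hX hw)).2
    have l2 := (mem_Rw.1 (hX hw')).2
    have key : ∀ i, w.take i = w'.take i := by
      intro i
      induction i with
      | zero => simp
      | succ i ih =>
        rw [List.take_add_one, List.take_add_one, ih]
        congr 2
        by_cases h1 : i < c
        · have := congrArg (fun L => L[i]?) heq.1
          simpa [List.getElem?_take, h1] using this
        · by_cases h2 : i < c + h
          · rw [hΦ w hw i (by omega) h2, hΦ w' hw' i (by omega) h2, ih]
          · have := congrArg (fun L => L[i - (c + h)]?) heq.2
            simp only [List.getElem?_drop] at this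
            rwa [show c + h + (i - (c + h)) = i by omega] at this
    have := key n
    rwa [List.take_of_length_le (by omega), List.take_of_length_le (by omega)] at this
  have hmaps : ∀ w ∈ X, (w.take c, w.drop (c + h)) ∈ (Rw α c) ×ˢ (Rw α (n - (c + h))) := by
    intro w hw
    rw [Finset.mem_product]
    exact ⟨Rw_take (hX hw) (by omega), Rw_drop (hX hw)⟩
  calc X.card ≤ ((Rw α c) ×ˢ (Rw α (n - (c + h)))).card := Finset.card_le_card_of_injOn _ hmaps hinj
    _ = (Rw α c).card * (Rw α (n - (c + h))).card := Finset.card_product _ _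
    _ ≤ (2 * D ^ c) * (2 * D ^ (n - (c + h))) := Nat.mul_le_mul (Rw_le hD h3 _) (Rw_le hD h3 _)
    _ = 4 * D ^ (c + (n - (c + h))) := by rw [pow_add]; ring
    _ = _ := by congr 2; omega

theorem avoid_count {D : ℕ} (hD : Fintype.card (α × Bool) = D + 1) (h3 : 3 ≤ D) {n a j : ℕ} {c d : α × Bool}
    (hcd : FreeGroup.IsReduced [c, d]) (hc : a + (3 * j + 1) ≤ n)
    (X : Finset (List (α × Bool))) (hX : X ⊆ Rw α n)
    (hav : ∀ w ∈ X, (w.drop a).take (3 * j + 1) ∈ Av c d (3 * j + 1)) :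
    X.card ≤ 8 * D ^ (n - 3 * j) * (D ^ 3 - 1) ^ j := by
  classical
  have hinj : Set.InjOn (fun w : List (α × Bool) => (w.take a, (w.drop a).take (3 * j + 1), w.drop (a + (3 * j + 1)))) X := by
    intro w hw w' hw' heq
    simp only [Prod.mk.injEq] at heq
    rw [← List.take_append_drop a w, ← List.take_append_drop a w', heq.1,
      ← List.take_append_drop (3 * j + 1) (w.drop a), ← List.take_append_drop (3 * j + 1) (w'.drop a), heq.2.1,
      List.drop_drop, List.drop_drop, heq.2.2]
  have hmaps : ∀ w ∈ X, (w.take a, (w.drop a).take (3 * j + 1), w.drop (a + (3 * j + 1))) ∈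
      (Rw α a) ×ˢ ((Av c d (3 * j + 1)) ×ˢ (Rw α (n - (a + (3 * j + 1))))) := by
    intro w hw
    rw [Finset.mem_product, Finset.mem_product]
    exact ⟨Rw_take (hX hw) (by omega), hav w hw, Rw_drop (hX hw)⟩
  calc X.card ≤ _ := Finset.card_le_card_of_injOn _ hmaps hinj
    _ = (Rw α a).card * ((Av c d (3 * j + 1)).card * (Rw α (n - (a + (3 * j + 1)))).card) := by
        rw [Finset.card_product, Finset.card_product]
    _ ≤ (2 * D ^ a) * ((2 * D * (D ^ 3 - 1) ^ j) * (2 * D ^ (n - (a + (3 * j + 1))))) :=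
        Nat.mul_le_mul (Rw_le hD h3 _) (Nat.mul_le_mul (Av_card hD h3 hcd _) (Rw_le hD h3 _))
    _ = 8 * D ^ (a + 1 + (n - (a + (3 * j + 1)))) * (D ^ 3 - 1) ^ j := by rw [pow_add, pow_add]; ring
    _ = _ := by congr 3; omega

/-- tuple lemma -/
theorem tuple_count {β : Type} [DecidableEq β] {t : ℕ} (A : Finset β) (E : Finset (Fin (t + 1) → β))
    (hE : E ⊆ Fintype.piFinset (fun _ => A)) (i : Fin (t + 1)) (M : ℕ)
    (hM : ∀ T0 ∈ E, ((E.filter (fun T => ∀ l, l ≠ i → T l = T0 l)).image (fun T => T i)).card ≤ M) :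
    E.card ≤ M * A.card ^ t := by
  classical
  rcases E.eq_empty_or_nonempty with rfl | ⟨T1, hT1⟩
  · simp
  let x0 := T1 i
  have h1 : E.card ≤ M * (E.image (fun T => Function.update T i x0)).card := by
    apply Finset.card_le_mul_card_image
    intro b hb
    obtain ⟨T0, hT0, rfl⟩ := Finset.mem_image.1 hb
    refine le_trans ?_ (hM T0 hT0)
    rw [← Finset.card_image_of_injOn (f := fun T : Fin (t + 1) → β => T i)]
    · apply Finset.card_le_card
      apply Finset.image_subset_image
      intro T
      simp only [Finset.mem_filter]
      rintro ⟨h, h2⟩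
      refine ⟨h, fun l hl => ?_⟩
      have := congrFun h2 l
      simpa [Function.update_of_ne hl] using this
    · intro T hT T' hT' h
      simp only [Finset.coe_filter, Set.mem_setOf_eq] at hT hT'
      have h2 := hT.2.trans hT'.2.symm
      funext l
      by_cases hl : l = i
      · subst hl; exact h
      · have := congrFun h2 l
        simpa [Function.update_of_ne hl] using this
  refine h1.trans (Nat.mul_le_mul_left _ ?_)
  have h2 : E.image (fun T => Function.update T i x0) ⊆
      Fintype.piFinset (Function.update (fun _ => A) i {x0}) := by
    intro S hS
    obtain ⟨T, hT, rfl⟩ := Finset.mem_image.1 hS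
    rw [Fintype.mem_piFinset]
    intro l
    by_cases hl : l = i
    · subst hl; simp
    · simp only [Function.update_of_ne hl]
      exact Fintype.mem_piFinset.1 (hE hT) l
  refine (Finset.card_le_card h2).trans ?_
  rw [Fintype.card_piFinset]
  have : ∀ l, (Function.update (fun _ => A) i {x0} l).card = Function.update (fun _ => A.card) i 1 l := by
    intro l
    by_cases hl : l = i
    · subst hl; simp
    · simp [Function.update_of_ne hl]
  simp only [this]
  rw [Finset.prod_update_of_mem (Finset.mem_univ i)]
  simp [Finset.card_sdiff]

end P8
end KW

set_option linter.all false
namespace KW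
section P9
variable {α : Type} [DecidableEq α] [Fintype α]

/-- source letter -/
def src (e : Bool) (w : List (α × Bool)) (a q s : ℕ) : Option (α × Bool) :=
  if e then w[a + s]? else (w[a + q - 1 - s]?).map nl

def Ev {t : ℕ} (W : Fin t → List (α × Bool)) (q : ℕ) (i i' : Fin t) (e : Bool) (a c : ℕ) : Prop :=
  ∀ s < q, (W i')[c + s]? = src e (W i) a q s

theorem ev_count {D : ℕ} (hD : Fintype.card (α × Bool) = D + 1) (h3 : 3 ≤ D) {t n q : ℕ}
    (E : Finset (Fin (t + 1) → List (α × Bool))) (hE : E ⊆ Fintype.piFinset (fun _ => Rw α n))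
    (i i' : Fin (t + 1)) (e : Bool) (a c : ℕ) (hc : c + q ≤ n)
    (hcond : i = i' → a < c ∨ (e = false ∧ a ≤ c)) (hev : ∀ W ∈ E, Ev W q i i' e a c) :
    E.card ≤ 4 * D ^ (n - q / 2) * (Rw α n).card ^ t := by
  classical
  apply tuple_count _ E hE i'
  intro T0 hT0
  apply predictor hD h3 (c := c + (q - q / 2)) (h := q / 2) (by omega) _ _
    (fun x L => if i = i' then src e L a q (x - c) else src e (T0 i) a q (x - c))
  · intro w hw x hx1 hx2
    obtain ⟨W, hW, rfl⟩ := Finset.mem_image.1 hw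
    rw [Finset.mem_filter] at hW
    have h := hev W hW.1 (x - c) (by omega)
    rw [show c + (x - c) = x by omega] at h
    by_cases hi : i = i'
    · simp only [hi, if_true]
      rw [h, ← hi]
      have hcd := hcond hi
      unfold src
      cases e
      · simp only [Bool.false_eq_true, if_false]
        rw [List.getElem?_take_of_lt]
        rcases hcd with h | h <;> omega
      · simp only [if_true]
        rw [List.getElem?_take_of_lt]
        simp at hcd
        omega
    · simp only [hi, if_false]
      rw [h, hW.2 i hi]
  · intro w hw
    obtain ⟨W, hW, rfl⟩ := Finset.mem_image.1 hw
    exact Fintype.mem_piFinset.1 (hE (Finset.mem_filter.1 hW).1) i'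

theorem av_count {D : ℕ} (hD : Fintype.card (α × Bool) = D + 1) (h3 : 3 ≤ D) {t n j : ℕ}
    (E : Finset (Fin (t + 1) → List (α × Bool))) (hE : E ⊆ Fintype.piFinset (fun _ => Rw α n))
    (i : Fin (t + 1)) (a : ℕ) (c d : α × Bool) (hcd : FreeGroup.IsReduced [c, d]) (ha : a + (3 * j + 1) ≤ n)
    (hev : ∀ W ∈ E, ((W i).drop a).take (3 * j + 1) ∈ Av c d (3 * j + 1)) :
    E.card ≤ 8 * D ^ (n - 3 * j) * (D ^ 3 - 1) ^ j * (Rw α n).card ^ t := by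
  classical
  apply tuple_count _ E hE i
  intro T0 hT0
  apply avoid_count hD h3 hcd ha
  · intro w hw
    obtain ⟨W, hW, rfl⟩ := Finset.mem_image.1 hw
    exact Fintype.mem_piFinset.1 (hE (Finset.mem_filter.1 hW).1) i
  · intro w hw
    obtain ⟨W, hW, rfl⟩ := Finset.mem_image.1 hw
    exact hev W (Finset.mem_filter.1 hW).1

def Bev {t : ℕ} (W : Fin t → List (α × Bool)) (n q : ℕ) (p : Fin t × Fin t × Bool × ℕ × ℕ) : Prop :=
  p.2.2.2.2 + q ≤ n ∧ (p.1 = p.2.1 → p.2.2.2.1 < p.2.2.2.2 ∨ (p.2.2.1 = false ∧ p.2.2.2.1 ≤ p.2.2.2.2)) ∧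
    Ev W q p.1 p.2.1 p.2.2.1 p.2.2.2.1 p.2.2.2.2

def Bav {t : ℕ} (W : Fin t → List (α × Bool)) (n j : ℕ) (p : Fin t × ℕ × (α × Bool) × (α × Bool)) : Prop :=
  FreeGroup.IsReduced [p.2.2.1, p.2.2.2] ∧ p.2.1 + (3 * j + 1) ≤ n ∧
    ((W p.1).drop p.2.1).take (3 * j + 1) ∈ Av p.2.2.1 p.2.2.2 (3 * j + 1)

def P1set (t n : ℕ) : Finset (Fin t × Fin t × Bool × ℕ × ℕ) :=
  Finset.univ ×ˢ (Finset.univ ×ˢ (Finset.univ ×ˢ (Finset.range (n + 1) ×ˢ Finset.range (n + 1))))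

def P2set (α : Type) [Fintype α] (t n : ℕ) : Finset (Fin t × ℕ × (α × Bool) × (α × Bool)) :=
  Finset.univ ×ˢ (Finset.range (n + 1) ×ˢ (Finset.univ ×ˢ Finset.univ))

open Classical in
noncomputable def BadW (α : Type) [DecidableEq α] [Fintype α] (t n : ℕ) : Finset (Fin t → List (α × Bool)) :=
  (Fintype.piFinset (fun _ => Rw α n)).filter (fun W =>
    (∃ p ∈ P1set t n, Bev W n ((n + 19) / 20) p) ∨ ∃ p ∈ P2set α t n, Bav W n (((n + 19) / 20 - 1) / 3) p)

theorem bad_count {D : ℕ} (hD : Fintype.card (α × Bool) = D + 1) (h3 : 3 ≤ D) {t n : ℕ} :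
    (BadW α (t + 1) n).card ≤ (2 * (t + 1) ^ 2 + (t + 1) * (D + 1) ^ 2) * (n + 1) ^ 2 *
      (8 * D ^ (n - 3 * (((n + 19) / 20 - 1) / 3)) * (D ^ 3 - 1) ^ (((n + 19) / 20 - 1) / 3) * (Rw α n).card ^ t) := by
  classical
  set q := (n + 19) / 20 with hq
  set j := (q - 1) / 3 with hj
  set M := 8 * D ^ (n - 3 * j) * (D ^ 3 - 1) ^ j * (Rw α n).card ^ t with hM
  let A1 := fun p => (Fintype.piFinset (fun _ : Fin (t + 1) => Rw α n)).filter (fun W => Bev W n q p)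
  let A2 := fun p => (Fintype.piFinset (fun _ : Fin (t + 1) => Rw α n)).filter (fun W => Bav W n j p)
  have hsub : BadW α (t + 1) n ⊆ (P1set (t + 1) n).biUnion A1 ∪ (P2set α (t + 1) n).biUnion A2 := by
    intro W hW
    simp only [BadW, Finset.mem_filter] at hW
    simp only [Finset.mem_union, Finset.mem_biUnion, A1, A2, Finset.mem_filter]
    rcases hW with ⟨h, ⟨p, hp, h2⟩ | ⟨p, hp, h2⟩⟩
    · exact Or.inl ⟨p, hp, h, h2⟩
    · exact Or.inr ⟨p, hp, h, h2⟩
  have hpow : 4 * D ^ (n - q / 2) ≤ 8 * D ^ (n - 3 * j) * (D ^ 3 - 1) ^ j := by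
    have h1 : D ^ (n - q / 2) ≤ D ^ (n - 3 * j) * (D ^ 2) ^ j := by
      rw [← pow_mul, ← pow_add]
      apply Nat.pow_le_pow_right (by omega)
      omega
    have h2 : (D ^ 2) ^ j ≤ (D ^ 3 - 1) ^ j := by
      apply Nat.pow_le_pow_left
      have : D ^ 2 + 1 ≤ D ^ 3 := by nlinarith [Nat.pow_pos (n := 2) (by omega : 0 < D)]
      omega
    have h4 := Nat.mul_le_mul_left (D ^ (n - 3 * j)) h2
    rw [mul_assoc]
    omega
  have b1 : ∀ p ∈ P1set (t + 1) n, (A1 p).card ≤ M := by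
    rintro p -
    by_cases hp : p.2.2.2.2 + q ≤ n ∧ (p.1 = p.2.1 → p.2.2.2.1 < p.2.2.2.2 ∨ (p.2.2.1 = false ∧ p.2.2.2.1 ≤ p.2.2.2.2))
    · refine (ev_count hD h3 (q := q) (A1 p) (Finset.filter_subset _ _) p.1 p.2.1 p.2.2.1 p.2.2.2.1 p.2.2.2.2 hp.1 hp.2
        (fun W hW => (Finset.mem_filter.1 hW).2.2.2)).trans ?_
      exact Nat.mul_le_mul_right _ hpow
    · have : A1 p = ∅ := by
        apply Finset.filter_eq_empty_iff.2
        rintro W - h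
        exact hp ⟨h.1, h.2.1⟩
      rw [this]; simp
  have b2 : ∀ p ∈ P2set α (t + 1) n, (A2 p).card ≤ M := by
    rintro p -
    by_cases hp : FreeGroup.IsReduced [p.2.2.1, p.2.2.2] ∧ p.2.1 + (3 * j + 1) ≤ n
    · exact av_count hD h3 (A2 p) (Finset.filter_subset _ _) p.1 p.2.1 p.2.2.1 p.2.2.2 hp.1 hp.2
        (fun W hW => (Finset.mem_filter.1 hW).2.2.2)
    · have : A2 p = ∅ := by
        apply Finset.filter_eq_empty_iff.2
        rintro W - h
        exact hp ⟨h.1, h.2.1⟩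
      rw [this]; simp
  have c1 : (P1set (t + 1) n).card = (t + 1) * ((t + 1) * (2 * ((n + 1) * (n + 1)))) := by
    simp [P1set, Finset.card_product]
  have c2 : (P2set α (t + 1) n).card = (t + 1) * ((n + 1) * ((D + 1) * (D + 1))) := by
    rw [P2set, Finset.card_product, Finset.card_product, Finset.card_product, Finset.card_univ, Finset.card_univ, hD]
    simp
  calc _ ≤ _ := Finset.card_le_card hsub
    _ ≤ _ := Finset.card_union_le _ _
    _ ≤ (P1set (t + 1) n).card * M + (P2set α (t + 1) n).card * M :=
      add_le_add (Finset.card_biUnion_le_card_mul _ _ _ b1) (Finset.card_biUnion_le_card_mul _ _ _ b2)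
    _ = ((P1set (t + 1) n).card + (P2set α (t + 1) n).card) * M := by ring
    _ ≤ _ := by
      apply Nat.mul_le_mul_right
      rw [c1, c2]
      have : (t + 1) * ((n + 1) * ((D + 1) * (D + 1))) ≤ (t + 1) * ((n + 1) * ((D + 1) * (D + 1))) * (n + 1) :=
        Nat.le_mul_of_pos_right _ (by omega)
      nlinarith

/-! relation to Good -/

variable {r t : ℕ}

theorem nl_map_inj {x y : Option (α × Bool)} (h : x.map nl = y.map nl) : x = y := by
  apply Option.map_injective _ h
  intro a b hab
  have := congrArg nl hab
  simpa [nl_nl] using this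

theorem map_nl_nl (x : Option (α × Bool)) : (x.map nl).map nl = x := by
  cases x <;> simp [nl_nl]

theorem invRev_get {w : List (α × Bool)} {n x : ℕ} (hw : w.length = n) (hx : x < n) :
    (FreeGroup.invRev w)[x]? = (w[n - 1 - x]?).map nl := by
  rw [FreeGroup.invRev, List.getElem?_reverse (by simpa [hw] using hx)]
  simp only [List.length_map, hw, List.getElem?_map]
  rfl

theorem ev_pos {W : Fin t → List (α × Bool)} {n q : ℕ} {i i' : Fin t} {a b : ℕ} (ha : a + q ≤ n) (hb : b + q ≤ n)
    (hne : i = i' → a ≠ b) (h : ∀ s < q, (W i)[a + s]? = (W i')[b + s]?) : ∃ p ∈ P1set t n, Bev W n q p := by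
  by_cases hlt : i = i' ∧ b < a
  · refine ⟨(i', i, true, b, a), by simp [P1set]; omega, ha, fun _ => Or.inl hlt.2, ?_⟩
    intro s hs
    simpa [src] using h s hs
  · refine ⟨(i, i', true, a, b), by simp [P1set]; omega, hb, fun hi => Or.inl ?_, ?_⟩
    · have := hne hi
      have : ¬ b < a := fun h => hlt ⟨hi, h⟩
      simp only at *
      omega
    · intro s hs
      simpa [src] using (h s hs).symm

theorem ev_neg {W : Fin t → List (α × Bool)} {n q : ℕ} {i i' : Fin t} {a b : ℕ} (ha : a + q ≤ n) (hb : b + q ≤ n)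
    (h : ∀ s < q, (W i)[a + s]? = ((W i')[b + q - 1 - s]?).map nl) : ∃ p ∈ P1set t n, Bev W n q p := by
  by_cases hlt : b ≤ a
  · refine ⟨(i', i, false, b, a), by simp [P1set]; omega, ha, fun _ => Or.inr ⟨rfl, hlt⟩, ?_⟩
    intro s hs
    simpa [src] using h s hs
  · refine ⟨(i, i', false, a, b), by simp [P1set]; omega, hb, fun hi => Or.inr ⟨rfl, by simp only; omega⟩, ?_⟩
    intro s hs
    have := h (q - 1 - s) (by omega)
    rw [show a + (q - 1 - s) = a + q - 1 - s by omega, show b + q - 1 - (q - 1 - s) = b + s by omega] at this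
    simp only [src, Bool.false_eq_true, if_false]
    rw [this, map_nl_nl]

theorem noRep_of {T : Fin t → FreeGroup (Fin r)} {n : ℕ} (hT : ∀ i, (T i).toWord.length = n)
    (h : ¬ NoRep T n) : ∃ p ∈ P1set t n, Bev (fun i => (T i).toWord) n ((n + 19) / 20) p := by
  unfold NoRep at h
  push Not at h
  obtain ⟨⟨i, e⟩, ⟨i', e'⟩, p, z, s, p', s', h1, h2, h3, h4⟩ := h
  have hl : ∀ y, (sw T y).length = n := by
    intro y; unfold sw; split
    · rw [FreeGroup.invRev_length, hT]
    · rw [hT]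
  set q := (n + 19) / 20 with hq
  have hqz : q ≤ z.length := by omega
  have la := hl (i, e)
  have lb := hl (i', e')
  rw [h1] at la
  rw [h2] at lb
  simp only [List.length_append] at la lb
  have key : ∀ x < q, (sw T (i, e))[p.length + x]? = (sw T (i', e'))[p'.length + x]? := by
    intro x hx
    have aux : ∀ p s : List (Fin r × Bool), (p ++ z ++ s)[p.length + x]? = z[x]? := by
      intro p s
      rw [List.append_assoc, List.getElem?_append_right (by omega), List.getElem?_append_left (by omega)]
      congr 1; omega
    rw [h1, h2, aux, aux]
  set a := p.length
  set b := p'.length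
  have ha : a + q ≤ n := by omega
  have hb : b + q ≤ n := by omega
  cases e <;> cases e' <;> simp only [sw, Bool.false_eq_true, if_false, if_true] at key
  · apply ev_pos (i := i) (i' := i') ha hb _ key
    rintro rfl; exact h4 rfl
  · apply ev_neg (i := i) (i' := i') (b := n - b - q) ha (by omega)
    intro x hx
    rw [key x hx, invRev_get (hT i') (by omega)]
    congr 2; omega
  · apply ev_neg (i := i') (i' := i) (b := n - a - q) hb (by omega)
    intro x hx
    rw [← key x hx, invRev_get (hT i) (by omega)]
    congr 2; omega
  · apply ev_pos (i := i) (i' := i') (a := n - a - q) (b := n - b - q) (by omega) (by omega)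
    · rintro rfl h
      exact h4 rfl (by omega)
    · intro x hx
      have := key (q - 1 - x) (by omega)
      rw [invRev_get (hT i') (by omega), invRev_get (hT i) (by omega)] at this
      have := nl_map_inj this
      rw [show n - a - q + x = n - 1 - (a + (q - 1 - x)) by omega, this]
      congr 1; omega

theorem full_of {T : Fin t → FreeGroup (Fin r)} {n : ℕ} (hn : 1 ≤ n) (hT : ∀ i, (T i).toWord.length = n)
    (h : ¬ Full T n) :
    ∃ p ∈ P2set (Fin r) t n, Bav (fun i => (T i).toWord) n (((n + 19) / 20 - 1) / 3) p := by
  unfold Full at h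
  push Not at h
  obtain ⟨i, z, ⟨p, s, hz⟩, h3, c, d, hcd, h4⟩ := h
  set j := ((n + 19) / 20 - 1) / 3 with hj
  have hl := hT i
  rw [← hz] at hl
  simp only [List.length_append] at hl
  refine ⟨(i, p.length, c, d), by simp [P2set]; omega, hcd, by simp only; omega, ?_⟩
  simp only
  have h5 : ((T i).toWord.drop p.length).take (3 * j + 1) = z.take (3 * j + 1) := by
    rw [← hz, List.append_assoc, List.drop_left, List.take_append_of_le_length (by omega)]
  rw [h5, mem_Av, mem_Rw]
  refine ⟨⟨?_, by rw [List.length_take]; omega⟩, fun h => h4 (h.trans (KW.take_pre _ _).isInfix)⟩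
  have : FreeGroup.IsReduced (T i).toWord := FreeGroup.isReduced_toWord
  refine this.subw ((KW.take_pre _ _).isInfix.trans ⟨p, s, hz⟩)

theorem mem_BadW {T : Fin t → FreeGroup (Fin r)} {n : ℕ} (hn : 1000 ≤ n) (hT : ∀ i, (T i).toWord.length = n)
    (h : ¬ Good T n) : (fun i => (T i).toWord) ∈ BadW (Fin r) t n := by
  classical
  rw [BadW, Finset.mem_filter]
  constructor
  · rw [Fintype.mem_piFinset]
    intro i
    rw [mem_Rw]
    exact ⟨FreeGroup.isReduced_toWord, hT i⟩
  · by_cases h1 : NoRep T n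
    · right
      apply full_of (by omega) hT
      intro h2
      exact h ⟨hn, hT, h1, h2⟩
    · exact Or.inl (noRep_of hT h1)

end P9
end KW

set_option linter.all false
namespace KW
section P10

theorem real_bound {θ K : ℝ} (h0 : 0 < θ) (h1 : θ < 1) (hK : 0 < K) :
    ∃ C : ℝ, 0 < C ∧ ∃ q : ℝ, 0 < q ∧ q < 1 ∧ (∀ n < 1000, 1 ≤ C * q ^ n) ∧
      ∀ n j : ℕ, n ≤ 60 * (j + 1) → K * ((n : ℝ) + 1) ^ 2 * θ ^ j ≤ C * q ^ n := by
  obtain ⟨σ, hσ0, hσ1, hσ⟩ : ∃ σ : ℝ, 0 < σ ∧ σ < 1 ∧ σ ^ 120 = θ := by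
    refine ⟨θ ^ ((1 : ℝ) / 120), Real.rpow_pos_of_pos h0 _, Real.rpow_lt_one h0.le h1 (by norm_num), ?_⟩
    rw [← Real.rpow_natCast, ← Real.rpow_mul h0.le]
    norm_num
  have ht := tendsto_pow_const_mul_const_pow_of_abs_lt_one 2 (r := σ) (by rw [abs_of_pos hσ0]; exact hσ1)
  obtain ⟨M, hM⟩ := ht.bddAbove_range
  have hM' : ∀ n : ℕ, ((n : ℝ) + 1) ^ 2 * σ ^ n ≤ M / σ := by
    intro n
    rw [le_div_iff₀ hσ0]
    have := hM ⟨n + 1, rfl⟩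
    push_cast at this
    rw [pow_succ σ n, ← mul_assoc] at this
    exact this
  have hMp : 0 < M / σ := lt_of_lt_of_le (by norm_num) (hM' 0)
  have hC1 : 0 < K * (M / σ) / θ := by positivity
  refine ⟨K * (M / σ) / θ + 1 / σ ^ 1000, by positivity, σ, hσ0, hσ1, ?_, ?_⟩
  · intro n hn
    have h2 : σ ^ 1000 ≤ σ ^ n := pow_le_pow_of_le_one hσ0.le hσ1.le (by omega)
    have h3 : 0 < σ ^ 1000 := by positivity
    have h4 : 1 ≤ 1 / σ ^ 1000 * σ ^ n := by
      rw [one_div, inv_mul_eq_div, le_div_iff₀ h3]; linarith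
    have h5 : 0 < K * (M / σ) / θ * σ ^ n := by positivity
    rw [add_mul]; linarith
  · intro n j hnj
    have h2 : θ ^ j ≤ σ ^ n * σ ^ n / θ := by
      rw [le_div_iff₀ h0, ← pow_succ, ← hσ, ← pow_mul, ← pow_add]
      exact pow_le_pow_of_le_one hσ0.le hσ1.le (by omega)
    have h5 : 0 < 1 / σ ^ 1000 * σ ^ n := by positivity
    have h6 : 0 < σ ^ n := by positivity
    calc K * ((n : ℝ) + 1) ^ 2 * θ ^ j ≤ K * ((n : ℝ) + 1) ^ 2 * (σ ^ n * σ ^ n / θ) := by gcongr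
      _ = K * (((n : ℝ) + 1) ^ 2 * σ ^ n) * σ ^ n / θ := by ring
      _ ≤ K * (M / σ) * σ ^ n / θ := by gcongr; exact hM' n
      _ = K * (M / σ) / θ * σ ^ n := by ring
      _ ≤ _ := by rw [add_mul]; linarith

def GoodSet (r t : ℕ) : Set (Fin t → FreeGroup (Fin r)) := {T | T ∈ Cset r t ∧ ∃ n, Good T n}

variable {r t : ℕ}

theorem words_inj : Function.Injective (fun (T : Fin t → FreeGroup (Fin r)) (i : Fin t) => (T i).toWord) := by
  intro T T' h
  funext i
  exact FreeGroup.toWord_injective (congrFun h i)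

theorem Sn_finite (n : ℕ) : {T | T ∈ Cset r t ∧ ∀ i, wlen (T i) = n}.Finite := by
  apply Set.Finite.of_injOn (f := fun (T : Fin t → FreeGroup (Fin r)) (i : Fin t) => (T i).toWord)
    (t := ((Fintype.piFinset (fun _ => Rw (Fin r) n) : Finset (Fin t → List (Fin r × Bool))) : Set _)) _
    words_inj.injOn (Finset.finite_toSet _)
  intro T hT
  simp only [Finset.mem_coe, Fintype.mem_piFinset, mem_Rw]
  exact fun i => ⟨FreeGroup.isReduced_toWord, hT.2 i⟩

theorem good_le (n : ℕ) : gammaA (GoodSet r t) n ≤ gammaA (Cset r t) n := by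
  apply Set.ncard_le_ncard _ (Sn_finite n)
  rintro T ⟨h1, h2⟩
  exact ⟨h1.1, h2⟩

theorem total_le {n : ℕ} (hn : 1000 ≤ n) :
    gammaA (Cset r t) n ≤ gammaA (GoodSet r t) n + (BadW (Fin r) t n).card := by
  have h1 : {T | T ∈ Cset r t ∧ ∀ i, wlen (T i) = n} ⊆
      {T | T ∈ GoodSet r t ∧ ∀ i, wlen (T i) = n} ∪ {T | (fun i => (T i).toWord) ∈ BadW (Fin r) t n} := by
    rintro T ⟨hT, hl⟩
    by_cases hg : Good T n
    · exact Or.inl ⟨⟨hT, n, hg⟩, hl⟩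
    · exact Or.inr (mem_BadW hn hl hg)
  have hf : {T : Fin t → FreeGroup (Fin r) | (fun i => (T i).toWord) ∈ BadW (Fin r) t n}.Finite :=
    Set.Finite.preimage words_inj.injOn (Finset.finite_toSet _)
  have hc : {T : Fin t → FreeGroup (Fin r) | (fun i => (T i).toWord) ∈ BadW (Fin r) t n}.ncard ≤ (BadW (Fin r) t n).card := by
    rw [← Set.ncard_coe_finset]
    exact Set.ncard_le_ncard_of_injOn (fun T i => (T i).toWord) (fun T hT => hT) words_inj.injOn (Finset.finite_toSet _)
  have hf2 : {T | T ∈ GoodSet r t ∧ ∀ i, wlen (T i) = n}.Finite :=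
    (Sn_finite n).subset (fun T h => ⟨h.1.1, h.2⟩)
  calc gammaA (Cset r t) n ≤ _ := Set.ncard_le_ncard h1 (hf2.union hf)
    _ ≤ _ := Set.ncard_union_le _ _
    _ ≤ _ := Nat.add_le_add_left hc _

theorem total_ge (hr : 2 ≤ r) {n : ℕ} (hn : 2 ≤ n) :
    ((2 * r - 1) ^ (n - 1)) ^ t ≤ gammaA (Cset r t) n := by
  have hD : Fintype.card (Fin r × Bool) = (2 * r - 1) + 1 := by simp; omega
  have hx : ∀ L : List (Fin r × Bool), ∃ x, (∀ a ∈ L.getLast?, x ≠ nl a) ∧ (∀ a ∈ L.head?, x ≠ nl a) := by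
    intro L
    have h2 : 2 < (Finset.univ : Finset (Fin r × Bool)).card := by rw [Finset.card_univ, hD]; omega
    have key : ∀ a b : Fin r × Bool, ∃ x, x ≠ a ∧ x ≠ b := by
      intro a b
      by_contra hc
      push Not at hc
      have : (Finset.univ : Finset (Fin r × Bool)) ⊆ {a, b} := by
        intro x _
        by_cases h : x = a
        · simp [h]
        · simp [hc x h]
      have := (Finset.card_le_card this).trans Finset.card_le_two
      omega
    rcases L.eq_nil_or_concat with rfl | ⟨L', b, rfl⟩
    · exact ⟨(⟨0, by omega⟩, true), by simp, by simp⟩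
    · obtain ⟨a, ha⟩ : ∃ a, (L' ++ [b]).head? = some a := by
        cases L' <;> simp
      obtain ⟨x, h1, h2⟩ := key (nl a) (nl b)
      refine ⟨x, by simpa using h2, ?_⟩
      rw [List.concat_eq_append, ha]
      simpa using h1
  choose X hX1 hX2 using hx
  have hword : ∀ L ∈ Rw (Fin r) (n - 1), (FreeGroup.mk (L ++ [X L])).toWord = L ++ [X L] := by
    intro L hL
    rw [FreeGroup.toWord_mk]
    exact (red_snoc (mem_Rw.1 hL).1 (hX1 L)).reduce_eq
  calc ((2 * r - 1) ^ (n - 1)) ^ t ≤ (Rw (Fin r) (n - 1)).card ^ t := Nat.pow_le_pow_left (Rw_ge hD _) _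
    _ = (Fintype.piFinset (fun _ : Fin t => Rw (Fin r) (n - 1))).card := by simp [Fintype.card_piFinset]
    _ = ((Fintype.piFinset (fun _ : Fin t => Rw (Fin r) (n - 1)) : Finset _) : Set (Fin t → List (Fin r × Bool))).ncard :=
        (Set.ncard_coe_finset _).symm
    _ ≤ _ := by
      apply Set.ncard_le_ncard_of_injOn (fun W i => FreeGroup.mk (W i ++ [X (W i)])) _ _ (Sn_finite n)
      · intro W hW
        simp only [Finset.mem_coe, Fintype.mem_piFinset] at hW
        have hl : ∀ i, wlen (FreeGroup.mk (W i ++ [X (W i)])) = n := by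
          intro i
          rw [wlen, hword _ (hW i), List.length_append, (mem_Rw.1 (hW i)).2]
          simp; omega
        refine ⟨⟨fun i => ?_, fun i j => by rw [hl, hl]⟩, hl⟩
        intro x y hx hy
        rw [hword _ (hW i)] at hx hy
        simp at hy
        subst hy
        have hne : W i ≠ [] := by
          intro h
          have := (mem_Rw.1 (hW i)).2
          rw [h] at this; simp at this; omega
        rw [List.head?_append_of_ne_nil _ hne] at hx
        have := hX2 (W i) x hx
        intro h
        apply this
        rw [h]; simp [nl]
      · intro W hW W' hW' h
        simp only [Finset.mem_coe, Fintype.mem_piFinset] at hW hW'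
        funext i
        have h1 := congrArg FreeGroup.toWord (congrFun h i)
        simp only at h1
        rw [hword _ (hW i), hword _ (hW' i)] at h1
        exact (List.append_inj h1 (by rw [(mem_Rw.1 (hW i)).2, (mem_Rw.1 (hW' i)).2])).1

theorem bad_ratio (hr : 2 ≤ r) {n : ℕ} (hn : 1000 ≤ n) (D : ℕ) (hDr : D = 2 * r - 1) :
    ((BadW (Fin r) (t + 1) n).card : ℝ) ≤
      ((2 * ((t : ℝ) + 1) ^ 2 + (t + 1) * (D + 1) ^ 2) * 8 * 2 ^ t * D ^ (t + 1)) * ((n : ℝ) + 1) ^ 2 *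
        (1 - 1 / (D : ℝ) ^ 3) ^ (((n + 19) / 20 - 1) / 3) * gammaA (Cset r (t + 1)) n := by
  have hD : Fintype.card (Fin r × Bool) = D + 1 := by simp; omega
  have h3 : 3 ≤ D := by omega
  set j := ((n + 19) / 20 - 1) / 3 with hj
  have hb := bad_count hD h3 (t := t) (n := n)
  rw [← hj] at hb
  have hS := total_ge (t := t + 1) hr (n := n) (by omega)
  rw [← hDr] at hS
  have hR := Rw_le hD h3 n
  have hDpos : (0 : ℝ) < D := by exact_mod_cast (by omega : 0 < D)
  have hb' : ((BadW (Fin r) (t + 1) n).card : ℝ) ≤ (2 * ((t : ℝ) + 1) ^ 2 + (t + 1) * (D + 1) ^ 2) * (n + 1) ^ 2 *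
      (8 * D ^ (n - 3 * j) * ((D : ℝ) ^ 3 - 1) ^ j * (Rw (Fin r) n).card ^ t) := by
    have : ((D ^ 3 - 1 : ℕ) : ℝ) = (D : ℝ) ^ 3 - 1 := by
      rw [Nat.cast_sub (Nat.one_le_pow _ _ (by omega))]; push_cast; ring
    rw [← this]
    exact_mod_cast hb
  have hS' : ((D : ℝ) ^ (n - 1)) ^ (t + 1) ≤ (gammaA (Cset r (t + 1)) n : ℝ) := by exact_mod_cast hS
  have hR' : ((Rw (Fin r) n).card : ℝ) ≤ 2 * (D : ℝ) ^ n := by exact_mod_cast hR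
  have hD1 : (1 : ℝ) ≤ (D : ℝ) ^ 3 := one_le_pow₀ (by exact_mod_cast (by omega : 1 ≤ D))
  have e1 : (D : ℝ) ^ (n - 3 * j) * ((D : ℝ) ^ 3 - 1) ^ j = (D : ℝ) ^ n * (1 - 1 / (D : ℝ) ^ 3) ^ j := by
    have : (D : ℝ) ^ 3 - 1 = (D : ℝ) ^ 3 * (1 - 1 / (D : ℝ) ^ 3) := by field_simp
    rw [this, mul_pow, ← pow_mul, ← mul_assoc, ← pow_add]
    congr 2
    omega
  have hθ : 0 ≤ 1 - 1 / (D : ℝ) ^ 3 := by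
    rw [sub_nonneg, div_le_one (by positivity)]; exact hD1
  set θ := 1 - 1 / (D : ℝ) ^ 3 with hθd
  have e2 : (D : ℝ) ^ n * (D ^ n) ^ t = D ^ (t + 1) * ((D : ℝ) ^ (n - 1)) ^ (t + 1) := by
    rw [← mul_pow, ← pow_succ']
    rw [← pow_succ', show n - 1 + 1 = n by omega]
  calc _ ≤ _ := hb'
    _ = (2 * ((t : ℝ) + 1) ^ 2 + (t + 1) * (D + 1) ^ 2) * (n + 1) ^ 2 *
      (8 * (D ^ n * θ ^ j) * (Rw (Fin r) n).card ^ t) := by rw [mul_assoc 8, e1]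
    _ ≤ (2 * ((t : ℝ) + 1) ^ 2 + (t + 1) * (D + 1) ^ 2) * (n + 1) ^ 2 *
      (8 * (D ^ n * θ ^ j) * (2 * (D : ℝ) ^ n) ^ t) := by gcongr
    _ = ((2 * ((t : ℝ) + 1) ^ 2 + (t + 1) * (D + 1) ^ 2) * 8 * 2 ^ t) * ((n : ℝ) + 1) ^ 2 * θ ^ j *
        ((D : ℝ) ^ n * (D ^ n) ^ t) := by rw [mul_pow]; ring
    _ = ((2 * ((t : ℝ) + 1) ^ 2 + (t + 1) * (D + 1) ^ 2) * 8 * 2 ^ t * D ^ (t + 1)) * ((n : ℝ) + 1) ^ 2 *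
        θ ^ j * ((D : ℝ) ^ (n - 1)) ^ (t + 1) := by rw [e2]; ring
    _ ≤ _ := by gcongr

theorem goodSet_generic (hr : 2 ≤ r) : ExpGenericIn (GoodSet r (t + 1)) := by
  refine ⟨fun T h => h.1, ?_⟩
  obtain ⟨D, hDr⟩ : ∃ D, D = 2 * r - 1 := ⟨_, rfl⟩
  have hDpos : (3 : ℝ) ≤ D := by exact_mod_cast (by omega : 3 ≤ D)
  have hD1 : (1 : ℝ) < (D : ℝ) ^ 3 := one_lt_pow₀ (by linarith) (by norm_num)
  have hθ0 : 0 < 1 - 1 / (D : ℝ) ^ 3 := by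
    rw [sub_pos, div_lt_one (by positivity)]; exact hD1
  have hθ1 : 1 - 1 / (D : ℝ) ^ 3 < 1 := by
    have : 0 < 1 / (D : ℝ) ^ 3 := by positivity
    linarith
  obtain ⟨C, hC, q, hq0, hq1, hsmall, hbig⟩ := real_bound hθ0 hθ1
    (K := ((2 * ((t : ℝ) + 1) ^ 2 + (t + 1) * (D + 1) ^ 2) * 8 * 2 ^ t * D ^ (t + 1))) (by positivity)
  refine ⟨C, hC, q, hq0, hq1, ?_⟩
  intro n
  have hg := good_le (r := r) (t := t + 1) n
  have hg' : (gammaA (GoodSet r (t + 1)) n : ℝ) ≤ gammaA (Cset r (t + 1)) n := by exact_mod_cast hg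
  set g : ℝ := (gammaA (GoodSet r (t + 1)) n : ℝ) with hgd
  set S : ℝ := (gammaA (Cset r (t + 1)) n : ℝ) with hSd
  have g0 : 0 ≤ g := Nat.cast_nonneg _
  have S0 : 0 ≤ S := Nat.cast_nonneg _
  have hle : g / S ≤ 1 := div_le_one_of_le₀ hg' S0
  have hge : 0 ≤ g / S := by positivity
  rw [abs_of_nonpos (by linarith)]
  by_cases hn : n < 1000
  · have := hsmall n hn
    linarith
  · have hn : 1000 ≤ n := by omega
    have hS : 0 < S := by
      have := total_ge (t := t + 1) hr (n := n) (by omega)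
      have h2 : 0 < ((2 * r - 1) ^ (n - 1)) ^ (t + 1) := Nat.pow_pos (Nat.pow_pos (by omega))
      rw [hSd]
      exact_mod_cast lt_of_lt_of_le h2 this
    have h1 := total_le (r := r) (t := t + 1) hn
    have h1' : S ≤ g + (BadW (Fin r) (t + 1) n).card := by rw [hgd, hSd]; exact_mod_cast h1
    have h2 := bad_ratio (t := t) hr hn D hDr
    have h3 := hbig n (((n + 19) / 20 - 1) / 3) (by omega)
    have h4 : S - g ≤ C * q ^ n * S := by
      calc S - g ≤ _ := by linarith
        _ ≤ _ := h2
        _ ≤ _ := by gcongr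
    rw [neg_sub, sub_le_iff_le_add, ← sub_le_iff_le_add', le_div_iff₀ hS]
    nlinarith

end P10
end KW

theorem statement2 (k m : ℕ) (hm : 2 ≤ m) (hkm : m ≤ k) :
    ∃ U : Set (Fin k → FreeGroup (Fin m)), ∃ V : Set (Fin m → FreeGroup (Fin k)),
      ExpGenericIn U ∧ ExpGenericIn V ∧
      ∀ u, u ∈ U → ∀ v, v ∈ V →
        ∀ T' : Fin k → PresentedGroup (mixedRels u v),
          T' ⟨0, by omega⟩ = PresentedGroup.of (Sum.inr (⟨0, by omega⟩ : Fin m)) →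
          ¬ NielsenEquiv
              (fun i : Fin k => PresentedGroup.of (Sum.inl i))
              T' := by
  refine ⟨KW.GoodSet m k, KW.GoodSet k m, ?_, ?_, ?_⟩
  · obtain ⟨k, rfl⟩ : ∃ k', k = k' + 1 := ⟨k - 1, by omega⟩
    exact KW.goodSet_generic hm
  · obtain ⟨m, rfl⟩ : ∃ m', m = m' + 1 := ⟨m - 1, by omega⟩
    exact KW.goodSet_generic (by omega)
  · rintro u ⟨-, n, hu⟩ v ⟨-, n', hv⟩ T' hT
    exact KW.main_alg hu hv ⟨0, by omega⟩ ⟨1, by omega⟩ (by simp) ⟨0, by omega⟩ T' hT
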